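/- arXiv:1203.4927 — 9 statements merged into one kernel-verified Lean document; each statement's English description precedes it below -/
import Mathlib

section
/- If a continuous weight function ω : [0,∞) → (0,∞) satisfies ω(t) ≤ C·exp(−γt) for some constants C, γ > 0, then ω is a fundamental weight on ℝ^d: for every continuous function f : ℝ^d → ℝ with f(x)·ω(|x|) → 0 as |x| → ∞ and every ε > 0, there exists a polynomial p in d real variables such that sup over x ∈ ℝ^d of |f(x) − p(x)|·ω(|x|) < ε. -/
open Filter MvPolynomial

lemma bw_sin_tail (t : ℝ) (n : ℕ) :
    |Real.sin t - ∑ k ∈ Finset.range n, (-1) ^ k * t ^ (2 * k + 1) / ((2 * k + 1).factorial : ℝ)|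
      ≤ (1 / 2) ^ n * Real.exp (2 * |t|) := by
  have h1 := Real.hasSum_sin t
  have h2 := Real.hasSum_sinh (2 * |t|)
  have h1' := (hasSum_nat_add_iff' n).2 h1
  have h2' := ((hasSum_nat_add_iff' n).2 h2).mul_left ((1 / 2 : ℝ) ^ n)
  have hb : ∀ k, ‖(-1 : ℝ) ^ (k + n) * t ^ (2 * (k + n) + 1) / ((2 * (k + n) + 1).factorial : ℝ)‖ ≤
      (1 / 2 : ℝ) ^ n * ((2 * |t|) ^ (2 * (k + n) + 1) / ((2 * (k + n) + 1).factorial : ℝ)) := by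
    intro k
    rw [norm_div, norm_mul, norm_pow, norm_pow, norm_neg, norm_one, one_pow, one_mul,
      Real.norm_eq_abs, RCLike.norm_natCast, mul_pow, ← mul_div_assoc, ← mul_assoc]
    gcongr
    apply le_mul_of_one_le_left (by positivity)
    have : (2 : ℝ) ^ n ≤ 2 ^ (2 * (k + n) + 1) := pow_le_pow_right₀ (by norm_num) (by omega)
    calc (1 : ℝ) = (1 / 2) ^ n * 2 ^ n := by rw [← mul_pow]; norm_num
      _ ≤ _ := by gcongr
  have := h1'.norm_le_of_bounded h2' hb
  rw [Real.norm_eq_abs] at this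
  refine this.trans ?_
  gcongr
  have h3 : 0 ≤ ∑ k ∈ Finset.range n, (2 * |t|) ^ (2 * k + 1) / ((2 * k + 1).factorial : ℝ) := by
    positivity
  have h4 : Real.sinh (2 * |t|) ≤ Real.exp (2 * |t|) := by
    rw [Real.sinh_eq]
    have := Real.exp_pos (2 * |t|)
    have := Real.exp_pos (-(2 * |t|))
    linarith
  linarith

lemma bw_poly_bound {d : ℕ} (p : MvPolynomial (Fin d) ℝ) :
    ∀ a > (0 : ℝ), ∃ K > (0 : ℝ), ∀ x : EuclideanSpace ℝ (Fin d),
      |eval (fun i => x i) p| ≤ K * Real.exp (a * ‖x‖) := by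
  induction p using MvPolynomial.induction_on with
  | C c =>
    intro a ha
    refine ⟨|c| + 1, by positivity, fun x => ?_⟩
    rw [eval_C]
    have : 1 ≤ Real.exp (a * ‖x‖) := Real.one_le_exp (by positivity)
    nlinarith [abs_nonneg c]
  | add p q hp hq =>
    intro a ha
    obtain ⟨K, hK, h1⟩ := hp a ha
    obtain ⟨L, hL, h2⟩ := hq a ha
    refine ⟨K + L, by positivity, fun x => ?_⟩
    rw [eval_add, add_mul]
    exact (abs_add_le _ _).trans (add_le_add (h1 x) (h2 x))
  | mul_X p i hp =>
    intro a ha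
    obtain ⟨K, hK, h1⟩ := hp (a / 2) (by positivity)
    refine ⟨K * (2 / a), by positivity, fun x => ?_⟩
    rw [eval_mul, eval_X, abs_mul]
    have hx : |x i| ≤ (2 / a) * Real.exp (a / 2 * ‖x‖) := by
      have h3 : |x i| ≤ ‖x‖ := PiLp.norm_apply_le x i
      have h4 := Real.add_one_le_exp (a / 2 * ‖x‖)
      calc |x i| ≤ ‖x‖ := h3
        _ = 2 / a * (a / 2 * ‖x‖) := by field_simp
        _ ≤ _ := by gcongr; linarith
    calc _ ≤ (K * Real.exp (a / 2 * ‖x‖)) * ((2 / a) * Real.exp (a / 2 * ‖x‖)) := by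
          gcongr; exact h1 x
      _ = K * (2 / a) * (Real.exp (a / 2 * ‖x‖) * Real.exp (a / 2 * ‖x‖)) := by ring
      _ = _ := by rw [← Real.exp_add]; ring_nf

/-- weighted closure of the polynomials -/
def BWA {d : ℕ} (W h : EuclideanSpace ℝ (Fin d) → ℝ) : Prop :=
  ∀ ε > (0 : ℝ), ∃ p : MvPolynomial (Fin d) ℝ, ∀ x, |h x - eval (fun i => x i) p| * W x < ε

lemma bw_sin {d : ℕ} (W : EuclideanSpace ℝ (Fin d) → ℝ) (hW : ∀ x, 0 < W x)
    (C γ : ℝ) (hC : 0 < C) (hγ : 0 < γ) (hbd : ∀ x, W x ≤ C * Real.exp (-γ * ‖x‖))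
    (δ : ℝ) (hδ : 0 < δ) (hδγ : δ ≤ γ / 4) (i : Fin d) (p : MvPolynomial (Fin d) ℝ) :
    BWA W (fun x => Real.sin (δ * x i) * eval (fun i => x i) p) := by
  intro ε hε
  obtain ⟨K, hK, hp⟩ := bw_poly_bound p (γ / 2) (by positivity)
  obtain ⟨n, hn⟩ := exists_pow_lt_of_lt_one (show 0 < ε / (K * C) by positivity)
    (show (1 / 2 : ℝ) < 1 by norm_num)
  refine ⟨(∑ k ∈ Finset.range n, MvPolynomial.C ((-1) ^ k / ((2 * k + 1).factorial : ℝ)) *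
    (MvPolynomial.C δ * X i) ^ (2 * k + 1)) * p, fun x => ?_⟩
  have e : eval (fun i => x i) (∑ k ∈ Finset.range n,
      MvPolynomial.C ((-1) ^ k / ((2 * k + 1).factorial : ℝ)) *
      (MvPolynomial.C δ * X i) ^ (2 * k + 1)) = ∑ k ∈ Finset.range n,
      (-1) ^ k * (δ * x i) ^ (2 * k + 1) / ((2 * k + 1).factorial : ℝ) := by
    rw [map_sum]
    refine Finset.sum_congr rfl fun k _ => ?_
    simp only [eval_mul, eval_C, eval_pow, eval_X]
    ring
  rw [eval_mul, e, ← sub_mul, abs_mul]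
  have h1 := bw_sin_tail (δ * x i) n
  have h2 : 2 * |δ * x i| ≤ γ / 2 * ‖x‖ := by
    have h3 : |x i| ≤ ‖x‖ := PiLp.norm_apply_le x i
    rw [abs_mul, abs_of_pos hδ]
    nlinarith [norm_nonneg x, abs_nonneg (x i)]
  have h3 := h1.trans (mul_le_mul_of_nonneg_left (Real.exp_le_exp.2 h2) (by positivity))
  calc _ ≤ ((1 / 2) ^ n * Real.exp (γ / 2 * ‖x‖)) * (K * Real.exp (γ / 2 * ‖x‖)) *
        (C * Real.exp (-γ * ‖x‖)) := by
        gcongr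
        · exact (hW x).le
        · exact hp x
        · exact hbd x
    _ = (1 / 2) ^ n * (K * C) * (Real.exp (γ / 2 * ‖x‖) * Real.exp (γ / 2 * ‖x‖) *
        Real.exp (-γ * ‖x‖)) := by ring
    _ = (1 / 2) ^ n * (K * C) := by
        rw [← Real.exp_add, ← Real.exp_add]; ring_nf; simp
    _ < ε := by rwa [lt_div_iff₀ (by positivity)] at hn

lemma BWA.add {d : ℕ} {W h k : EuclideanSpace ℝ (Fin d) → ℝ} (hW : ∀ x, 0 < W x)
    (h1 : BWA W h) (h2 : BWA W k) : BWA W (fun x => h x + k x) := by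
  intro ε hε
  obtain ⟨p, hp⟩ := h1 (ε / 2) (by positivity)
  obtain ⟨q, hq⟩ := h2 (ε / 2) (by positivity)
  refine ⟨p + q, fun x => ?_⟩
  have := hp x
  have := hq x
  rw [eval_add, add_sub_add_comm]
  have := mul_le_mul_of_nonneg_right
    (abs_add_le (h x - eval (fun i => x i) p) (k x - eval (fun i => x i) q)) (hW x).le
  linarith

lemma bw_trig {d : ℕ} (W : EuclideanSpace ℝ (Fin d) → ℝ) (hW : ∀ x, 0 < W x)
    (C γ : ℝ) (hC : 0 < C) (hγ : 0 < γ) (hbd : ∀ x, W x ≤ C * Real.exp (-γ * ‖x‖))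
    (δ : ℝ) (hδ : 0 < δ) (hδγ : δ ≤ γ / 4) (q : MvPolynomial (Fin d) ℝ) :
    ∀ p : MvPolynomial (Fin d) ℝ,
    BWA W (fun x => eval (fun i => Real.sin (δ * x i)) q * eval (fun i => x i) p) := by
  induction q using MvPolynomial.induction_on with
  | C c =>
    intro p ε hε
    exact ⟨MvPolynomial.C c * p, fun x => by simpa using hε⟩
  | add q r hq hr =>
    intro p
    simp only [eval_add, add_mul]
    exact (hq p).add hW (hr p)
  | mul_X q i hq =>
    intro p ε hε
    obtain ⟨r, hr⟩ := hq p (ε / 2) (by positivity)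
    obtain ⟨s, hs⟩ := bw_sin W hW C γ hC hγ hbd δ hδ hδγ i r (ε / 2) (by positivity)
    refine ⟨s, fun x => ?_⟩
    have h1 := hr x
    have h2 := hs x
    simp only [eval_mul, eval_X] at *
    set Q := eval (fun i => Real.sin (δ * x i)) q
    set P := eval (fun i => x i) p
    set R := eval (fun i => x i) r
    set S := eval (fun i => x i) s
    set u := Real.sin (δ * x i)
    have hu : |u| ≤ 1 := Real.abs_sin_le_one _
    have e : Q * u * P - S = u * (Q * P - R) + (u * R - S) := by ring
    have h3 : |Q * u * P - S| ≤ |Q * P - R| + |u * R - S| := by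
      rw [e]
      refine (abs_add_le _ _).trans ?_
      rw [abs_mul]
      gcongr
      exact mul_le_of_le_one_left (abs_nonneg _) hu
    have := mul_le_mul_of_nonneg_right h3 (hW x).le
    linarith

lemma bw_sw {d : ℕ} (φ : (Fin d → ℝ) → ℝ) (hφ : Continuous φ) (ε : ℝ) (hε : 0 < ε) :
    ∃ q : MvPolynomial (Fin d) ℝ, ∀ y : Fin d → ℝ, (∀ i, |y i| ≤ 1) → |φ y - eval y q| < ε := by
  let S : Set (Fin d → ℝ) := Set.Icc (fun _ => -1) (fun _ => 1)
  haveI : CompactSpace S := isCompact_iff_compactSpace.1 isCompact_Icc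
  let c : Fin d → C(S, ℝ) := fun i => ⟨fun y => y.1 i, (continuous_apply i).comp continuous_subtype_val⟩
  let A : Subalgebra ℝ C(S, ℝ) := (aeval c : MvPolynomial (Fin d) ℝ →ₐ[ℝ] C(S, ℝ)).range
  have ev : ∀ (q : MvPolynomial (Fin d) ℝ) (y : S), (aeval c q) y = eval y.1 q := by
    intro q y
    induction q using MvPolynomial.induction_on with
    | C a => simp
    | add p q hp hq => simp [hp, hq]
    | mul_X p i hp => simp [hp, c]
  have hsep : A.SeparatesPoints := by
    intro y z hyz
    have : ∃ i, y.1 i ≠ z.1 i := by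
      by_contra! h
      exact hyz (Subtype.ext (funext h))
    obtain ⟨i, hi⟩ := this
    exact ⟨c i, ⟨c i, ⟨X i, by simp⟩, rfl⟩, hi⟩
  obtain ⟨⟨g, q, rfl⟩, hg⟩ :=
    ContinuousMap.exists_mem_subalgebra_near_continuous_of_separatesPoints A hsep
      (fun y : S => φ y.1) (by fun_prop) ε hε
  refine ⟨q, fun y hy => ?_⟩
  have := hg ⟨y, fun i => (abs_le.1 (hy i)).1, fun i => (abs_le.1 (hy i)).2⟩
  rw [abs_sub_comm]
  simpa [ev] using this

/-- Bernstein's approximation theorem: an exponentially decaying weight is fundamental. -/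
theorem bernstein_fundamental_weight
    (d : ℕ) (ω : ℝ → ℝ) (hωcont : ContinuousOn ω (Set.Ici 0))
    (hωpos : ∀ t ≥ (0 : ℝ), 0 < ω t)
    (C γ : ℝ) (hC : 0 < C) (hγ : 0 < γ)
    (hbd : ∀ t ≥ (0 : ℝ), ω t ≤ C * Real.exp (-γ * t))
    (f : EuclideanSpace ℝ (Fin d) → ℝ) (hf : Continuous f)
    (hf0 : Tendsto (fun x => f x * ω ‖x‖) (cocompact (EuclideanSpace ℝ (Fin d))) (nhds 0)) :
    ∀ ε > 0, ∃ p : MvPolynomial (Fin d) ℝ,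
      ∀ x : EuclideanSpace ℝ (Fin d),
        |f x - eval (fun i => x i) p| * ω ‖x‖ < ε := by
  intro ε hε
  have hW : ∀ x : EuclideanSpace ℝ (Fin d), 0 < ω ‖x‖ := fun x => hωpos _ (norm_nonneg x)
  have hB : ∀ x : EuclideanSpace ℝ (Fin d), ω ‖x‖ ≤ C * Real.exp (-γ * ‖x‖) :=
    fun x => hbd _ (norm_nonneg x)
  have hBC : ∀ x : EuclideanSpace ℝ (Fin d), ω ‖x‖ ≤ C := fun x => (hB x).trans
    (mul_le_of_le_one_right hC.le (Real.exp_le_one_iff.2 (by nlinarith [norm_nonneg x])))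
  -- cutoff
  obtain ⟨R, hR⟩ : ∃ R : ℝ, ∀ x : EuclideanSpace ℝ (Fin d), R < ‖x‖ → |f x * ω ‖x‖| < ε / 4 := by
    have h1 := hf0.eventually (Metric.ball_mem_nhds 0 (show 0 < ε / 4 by positivity))
    rw [← Metric.cobounded_eq_cocompact, Filter.eventually_iff,
      ← Bornology.isCobounded_def, ← Bornology.isBounded_compl_iff] at h1
    obtain ⟨R, hR⟩ := h1.exists_norm_le
    refine ⟨R, fun x hx => ?_⟩
    by_contra hcon
    exact absurd (hR x (by simpa using hcon)) (not_le.2 hx)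
  let χ : EuclideanSpace ℝ (Fin d) → ℝ := fun x => max 0 (min 1 (R + 1 - ‖x‖))
  have hχc : Continuous χ := by fun_prop
  have hχ0 : ∀ x, 0 ≤ χ x := fun x => le_max_left _ _
  have hχ1 : ∀ x, χ x ≤ 1 := fun x => max_le zero_le_one (min_le_left _ _)
  let g : EuclideanSpace ℝ (Fin d) → ℝ := fun x => f x * χ x
  have hg : Continuous g := hf.mul hχc
  have hfg : ∀ x, |f x - g x| * ω ‖x‖ < ε / 4 := by
    intro x
    by_cases hx : ‖x‖ ≤ R
    · have : χ x = 1 := by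
        simp only [χ]
        rw [min_eq_left (by linarith)]; simp
      simp only [g, this]; simpa using hε
    · have h1 := hR x (not_le.1 hx)
      rw [abs_mul, abs_of_pos (hW x)] at h1
      refine lt_of_le_of_lt ?_ h1
      have : f x - g x = f x * (1 - χ x) := by simp only [g]; ring
      rw [this, abs_mul]
      have h2 : |1 - χ x| ≤ 1 := by rw [abs_le]; constructor <;> linarith [hχ0 x, hχ1 x]
      exact mul_le_mul_of_nonneg_right (mul_le_of_le_one_right (abs_nonneg _) h2) (hW x).le
  obtain ⟨B, hB0, hgB⟩ : ∃ B > 0, ∀ x, |g x| ≤ B := by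
    obtain ⟨B, hB⟩ := (isCompact_closedBall (0 : EuclideanSpace ℝ (Fin d)) (R + 1)).exists_bound_of_continuousOn
      hf.continuousOn
    refine ⟨|B| + 1, by positivity, fun x => ?_⟩
    by_cases hx : ‖x‖ ≤ R + 1
    · have h1 := hB x (by simpa using hx)
      simp only [g]
      rw [abs_mul, abs_of_nonneg (hχ0 x)]
      have : |f x| * χ x ≤ |f x| := mul_le_of_le_one_right (abs_nonneg _) (hχ1 x)
      rw [Real.norm_eq_abs] at h1
      linarith [le_abs_self B]
    · have : χ x = 0 := max_eq_left ((min_le_right _ _).trans (by linarith [not_le.1 hx]))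
      simp only [g, this, mul_zero, abs_zero]
      positivity
  -- choice of δ
  obtain ⟨δ, hδ, hδγ, hδε⟩ : ∃ δ > 0, δ ≤ γ / 4 ∧
      2 * B * (C * Real.exp (-γ * (Real.pi / 2 / δ))) < ε / 4 := by
    have ht : Tendsto (fun r : ℝ => 2 * B * (C * Real.exp (-γ * r))) atTop (nhds 0) := by
      have h1 : Tendsto (fun r : ℝ => -γ * r) atTop atBot :=
        tendsto_id.const_mul_atTop_of_neg (by linarith)
      simpa using ((Real.tendsto_exp_atBot.comp h1).const_mul C).const_mul (2 * B)
    obtain ⟨r, hr1, hr2, hr3⟩ := ((ht.eventually (gt_mem_nhds (show 0 < ε / 4 by positivity))).and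
      ((eventually_ge_atTop (Real.pi / 2 / (γ / 4))).and (eventually_gt_atTop 0))).exists
    have hpi := Real.pi_pos
    refine ⟨Real.pi / 2 / r, by positivity, ?_, ?_⟩
    · rw [div_le_iff₀ hr3]
      rw [div_le_iff₀ (by positivity)] at hr2
      linarith
    · rwa [div_div_cancel₀ (by positivity)]
  let φ : (Fin d → ℝ) → ℝ := fun y => g (WithLp.toLp 2 (fun i => Real.arcsin (y i) / δ))
  have hφ : Continuous φ := by
    refine hg.comp ((PiLp.continuous_toLp 2 _).comp (continuous_pi fun i => ?_))
    exact (Real.continuous_arcsin.comp (continuous_apply i)).div_const _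
  obtain ⟨q, hq⟩ := bw_sw φ hφ (ε / (4 * C)) (by positivity)
  obtain ⟨p, hp⟩ := bw_trig (fun x => ω ‖x‖) hW C γ hC hγ hB δ hδ hδγ q 1 (ε / 4) (by positivity)
  refine ⟨p, fun x => ?_⟩
  have h1 := hfg x
  have h4 := hp x
  simp only [map_one, mul_one] at h4
  have h3 := hq (fun i => Real.sin (δ * x i)) (fun i => Real.abs_sin_le_one _)
  set Φ := φ (fun i => Real.sin (δ * x i)) with hΦ
  set Q := eval (fun i => Real.sin (δ * x i)) q
  set P := eval (fun i => x i) p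
  have h3' : |Φ - Q| * ω ‖x‖ < ε / 4 := by
    calc _ ≤ |Φ - Q| * C := by gcongr; exact hBC x
      _ < ε / (4 * C) * C := by gcongr
      _ = ε / 4 := by field_simp
  have h2 : |g x - Φ| * ω ‖x‖ < ε / 4 := by
    by_cases hx : ‖x‖ ≤ Real.pi / 2 / δ
    · have : Φ = g x := by
        rw [hΦ]
        simp only [φ]
        congr 1
        ext i
        have hi : |x i| ≤ Real.pi / 2 / δ := (PiLp.norm_apply_le x i).trans hx
        rw [abs_le, ← neg_div, div_le_iff₀ hδ, le_div_iff₀ hδ] at hi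
        simp only
        rw [Real.arcsin_sin (by linarith) (by linarith)]
        field_simp
      rw [this]; simpa using hε
    · refine lt_of_le_of_lt ?_ hδε
      have a1 : |g x - Φ| ≤ 2 * B := by
        have := abs_sub (g x) Φ
        have := hgB x
        have : |Φ| ≤ B := hgB _
        linarith
      have a2 : ω ‖x‖ ≤ C * Real.exp (-γ * (Real.pi / 2 / δ)) := by
        refine (hB x).trans ?_
        gcongr C * Real.exp ?_
        nlinarith [not_le.1 hx]
      exact mul_le_mul a1 a2 (hW x).le (by positivity)
  have e : |f x - P| ≤ |f x - g x| + |g x - Φ| + |Φ - Q| + |Q - P| := by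
    have b1 := abs_sub_le (f x) (g x) P
    have b2 := abs_sub_le (g x) Φ P
    have b3 := abs_sub_le Φ Q P
    linarith
  have := mul_le_mul_of_nonneg_right e (hW x).le
  linarith
end

section
/- Let ς be a continuous linear functional on C₀(ℝ^d) and ω a continuous positive weight with ω(t) ≤ C·exp(−γt), γ > 0. If ς(s ↦ ω(|s|)·p(s)) = 0 for every polynomial p in d real variables, then ς(s ↦ ω(|s|)·exp(i ζ·s)) = 0 for every ζ ∈ ℝ^d. -/
open Filter Complex ZeroAtInfty MvPolynomial

/-- If a continuous functional on `C₀(ℝ^d)` annihilates all weighted polynomials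
(with an exponentially decaying weight), then it annihilates all weighted characters. -/
theorem annihilates_weighted_polynomials_implies_characters
    (d : ℕ) (ω : ℝ → ℝ) (hωcont : ContinuousOn ω (Set.Ici 0))
    (hωpos : ∀ t ≥ (0 : ℝ), 0 < ω t)
    (C γ : ℝ) (hC : 0 < C) (hγ : 0 < γ)
    (hbd : ∀ t ≥ (0 : ℝ), ω t ≤ C * Real.exp (-γ * t))
    (ς : C₀(EuclideanSpace ℝ (Fin d), ℂ) →L[ℂ] ℂ)
    -- bundled weighted polynomials
    (wp : MvPolynomial (Fin d) ℝ → C₀(EuclideanSpace ℝ (Fin d), ℂ))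
    (hwp : ∀ p s, wp p s = (ω ‖s‖ : ℂ) * (eval (fun j => s j) p : ℂ))
    -- bundled weighted characters (real frequencies)
    (wc : (Fin d → ℝ) → C₀(EuclideanSpace ℝ (Fin d), ℂ))
    (hwc : ∀ ζ s, wc ζ s = (ω ‖s‖ : ℂ) * Complex.exp (Complex.I * ∑ j, (ζ j : ℂ) * (s j : ℂ)))
    (hzero : ∀ p : MvPolynomial (Fin d) ℝ, ς (wp p) = 0) :
    ∀ ζ : Fin d → ℝ, ς (wc ζ) = 0 := by
  intro ζ
  set φ : EuclideanSpace ℝ (Fin d) → ℝ := fun s => ∑ j, ζ j * s j with hφ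
  have hφc : Continuous φ := by
    rw [hφ]
    fun_prop
  set K : ℝ := ∑ j, |ζ j| with hK
  have hK0 : 0 ≤ K := Finset.sum_nonneg fun j _ => abs_nonneg _
  have hφb : ∀ s, |φ s| ≤ K * ‖s‖ := by
    intro s
    rw [hK, Finset.sum_mul]
    refine (Finset.abs_sum_le_sum_abs _ _).trans (Finset.sum_le_sum fun j _ => ?_)
    rw [abs_mul]
    have : |s j| ≤ ‖s‖ := by
      simpa using PiLp.norm_apply_le s j
    gcongr
  have hωc : Continuous fun s : EuclideanSpace ℝ (Fin d) => ω ‖s‖ :=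
    hωcont.comp_continuous continuous_norm fun s => norm_nonneg s
  -- norm of the values
  have hval : ∀ (m : ℕ) (t : ℝ) (s : EuclideanSpace ℝ (Fin d)),
      ‖(ω ‖s‖ : ℂ) * (φ s : ℂ) ^ m * Complex.exp (Complex.I * (t * φ s))‖
        ≤ C * (K / γ) ^ m * ((γ * ‖s‖) ^ m * Real.exp (-(γ * ‖s‖))) := by
    intro m t s
    have h1 : ‖Complex.exp (Complex.I * (t * φ s))‖ = 1 := by
      rw [mul_comm, ← Complex.ofReal_mul, Complex.norm_exp_ofReal_mul_I]
    rw [norm_mul, h1, mul_one, norm_mul, norm_pow, Complex.norm_real, Complex.norm_real,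
      Real.norm_eq_abs, Real.norm_eq_abs, abs_of_pos (hωpos _ (norm_nonneg s))]
    have h2 := hbd _ (norm_nonneg s)
    have h3 : |φ s| ^ m ≤ (K * ‖s‖) ^ m := pow_le_pow_left₀ (abs_nonneg _) (hφb s) m
    calc ω ‖s‖ * |φ s| ^ m ≤ (C * Real.exp (-γ * ‖s‖)) * (K * ‖s‖) ^ m := by gcongr
      _ = _ := by
        have : K * ‖s‖ = (K / γ) * (γ * ‖s‖) := by field_simp
        rw [this, mul_pow (K / γ), neg_mul]; ring
  have hex : ∀ (m : ℕ) (t : ℝ), ∃ f : C₀(EuclideanSpace ℝ (Fin d), ℂ), ∀ s,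
      f s = (ω ‖s‖ : ℂ) * (φ s : ℂ) ^ m * Complex.exp (Complex.I * (t * φ s)) := by
    intro m t
    refine ⟨⟨⟨fun s => (ω ‖s‖ : ℂ) * (φ s : ℂ) ^ m * Complex.exp (Complex.I * (t * φ s)), ?_⟩, ?_⟩,
      fun s => rfl⟩
    · have := Complex.continuous_ofReal.comp hωc
      have := Complex.continuous_ofReal.comp hφc
      simp only [Function.comp_def] at *
      fun_prop
    · refine squeeze_zero_norm (hval m t) ?_
      have h1 : Tendsto (fun s : EuclideanSpace ℝ (Fin d) => γ * ‖s‖)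
          (cocompact _) atTop :=
        (tendsto_norm_cocompact_atTop (E := EuclideanSpace ℝ (Fin d))).const_mul_atTop hγ
      have h2 := ((Real.tendsto_pow_mul_exp_neg_atTop_nhds_zero m).comp h1).const_mul
        (C * (K / γ) ^ m)
      simpa [Function.comp_def] using h2
  choose g hg using hex
  have hgn : ∀ m t, ‖g m t‖ ≤ C * (K / γ) ^ m * m.factorial := by
    intro m t
    have hKγ : 0 ≤ K / γ := div_nonneg hK0 hγ.le
    rw [← ZeroAtInftyContinuousMap.norm_toBCF_eq_norm]
    refine (BoundedContinuousFunction.norm_le (by positivity)).2 fun s => ?_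
    change ‖g m t s‖ ≤ _
    rw [hg]
    refine (hval m t s).trans ?_
    gcongr
    have h0 : 0 ≤ γ * ‖s‖ := by positivity
    have h1 := Real.pow_div_factorial_le_exp _ h0 m
    rw [div_le_iff₀ (by positivity)] at h1
    rw [Real.exp_neg, ← div_eq_mul_inv, div_le_iff₀ (Real.exp_pos _)]
    linarith
  -- propagation
  have hstep : ∀ h : ℝ, 0 ≤ h → h * (2 * (K / γ)) < 1 → ∀ t : ℝ,
      (∀ m, ς (g m t) = 0) → ∀ m, ς (g m (t + h)) = 0 := by
    intro h hh0 hh t ht m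
    have hKγ : 0 ≤ K / γ := div_nonneg hK0 hγ.le
    set u : ℕ → C₀(EuclideanSpace ℝ (Fin d), ℂ) :=
      fun k => ((Complex.I * h) ^ k / (k.factorial : ℂ)) • g (m + k) t with hu
    have hsum : Summable u := by
      refine Summable.of_norm_bounded
        (g := fun k => (C * (2 * (K / γ)) ^ m * m.factorial) * (h * (2 * (K / γ))) ^ k)
        ((summable_geometric_of_lt_one (by positivity) hh).mul_left _) fun k => ?_
      rw [hu]
      simp only [norm_smul, norm_div, norm_pow, norm_mul, Complex.norm_I, one_mul,
        Complex.norm_natCast, Complex.norm_real, Real.norm_eq_abs, abs_of_nonneg hh0]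
      have h1 := hgn (m + k) t
      have h2 : ((m + k).factorial : ℝ) ≤ 2 ^ (m + k) * m.factorial * k.factorial := by
        have := Nat.add_choose_mul_factorial_mul_factorial m k
        have h3 := Nat.choose_le_two_pow (m + k) k
        rw [← this]
        push_cast
        gcongr
        exact_mod_cast h3
      calc h ^ k / (k.factorial : ℝ) * ‖g (m + k) t‖
          ≤ h ^ k / (k.factorial : ℝ) * (C * (K / γ) ^ (m + k) *
              (2 ^ (m + k) * m.factorial * k.factorial)) := by
            gcongr
            exact h1.trans (by gcongr)
        _ = _ := by
            have : (k.factorial : ℝ) ≠ 0 := by positivity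
            rw [mul_pow, mul_pow, mul_pow, pow_add, pow_add]
            field_simp
    have hS : g m (t + h) = ∑' k, u k := by
      ext s
      have hev : HasSum (fun k => u k s) ((∑' k, u k) s) := by
        have hc : Continuous fun f : C₀(EuclideanSpace ℝ (Fin d), ℂ) => f s :=
          (BoundedContinuousFunction.evalCLM ℂ s).continuous.comp
            (ZeroAtInftyContinuousMap.isometry_toBCF).continuous
        exact hsum.hasSum.map
          (⟨⟨fun f => f s, rfl⟩, fun _ _ => rfl⟩ : C₀(EuclideanSpace ℝ (Fin d), ℂ) →+ ℂ) hc
      refine HasSum.unique ?_ hev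
      have he := NormedSpace.expSeries_div_hasSum_exp (𝔸 := ℂ) (Complex.I * h * φ s)
      rw [← Complex.exp_eq_exp_ℂ] at he
      have := he.mul_left ((ω ‖s‖ : ℂ) * (φ s : ℂ) ^ m * Complex.exp (Complex.I * (t * φ s)))
      have e1 : (fun k => u k s) = fun k => (ω ‖s‖ : ℂ) * (φ s : ℂ) ^ m *
          Complex.exp (Complex.I * (t * φ s)) *
            ((Complex.I * h * φ s) ^ k / (k.factorial : ℂ)) := by
        funext k
        simp only [hu, ZeroAtInftyContinuousMap.smul_apply, hg, smul_eq_mul]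
        rw [pow_add, mul_pow _ (φ s : ℂ)]
        ring
      have e2 : g m (t + h) s = (ω ‖s‖ : ℂ) * (φ s : ℂ) ^ m *
          Complex.exp (Complex.I * (t * φ s)) * Complex.exp (Complex.I * h * φ s) := by
        rw [hg, mul_assoc _ (Complex.exp _), ← Complex.exp_add]
        push_cast
        ring_nf
      rw [e1, e2]
      exact this
    rw [hS, ς.map_tsum hsum]
    simp [hu, ht]
  have h0 : ∀ m, ς (g m 0) = 0 := by
    intro m
    have : g m 0 = wp ((∑ j, MvPolynomial.C (ζ j) * X j) ^ m) := by
      ext s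
      rw [hg, hwp]
      simp [hφ]
    rw [this, hzero]
  obtain ⟨N, hN⟩ := exists_nat_gt (2 * (K / γ))
  have hN0 : (0 : ℝ) < N := lt_of_le_of_lt (by positivity) hN
  have hall : ∀ n : ℕ, ∀ m, ς (g m (n * (1 / N : ℝ))) = 0 := by
    intro n
    induction n with
    | zero => simpa using h0
    | succ n ih =>
      have := hstep (1 / N) (by positivity)
        (by rw [one_div, inv_mul_lt_iff₀ hN0]; simpa using hN) _ ih
      intro m
      have h2 := this m
      rwa [show ((n + 1 : ℕ) : ℝ) * (1 / N : ℝ) = n * (1 / N : ℝ) + 1 / N by push_cast; ring]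
  have hfin := hall N 0
  have : wc ζ = g 0 (N * (1 / N : ℝ)) := by
    ext s
    rw [hg, hwc, mul_one_div_cancel hN0.ne']
    simp [hφ]
  rw [this, hfin]
end

section
/- Let ς be a continuous linear functional on C₀(ℝ^d), and ω : [0,∞) → (0,∞) continuous. If ς(s ↦ ω(|s|)·exp(i ζ·s)) = 0 for all ζ ∈ ℝ^d, then ς(h) = 0 for every smooth compactly supported function h : ℝ^d → ℂ, and hence ς = 0. -/
open Filter Complex ZeroAtInfty

section Aux
open MeasureTheory FourierTransform SchwartzMap

theorem aux_dist_le {V : Type*} [TopologicalSpace V] (f g : C₀(V, ℂ)) {c : ℝ} (hc : 0 ≤ c)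
    (h : ∀ x, ‖f x - g x‖ ≤ c) : dist f g ≤ c := by
  rw [← ZeroAtInftyContinuousMap.dist_toBCF_eq_dist]
  refine (BoundedContinuousFunction.dist_le hc).2 fun x => ?_
  rw [dist_eq_norm]
  exact h x

theorem aux_norm_le {V : Type*} [TopologicalSpace V] (f : C₀(V, ℂ)) (x : V) : ‖f x‖ ≤ ‖f‖ := by
  rw [← ZeroAtInftyContinuousMap.norm_toBCF_eq_norm]
  exact f.toBCF.norm_coe_le_norm x

noncomputable def auxEv {V : Type*} [TopologicalSpace V] (x : V) : C₀(V, ℂ) →L[ℂ] ℂ :=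
  LinearMap.mkContinuous
    { toFun := fun f => f x, map_add' := fun _ _ => rfl, map_smul' := fun _ _ => rfl } 1
    (fun f => by simpa using aux_norm_le f x)

theorem aux_exp_sub (a b : ℝ) : ‖Complex.exp (I * a) - Complex.exp (I * b)‖ ≤ |a - b| := by
  have h : Complex.exp (I * a) - Complex.exp (I * b)
      = Complex.exp (I * b) * (Complex.exp (I * ((a - b : ℝ) : ℂ)) - 1) := by
    rw [mul_sub, ← Complex.exp_add]
    push_cast
    ring_nf
  rw [h, norm_mul, mul_comm I (b : ℂ), Complex.norm_exp_ofReal_mul_I, one_mul]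
  exact Real.norm_exp_I_mul_ofReal_sub_one_le

theorem aux_cont {V : Type*} [NormedAddCommGroup V] [InnerProductSpace ℝ V] [ProperSpace V]
    (W : C₀(V, ℂ)) (w : V → C₀(V, ℂ))
    (hw : ∀ ζ s, w ζ s = W s * Complex.exp (I * ((2 * Real.pi * inner ℝ ζ s : ℝ) : ℂ))) :
    Continuous w := by
  rw [Metric.continuous_iff]
  intro ζ₀ ε hε
  have h0 : ∀ᶠ s in cocompact V, ‖W s‖ < ε / 4 := by
    have := (zero_at_infty W).norm
    rw [norm_zero] at this
    exact this.eventually (gt_mem_nhds (by positivity))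
  rw [← Metric.cobounded_eq_cocompact] at h0
  obtain ⟨R, hR⟩ := (Metric.hasBasis_cobounded_compl_closedBall (0 : V)).eventually_iff.1 h0
  have hR := hR.2
  set C := ‖W‖ * (2 * Real.pi * |R|) with hC
  have hC0 : 0 ≤ C := by positivity
  refine ⟨ε / 2 / (C + 1), by positivity, fun ζ hζ => ?_⟩
  refine lt_of_le_of_lt (aux_dist_le _ _ (c := ε / 2) (by positivity) fun s => ?_) (by linarith)
  rw [hw, hw, ← mul_sub, norm_mul]
  by_cases hs : s ∈ Metric.closedBall (0 : V) R
  · have h1 := aux_exp_sub (2 * Real.pi * inner ℝ ζ s) (2 * Real.pi * inner ℝ ζ₀ s)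
    have h2 : |2 * Real.pi * inner ℝ ζ s - 2 * Real.pi * inner ℝ ζ₀ s|
        ≤ 2 * Real.pi * (‖ζ - ζ₀‖ * |R|) := by
      rw [← mul_sub, ← inner_sub_left, abs_mul, abs_of_pos Real.two_pi_pos]
      have : ‖s‖ ≤ |R| := (mem_closedBall_zero_iff.1 hs).trans (le_abs_self R)
      have := abs_real_inner_le_norm (ζ - ζ₀) s
      have : |inner ℝ (ζ - ζ₀) s| ≤ ‖ζ - ζ₀‖ * |R| := this.trans (by gcongr)
      gcongr
    rw [dist_eq_norm] at hζ
    calc _ ≤ ‖W‖ * (2 * Real.pi * (‖ζ - ζ₀‖ * |R|)) := by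
          gcongr
          · exact aux_norm_le W s
          · exact h1.trans h2
      _ = C * ‖ζ - ζ₀‖ := by rw [hC]; ring
      _ ≤ (C + 1) * (ε / 2 / (C + 1)) := by gcongr; linarith
      _ = ε / 2 := by field_simp
  · have h1 : ‖W s‖ < ε / 4 := hR hs
    have h2 : ‖Complex.exp (I * ((2 * Real.pi * inner ℝ ζ s : ℝ) : ℂ))
        - Complex.exp (I * ((2 * Real.pi * inner ℝ ζ₀ s : ℝ) : ℂ))‖ ≤ 2 := by
      refine (norm_sub_le _ _).trans ?_
      rw [mul_comm I, mul_comm I, Complex.norm_exp_ofReal_mul_I, Complex.norm_exp_ofReal_mul_I]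
      norm_num
    calc _ ≤ ε / 4 * 2 := by gcongr
      _ = ε / 2 := by ring

theorem aux_schwartz {V : Type*} [NormedAddCommGroup V] [InnerProductSpace ℝ V]
    [FiniteDimensional ℝ V] [MeasurableSpace V] [BorelSpace V]
    (W : C₀(V, ℂ)) (w : V → C₀(V, ℂ))
    (hw : ∀ ζ s, w ζ s = W s * Complex.exp (I * ((2 * Real.pi * inner ℝ ζ s : ℝ) : ℂ)))
    (L : C₀(V, ℂ) →L[ℂ] ℂ) (hL : ∀ ζ, L (w ζ) = 0) (φ : 𝓢(V, ℂ)) :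
    ∃ F : C₀(V, ℂ), (∀ s, F s = W s * φ s) ∧ L F = 0 := by
  have hc := aux_cont W w hw
  have hint : Integrable (fun ζ => (𝓕 φ) ζ • w ζ) := by
    refine Integrable.mono' (((𝓕 φ).integrable (μ := volume)).norm.mul_const ‖W‖)
      ((𝓕 φ).continuous.smul hc).aestronglyMeasurable (Eventually.of_forall fun ζ => ?_)
    rw [norm_smul]
    gcongr
    rw [← dist_zero_right]
    refine aux_dist_le _ _ (norm_nonneg _) fun s => ?_
    rw [hw, ZeroAtInftyContinuousMap.zero_apply, sub_zero, norm_mul, mul_comm I,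
      Complex.norm_exp_ofReal_mul_I, mul_one]
    exact aux_norm_le W s
  refine ⟨∫ ζ, (𝓕 φ) ζ • w ζ, fun s => ?_, ?_⟩
  · have h1 : auxEv s (∫ ζ, (𝓕 φ) ζ • w ζ) = ∫ ζ, auxEv s ((𝓕 φ) ζ • w ζ) :=
      ((auxEv s).integral_comp_comm hint).symm
    have h2 : φ s = 𝓕⁻ (𝓕 φ) s := by rw [fourierInv_fourier_eq]
    rw [SchwartzMap.fourierInv_coe, Real.fourierInv_eq'] at h2
    change auxEv s (∫ ζ, (𝓕 φ) ζ • w ζ) = _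
    rw [h1, h2, ← integral_const_mul]
    congr 1
    ext ζ
    change (𝓕 φ) ζ • (w ζ s) = _
    rw [hw, smul_eq_mul, smul_eq_mul, mul_comm I]
    ring
  · rw [← L.integral_comp_comm hint]
    simp [hL]

theorem aux_main {V : Type*} [NormedAddCommGroup V] [InnerProductSpace ℝ V]
    [FiniteDimensional ℝ V] [MeasurableSpace V] [BorelSpace V]
    (W : C₀(V, ℂ)) (hW : ∀ s, W s ≠ 0) (w : V → C₀(V, ℂ))
    (hw : ∀ ζ s, w ζ s = W s * Complex.exp (I * ((2 * Real.pi * inner ℝ ζ s : ℝ) : ℂ)))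
    (L : C₀(V, ℂ) →L[ℂ] ℂ) (hL : ∀ ζ, L (w ζ) = 0) : L = 0 := by
  ext h
  have hcl : h ∈ closure {f | L f = 0} := by
    rw [Metric.mem_closure_iff]
    intro ε hε
    have h0 : ∀ᶠ s in cocompact V, ‖h s‖ < ε / 4 := by
      have := (zero_at_infty h).norm
      rw [norm_zero] at this
      exact this.eventually (gt_mem_nhds (by positivity))
    obtain ⟨K, hK, hKh⟩ := mem_cocompact.1 h0
    obtain ⟨χ, hχ1, -, hχc, hχ⟩ := exists_continuous_one_zero_of_isCompact hK
      isClosed_empty (Set.disjoint_empty K)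
    have hgc : Continuous fun s => (χ s : ℂ) * (h s / W s) := by
      have h1 : Continuous h := map_continuous h
      have h2 : Continuous W := map_continuous W
      have h3 : Continuous χ := map_continuous χ
      exact (continuous_ofReal.comp h3).mul (h1.div h2 hW)
    obtain ⟨φ, hφ, hφd, hφs⟩ := hgc.exists_contDiff_approx ⊤ (ε := fun s => ε / 4 / ‖W s‖)
      (continuous_const.div (map_continuous W).norm fun s => norm_ne_zero_iff.2 (hW s))
      (fun s => by have := norm_pos_iff.2 (hW s); positivity)
    have hφc : HasCompactSupport φ := by
      refine hχc.mono (hφs.trans fun s hs => ?_)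
      rw [Function.mem_support] at hs ⊢
      intro h
      apply hs
      simp [h]
    obtain ⟨F, hF, hLF⟩ := aux_schwartz W w hw L hL (hφc.toSchwartzMap hφ)
    refine ⟨F, hLF, lt_of_le_of_lt (aux_dist_le _ _ (c := ε / 2) (by positivity) fun s => ?_)
      (by linarith)⟩
    have hWs := norm_pos_iff.2 (hW s)
    have e1 : F s = W s * φ s := hF s
    have h1 : ‖W s * φ s - χ s * h s‖ ≤ ε / 4 := by
      have := (hφd s).le
      rw [dist_eq_norm, le_div_iff₀ hWs, ← norm_mul] at this
      have h4 : W s * φ s - χ s * h s = (φ s - χ s * (h s / W s)) * W s := by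
        rw [sub_mul, mul_assoc, div_mul_cancel₀ _ (hW s), mul_comm (φ s)]
      rw [h4]
      exact this
    have h2 : ‖h s - χ s * h s‖ ≤ ε / 4 := by
      by_cases hs : s ∈ K
      · have : χ s = 1 := hχ1 hs
        simp [this]; positivity
      · have h3 : ‖h s‖ < ε / 4 := hKh hs
        have : h s - χ s * h s = ((1 - χ s : ℝ) : ℂ) * h s := by push_cast; ring
        rw [this, norm_mul, Complex.norm_real, Real.norm_eq_abs,
          abs_of_nonneg (by linarith [(hχ s).2])]
        calc _ ≤ 1 * ‖h s‖ := by gcongr; linarith [(hχ s).1]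
          _ ≤ _ := by linarith
    rw [e1]
    calc ‖h s - W s * φ s‖ = ‖(h s - χ s * h s) - (W s * φ s - χ s * h s)‖ := by congr 1; ring
      _ ≤ _ := norm_sub_le _ _
      _ ≤ ε / 2 := by linarith
  have hcs : IsClosed {f | L f = 0} := isClosed_eq L.continuous continuous_const
  exact hcs.closure_subset hcl

end Aux

/-- If a continuous functional on `C₀(ℝ^d)` annihilates all weighted characters, then it
annihilates all smooth compactly supported functions, and hence is zero. -/
theorem annihilates_characters_implies_zero
    (d : ℕ) (ω : ℝ → ℝ) (hωcont : ContinuousOn ω (Set.Ici 0))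
    (hωpos : ∀ t ≥ (0 : ℝ), 0 < ω t)
    (ς : C₀(EuclideanSpace ℝ (Fin d), ℂ) →L[ℂ] ℂ)
    (wc : (Fin d → ℝ) → C₀(EuclideanSpace ℝ (Fin d), ℂ))
    (hwc : ∀ ζ s, wc ζ s = (ω ‖s‖ : ℂ) * Complex.exp (Complex.I * ∑ j, (ζ j : ℂ) * (s j : ℂ)))
    (hzero : ∀ ζ : Fin d → ℝ, ς (wc ζ) = 0) :
    (∀ h : C₀(EuclideanSpace ℝ (Fin d), ℂ),
      ContDiff ℝ (⊤ : ℕ∞) (h : EuclideanSpace ℝ (Fin d) → ℂ) →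
      HasCompactSupport (h : EuclideanSpace ℝ (Fin d) → ℂ) → ς h = 0) ∧ ς = 0 := by
  have hW : ∀ s, wc 0 s = (ω ‖s‖ : ℂ) := fun s => by rw [hwc]; simp
  have key : ς = 0 := by
    refine aux_main (wc 0) (fun s => ?_) (fun ζ => wc fun j => 2 * Real.pi * ζ j) (fun ζ s => ?_)
      ς (fun ζ => hzero _)
    · rw [hW]
      exact_mod_cast (hωpos _ (norm_nonneg s)).ne'
    · rw [hW, hwc]
      congr 3
      rw [PiLp.inner_apply]
      push_cast
      rw [Finset.mul_sum]
      refine Finset.sum_congr rfl fun j _ => ?_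
      simp
      ring
  exact ⟨fun h _ _ => by rw [key]; rfl, key⟩
end

section
/- Let X be a locally compact Hausdorff space, v : X → [0,∞) a weight, and a₁,…,a_N : X → ℝ continuous functions such that: the system contains a nonzero constant, separates points of X, Σ|a_j| → ∞ at infinity, and v(x) ≤ C·exp(−c'·|a_j(x)|) for some c' > 0 and all j. Then the algebra of real polynomials in a₁(x),…,a_N(x) is dense in the Banach space C⁰_v of continuous functions f : X → ℝ with v·f → 0 at infinity, equipped with the norm |f|_v = sup_x |f(x)|·v(x). -/
open MvPolynomial

namespace WSW

lemma tail_bound {f g : ℕ → ℝ} {s G : ℝ} (hf : HasSum f s) (hg : HasSum g G)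
    (h : ∀ m, |f m| ≤ (1/2:ℝ)^m * g m) (n : ℕ) :
    |s - ∑ m ∈ Finset.range n, f m| ≤ (1/2:ℝ)^n * G := by
  have hg0 : ∀ m, 0 ≤ g m := fun m => by
    have h1 := (abs_nonneg _).trans (h m)
    have h2 : (0:ℝ) < (1/2:ℝ)^m := by positivity
    exact nonneg_of_mul_nonneg_right h1 h2
  have h1 : HasSum (fun m => f (m + n)) (s - ∑ m ∈ Finset.range n, f m) :=
    (hasSum_nat_add_iff' n).2 hf
  have h2 : HasSum (fun m => g (m + n)) (G - ∑ m ∈ Finset.range n, g m) :=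
    (hasSum_nat_add_iff' n).2 hg
  have h3 : HasSum (fun m => (1/2:ℝ)^n * g (m + n))
      ((1/2:ℝ)^n * (G - ∑ m ∈ Finset.range n, g m)) := h2.mul_left _
  have hb : ∀ m, |f (m+n)| ≤ (1/2:ℝ)^n * g (m+n) := fun m => by
    refine (h _).trans (mul_le_mul_of_nonneg_right ?_ (hg0 _))
    exact pow_le_pow_of_le_one (by norm_num) (by norm_num) (by omega)
  have h4 : |s - ∑ m ∈ Finset.range n, f m| ≤ (1/2:ℝ)^n * (G - ∑ m ∈ Finset.range n, g m) := by
    rw [abs_le]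
    constructor
    · exact hasSum_le (fun m => (abs_le.1 (hb m)).1) h3.neg h1
    · exact hasSum_le (fun m => (abs_le.1 (hb m)).2) h1 h3
  refine h4.trans (mul_le_mul_of_nonneg_left ?_ (by positivity))
  have := Finset.sum_nonneg (fun m (_ : m ∈ Finset.range n) => hg0 m)
  linarith

lemma sin_bound (y : ℝ) (n : ℕ) :
    |Real.sin y - ∑ m ∈ Finset.range n, (-1:ℝ)^m * y^(2*m+1) / (2*m+1).factorial|
      ≤ (1/2:ℝ)^n * Real.exp (2 * |y|) := by
  have h := tail_bound (Real.hasSum_sin y) (Real.hasSum_sinh (2*|y|)) (fun m => ?_) n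
  · refine h.trans (mul_le_mul_of_nonneg_left ?_ (by positivity))
    rw [Real.sinh_eq]
    have := Real.exp_pos (2*|y|)
    have := Real.exp_pos (-(2*|y|))
    linarith
  · rw [abs_div, abs_mul, abs_pow, abs_pow, abs_neg, abs_one, one_pow, one_mul, Nat.abs_cast,
      ← mul_div_assoc]
    gcongr
    rw [mul_pow, ← mul_assoc]
    refine le_mul_of_one_le_left (by positivity) ?_
    rw [pow_succ, pow_mul, ← mul_assoc, ← mul_pow]
    norm_num
    have : (1:ℝ) ≤ 2^m := one_le_pow₀ (by norm_num)
    linarith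

variable {X : Type*} [TopologicalSpace X] {N : ℕ}

lemma poly_bound (a : Fin N → X → ℝ) (p : MvPolynomial (Fin N) ℝ) :
    ∀ η > (0:ℝ), ∃ D : ℝ, 0 < D ∧ ∀ x, |eval (fun j => a j x) p| ≤
      D * Real.exp (η * ∑ j, |a j x|) := by
  have hS : ∀ x, 0 ≤ ∑ j, |a j x| := fun x => Finset.sum_nonneg (fun _ _ => abs_nonneg _)
  induction p using MvPolynomial.induction_on with
  | C r =>
    intro η hη
    refine ⟨|r| + 1, by positivity, fun x => ?_⟩
    simp only [eval_C]
    have : 1 ≤ Real.exp (η * ∑ j, |a j x|) := Real.one_le_exp (mul_nonneg hη.le (hS x))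
    nlinarith [abs_nonneg r]
  | add p q hp hq =>
    intro η hη
    obtain ⟨D, hD, h1⟩ := hp η hη
    obtain ⟨E, hE, h2⟩ := hq η hη
    refine ⟨D + E, by positivity, fun x => ?_⟩
    rw [map_add, add_mul]
    exact (abs_add_le _ _).trans (add_le_add (h1 x) (h2 x))
  | mul_X p i hp =>
    intro η hη
    obtain ⟨D, hD, h1⟩ := hp (η/2) (by positivity)
    refine ⟨D * (2/η), by positivity, fun x => ?_⟩
    rw [map_mul, eval_X, abs_mul]
    have h3 : |a i x| ≤ ∑ j, |a j x| :=
      Finset.single_le_sum (f := fun j => |a j x|) (fun _ _ => abs_nonneg _) (Finset.mem_univ i)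
    have h4 := Real.add_one_le_exp (η/2 * ∑ j, |a j x|)
    have h5 : |a i x| ≤ (2/η) * Real.exp (η/2 * ∑ j, |a j x|) := by
      rw [div_mul_eq_mul_div, le_div_iff₀ hη]
      nlinarith
    calc _ ≤ (D * Real.exp (η/2 * ∑ j, |a j x|)) * ((2/η) * Real.exp (η/2 * ∑ j, |a j x|)) :=
          mul_le_mul (h1 x) h5 (abs_nonneg _) (by positivity)
      _ = D * (2/η) * (Real.exp (η/2 * ∑ j, |a j x|) * Real.exp (η/2 * ∑ j, |a j x|)) := by ring
      _ = _ := by rw [← Real.exp_add]; congr 2; ring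

/-- Bounded multipliers of the weighted closure of polynomials. -/
def multAlg (a : Fin N → X → ℝ) (v : X → ℝ) (hv : ∀ x, 0 ≤ v x) : Subalgebra ℝ C(X, ℝ) where
  carrier := {h | (∃ B : ℝ, 0 < B ∧ ∀ x, |h x| ≤ B) ∧ ∀ p : MvPolynomial (Fin N) ℝ, ∀ ε > (0:ℝ),
    ∃ q : MvPolynomial (Fin N) ℝ,
      ∀ x, |h x * eval (fun j => a j x) p - eval (fun j => a j x) q| * v x < ε}
  algebraMap_mem' r := by
    refine ⟨⟨|r| + 1, by positivity, fun x => by simp⟩, fun p ε hε => ⟨MvPolynomial.C r * p, fun x => ?_⟩⟩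
    simpa using hε
  add_mem' := by
    rintro f g ⟨⟨A, hA, hfA⟩, hf⟩ ⟨⟨B, hB, hgB⟩, hg⟩
    refine ⟨⟨A + B, by positivity, fun x => (abs_add_le _ _).trans (add_le_add (hfA x) (hgB x))⟩,
      fun p ε hε => ?_⟩
    obtain ⟨q, hq⟩ := hf p (ε/2) (by positivity)
    obtain ⟨r, hr⟩ := hg p (ε/2) (by positivity)
    refine ⟨q + r, fun x => ?_⟩
    have h1 := hq x
    have h2 := hr x
    rw [map_add]
    have h3 := mul_le_mul_of_nonneg_right (abs_add_le
      (f x * eval (fun j => a j x) p - eval (fun j => a j x) q)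
      (g x * eval (fun j => a j x) p - eval (fun j => a j x) r)) (hv x)
    have h4 : (f + g) x * eval (fun j => a j x) p - (eval (fun j => a j x) q + eval (fun j => a j x) r)
      = (f x * eval (fun j => a j x) p - eval (fun j => a j x) q) +
      (g x * eval (fun j => a j x) p - eval (fun j => a j x) r) := by
      rw [ContinuousMap.add_apply]; ring
    rw [h4]
    linarith
  mul_mem' := by
    rintro f g ⟨⟨A, hA, hfA⟩, hf⟩ ⟨⟨B, hB, hgB⟩, hg⟩
    refine ⟨⟨A * B, by positivity, fun x => ?_⟩, fun p ε hε => ?_⟩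
    · rw [ContinuousMap.mul_apply, abs_mul]
      exact mul_le_mul (hfA x) (hgB x) (abs_nonneg _) hA.le
    obtain ⟨q, hq⟩ := hg p (ε/(2*A)) (by positivity)
    obtain ⟨r, hr⟩ := hf q (ε/2) (by positivity)
    refine ⟨r, fun x => ?_⟩
    have h1 := hq x
    have h2 := hr x
    have h4 : (f * g) x * eval (fun j => a j x) p - eval (fun j => a j x) r
      = f x * (g x * eval (fun j => a j x) p - eval (fun j => a j x) q) +
      (f x * eval (fun j => a j x) q - eval (fun j => a j x) r) := by
      rw [ContinuousMap.mul_apply]; ring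
    have h3 := mul_le_mul_of_nonneg_right (abs_add_le
      (f x * (g x * eval (fun j => a j x) p - eval (fun j => a j x) q))
      (f x * eval (fun j => a j x) q - eval (fun j => a j x) r)) (hv x)
    rw [h4]
    have h5 : |f x * (g x * eval (fun j => a j x) p - eval (fun j => a j x) q)| * v x ≤ ε / 2 := by
      rw [abs_mul, mul_assoc]
      calc _ ≤ A * (ε/(2*A)) := mul_le_mul (hfA x) h1.le (mul_nonneg (abs_nonneg _) (hv x)) hA.le
        _ = ε/2 := by field_simp
    linarith

lemma mem_multAlg {a : Fin N → X → ℝ} {v : X → ℝ} {hv : ∀ x, 0 ≤ v x} {h : C(X, ℝ)} :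
    h ∈ multAlg a v hv ↔ (∃ B : ℝ, 0 < B ∧ ∀ x, |h x| ≤ B) ∧ ∀ p : MvPolynomial (Fin N) ℝ,
    ∀ ε > (0:ℝ), ∃ q : MvPolynomial (Fin N) ℝ,
      ∀ x, |h x * eval (fun j => a j x) p - eval (fun j => a j x) q| * v x < ε := Iff.rfl

lemma sin_mem {a : Fin N → X → ℝ} (ha : ∀ j, Continuous (a j)) {v : X → ℝ} {hv : ∀ x, 0 ≤ v x}
    {C δ : ℝ} (hC : 0 < C) (hδ : 0 < δ)
    (hvb : ∀ x, v x ≤ C * Real.exp (-(δ * ∑ j, |a j x|))) (i : Fin N) (t : ℝ) (ht : 0 < t)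
    (htδ : 4 * t ≤ δ) :
    (⟨fun x => Real.sin (t * a i x), by have := ha i; fun_prop⟩ : C(X, ℝ)) ∈ multAlg a v hv := by
  rw [mem_multAlg]
  refine ⟨⟨1, one_pos, fun x => Real.abs_sin_le_one _⟩, fun p ε hε => ?_⟩
  obtain ⟨D, hD, hp⟩ := poly_bound a p (δ/2) (by positivity)
  obtain ⟨n, hn⟩ := exists_pow_lt_of_lt_one (show 0 < ε / (D * C) by positivity)
    (show (1/2:ℝ) < 1 by norm_num)
  refine ⟨(∑ m ∈ Finset.range n, MvPolynomial.C ((-1:ℝ)^m * t^(2*m+1) / (2*m+1).factorial) *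
    MvPolynomial.X i ^ (2*m+1)) * p, fun x => ?_⟩
  have h1 : eval (fun j => a j x) (∑ m ∈ Finset.range n,
      MvPolynomial.C ((-1:ℝ)^m * t^(2*m+1) / (2*m+1).factorial) * MvPolynomial.X i ^ (2*m+1)) =
      ∑ m ∈ Finset.range n, (-1:ℝ)^m * (t * a i x)^(2*m+1) / (2*m+1).factorial := by
    rw [map_sum]
    refine Finset.sum_congr rfl fun m _ => ?_
    rw [map_mul, eval_C, map_pow, eval_X, mul_pow]
    ring
  have h2 := sin_bound (t * a i x) n
  have h3 : |a i x| ≤ ∑ j, |a j x| :=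
    Finset.single_le_sum (f := fun j => |a j x|) (fun _ _ => abs_nonneg _) (Finset.mem_univ i)
  rw [map_mul, h1, ContinuousMap.coe_mk, ← sub_mul, abs_mul]
  set S := ∑ j, |a j x|
  have hS : 0 ≤ S := (abs_nonneg _).trans h3
  have h4 : 2 * |t * a i x| ≤ δ/2 * S := by
    rw [abs_mul, abs_of_pos ht]
    nlinarith [abs_nonneg (a i x)]
  have h5 : Real.exp (2 * |t * a i x|) ≤ Real.exp (δ/2 * S) := Real.exp_le_exp.2 h4
  calc _ ≤ (((1/2:ℝ)^n * Real.exp (δ/2*S)) * (D * Real.exp (δ/2*S))) *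
        (C * Real.exp (-(δ * S))) := by
        refine mul_le_mul (mul_le_mul (h2.trans ?_) (hp x) (abs_nonneg _) (by positivity))
          (hvb x) (hv x) (by positivity)
        exact mul_le_mul_of_nonneg_left h5 (by positivity)
    _ = (1/2:ℝ)^n * (D * C) * (Real.exp (δ/2*S) * Real.exp (δ/2*S) * Real.exp (-(δ * S))) := by
        ring
    _ = (1/2:ℝ)^n * (D * C) := by
        rw [← Real.exp_add, ← Real.exp_add]
        have : δ/2*S + δ/2*S + -(δ*S) = 0 := by ring
        rw [this, Real.exp_zero, mul_one]
    _ < ε := by rwa [lt_div_iff₀ (by positivity)] at hn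

/-- Truncation to `[-B, B]`. -/
noncomputable def clamp (B y : ℝ) : ℝ := max (min y B) (-B)

lemma clamp_cont (B : ℝ) : Continuous (clamp B) := by unfold clamp; fun_prop

lemma clamp_abs {B : ℝ} (hB : 0 ≤ B) (y : ℝ) : |clamp B y| ≤ B := by
  unfold clamp
  rw [abs_le]
  exact ⟨le_max_right _ _, max_le (min_le_right _ _) (by linarith)⟩

lemma clamp_of_abs {B y : ℝ} (h : |y| ≤ B) : clamp B y = y := by
  unfold clamp
  rw [abs_le] at h
  rw [min_eq_left h.2, max_eq_left h.1]

lemma clamp_lip (B y z : ℝ) : |clamp B y - clamp B z| ≤ |y - z| := by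
  unfold clamp
  refine (abs_max_sub_max_le_abs _ _ _).trans ?_
  simpa using abs_min_sub_min_le_max y B z B

lemma clamp_zero {B : ℝ} (hB : 0 ≤ B) : clamp B 0 = 0 := clamp_of_abs (by simpa)

lemma clamp_sub {B : ℝ} (hB : 0 ≤ B) (y : ℝ) : |y - clamp B y| ≤ |y| := by
  unfold clamp
  rcases le_total y B with h | h
  · rw [min_eq_left h]
    rcases le_total (-B) y with h' | h'
    · rw [max_eq_left h']; simp
    · rw [max_eq_right h', abs_of_nonpos (by linarith), abs_of_nonpos (by linarith)]; linarith
  · rw [min_eq_right h, max_eq_left (by linarith), abs_of_nonneg (by linarith),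
      abs_of_nonneg (by linarith)]; linarith

lemma clamp_mem {a : Fin N → X → ℝ} {v : X → ℝ} {hv : ∀ x, 0 ≤ v x}
    {C δ : ℝ} (hC : 0 < C) (hδ : 0 < δ)
    (hvb : ∀ x, v x ≤ C * Real.exp (-(δ * ∑ j, |a j x|))) {B : ℝ} (hB : 0 < B) (h : C(X, ℝ))
    (hh : h ∈ multAlg a v hv) :
    (⟨fun x => clamp B (h x), (clamp_cont B).comp h.continuous⟩ : C(X, ℝ)) ∈ multAlg a v hv := by
  rw [mem_multAlg]
  refine ⟨⟨B, hB, fun x => clamp_abs hB.le _⟩, fun p ε hε => ?_⟩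
  obtain ⟨A, hA, hhA⟩ := (mem_multAlg.1 hh).1
  obtain ⟨D, hD, hp⟩ := poly_bound a p δ hδ
  have hpv : ∀ x, |eval (fun j => a j x) p| * v x ≤ D * C := fun x => by
    calc _ ≤ (D * Real.exp (δ * ∑ j, |a j x|)) * (C * Real.exp (-(δ * ∑ j, |a j x|))) :=
          mul_le_mul (hp x) (hvb x) (hv x) (by positivity)
      _ = D * C * (Real.exp (δ * ∑ j, |a j x|) * Real.exp (-(δ * ∑ j, |a j x|))) := by ring
      _ = D * C := by rw [← Real.exp_add, add_neg_cancel, Real.exp_zero, mul_one]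
  obtain ⟨P, hP⟩ := exists_polynomial_near_of_continuousOn (-A) A (clamp B)
    (clamp_cont B).continuousOn (ε / (2 * (D * C))) (by positivity)
  have hPm : Polynomial.aeval h P ∈ multAlg a v hv := by
    have := (Polynomial.aeval (⟨h, hh⟩ : multAlg a v hv) P).2
    rwa [← Subalgebra.coe_val, ← Polynomial.aeval_algHom_apply] at this
  obtain ⟨q, hq⟩ := (mem_multAlg.1 hPm).2 p (ε/2) (by positivity)
  refine ⟨q, fun x => ?_⟩
  have h1 := hq x
  have h0 : (Polynomial.aeval h P) x = P.eval (h x) := by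
    rw [Polynomial.aeval_continuousMap_apply]
  rw [h0] at h1
  have h2 := hP (h x) (abs_le.1 (hhA x))
  rw [ContinuousMap.coe_mk]
  have h4 : clamp B (h x) * eval (fun j => a j x) p - eval (fun j => a j x) q =
      (clamp B (h x) - P.eval (h x)) * eval (fun j => a j x) p +
      (P.eval (h x) * eval (fun j => a j x) p - eval (fun j => a j x) q) := by ring
  have h3 := mul_le_mul_of_nonneg_right (abs_add_le
    ((clamp B (h x) - P.eval (h x)) * eval (fun j => a j x) p)
    (P.eval (h x) * eval (fun j => a j x) p - eval (fun j => a j x) q)) (hv x)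
  have h5 : |(clamp B (h x) - P.eval (h x)) * eval (fun j => a j x) p| * v x ≤ ε/2 := by
    rw [abs_mul, mul_assoc, abs_sub_comm]
    calc _ ≤ (ε / (2 * (D * C))) * (D * C) :=
          mul_le_mul h2.le (hpv x) (mul_nonneg (abs_nonneg _) (hv x)) (by positivity)
      _ = ε/2 := by field_simp
  rw [h4]
  linarith

lemma sep {a : Fin N → X → ℝ} (ha : ∀ j, Continuous (a j)) {v : X → ℝ} {hv : ∀ x, 0 ≤ v x}
    {C δ : ℝ} (hC : 0 < C) (hδ : 0 < δ)
    (hvb : ∀ x, v x ≤ C * Real.exp (-(δ * ∑ j, |a j x|)))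
    (hsep : ∀ x x' : X, x ≠ x' → ∃ j, a j x ≠ a j x') : (multAlg a v hv).SeparatesPoints := by
  intro x y hxy
  obtain ⟨j, hj⟩ := hsep x y hxy
  set M := |a j x| + |a j y| + 1
  have hM : 0 < M := by positivity
  set t := min (δ/4) (1/M)
  have ht : 0 < t := by positivity
  refine ⟨_, ⟨_, sin_mem ha hC hδ hvb j t ht ?_, rfl⟩, ?_⟩
  · have := min_le_left (δ/4) (1/M)
    change t ≤ _ at this
    linarith
  · have key : ∀ r, |r| ≤ M → t * r ∈ Set.Icc (-(Real.pi/2)) (Real.pi/2) := fun r hr => by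
      have h1 : |t * r| ≤ 1 := by
        rw [abs_mul, abs_of_pos ht]
        calc t * |r| ≤ 1/M * M := mul_le_mul (min_le_right _ _) hr (abs_nonneg _) (by positivity)
          _ = 1 := by field_simp
      have := Real.pi_gt_three
      rw [abs_le] at h1
      constructor <;> linarith
    intro h
    have h' : Real.sin (t * a j x) = Real.sin (t * a j y) := h
    have := Real.injOn_sin (key _ (by have := abs_nonneg (a j y); simp only [M]; linarith))
      (key _ (by have := abs_nonneg (a j x); simp only [M]; linarith)) h'
    exact hj (mul_left_cancel₀ ht.ne' this)

end WSW

/-- Weighted Stone–Weierstrass theorem: polynomials in a separating system `a₁,…,a_N`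
containing a nonzero constant and dominating the weight exponentially are dense in `C⁰_v`. -/
theorem weighted_stone_weierstrass
    (X : Type*) [TopologicalSpace X] [T2Space X] [LocallyCompactSpace X]
    (N : ℕ) (a : Fin N → X → ℝ) (ha : ∀ j, Continuous (a j))
    (v : X → ℝ) (hv : ∀ x, 0 ≤ v x)
    (hconst : ∃ j, ∃ c : ℝ, c ≠ 0 ∧ ∀ x, a j x = c)
    (hsep : ∀ x x' : X, x ≠ x' → ∃ j, a j x ≠ a j x')
    (hinf : ∀ R : ℝ, IsCompact {x : X | ∑ j, |a j x| ≤ R})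
    (C c' : ℝ) (hC : 0 < C) (hc' : 0 < c')
    (hvbd : ∀ x, ∀ j, v x ≤ C * Real.exp (-c' * |a j x|)) :
    ∀ f : X → ℝ, Continuous f → (∀ ε > (0 : ℝ), IsCompact {x : X | ε ≤ |f x| * v x}) →
      ∀ ε > (0 : ℝ), ∃ p : MvPolynomial (Fin N) ℝ,
        ∀ x : X, |f x - eval (fun j => a j x) p| * v x < ε := by
  intro f hf hfv ε hε
  obtain ⟨j₀, -⟩ := hconst
  have hN : (0:ℝ) < N := by exact_mod_cast (Nat.zero_le _).trans_lt j₀.2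
  have : Nonempty (Fin N) := ⟨j₀⟩
  obtain ⟨δ, hδ, hvb⟩ : ∃ δ > 0, ∀ x, v x ≤ C * Real.exp (-(δ * ∑ j, |a j x|)) := by
    refine ⟨c'/N, by positivity, fun x => ?_⟩
    obtain ⟨i, hi⟩ := Finite.exists_max (fun j => |a j x|)
    refine (hvbd x i).trans (mul_le_mul_of_nonneg_left (Real.exp_le_exp.2 ?_) hC.le)
    have h1 : ∑ j, |a j x| ≤ N * |a i x| := by
      have := Finset.sum_le_card_nsmul Finset.univ (fun j => |a j x|) _ (fun j _ => hi j)
      simpa using this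
    rw [neg_mul, neg_le_neg_iff, div_mul_eq_mul_div, div_le_iff₀ hN]
    nlinarith
  have hvC : ∀ x, v x ≤ C := fun x => (hvb x).trans (by
    refine mul_le_of_le_one_right hC.le (Real.exp_le_one_iff.2 ?_)
    have := Finset.sum_nonneg (fun j (_ : j ∈ Finset.univ) => abs_nonneg (a j x))
    have := mul_nonneg hδ.le this
    linarith)
  obtain ⟨B, hB, hfB⟩ : ∃ B > 0, ∀ x, ε/4 ≤ |f x| * v x → |f x| ≤ B := by
    obtain ⟨B, hB⟩ := (hfv (ε/4) (by positivity)).exists_bound_of_continuousOn hf.continuousOn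
    exact ⟨max B 1, by positivity, fun x hx => (hB x hx).trans (le_max_left _ _)⟩
  have hfg : ∀ x, |f x - WSW.clamp B (f x)| * v x ≤ ε/4 := fun x => by
    by_cases hx : ε/4 ≤ |f x| * v x
    · rw [WSW.clamp_of_abs (hfB x hx)]
      simp; positivity
    · exact (mul_le_mul_of_nonneg_right (WSW.clamp_sub hB.le _) (hv x)).trans (not_le.1 hx).le
  obtain ⟨R, hR⟩ : ∃ R : ℝ, 2 * B * (C * Real.exp (-(δ * R))) ≤ ε/4 := by
    have h1 : Filter.Tendsto (fun R : ℝ => 2 * B * (C * Real.exp (-(δ * R)))) Filter.atTop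
        (nhds (2 * B * (C * 0))) := by
      refine ((Real.tendsto_exp_neg_atTop_nhds_zero.comp
        (Filter.tendsto_id.const_mul_atTop hδ)).const_mul C).const_mul (2*B)
    rw [mul_zero, mul_zero] at h1
    obtain ⟨R, hR⟩ := (h1.eventually (gt_mem_nhds (show 0 < ε/4 by positivity))).exists
    exact ⟨R, hR.le⟩
  obtain ⟨τ, hτ, hτK⟩ :=
    ContinuousMap.exists_mem_subalgebra_near_continuous_of_isCompact_of_separatesPoints
    (WSW.sep (hv := hv) ha hC hδ hvb hsep)
    (⟨fun x => WSW.clamp B (f x), (WSW.clamp_cont B).comp hf⟩ : C(X, ℝ)) (hinf R)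
    (show 0 < ε/(4*C) by positivity)
  obtain ⟨p, hp⟩ := (WSW.mem_multAlg.1 (WSW.clamp_mem hC hδ hvb hB τ hτ)).2 1 (ε/4) (by positivity)
  refine ⟨p, fun x => ?_⟩
  have h1 := hp x
  rw [map_one, mul_one, ContinuousMap.coe_mk] at h1
  have h2 : |WSW.clamp B (f x) - WSW.clamp B (τ x)| * v x ≤ ε/4 := by
    by_cases hx : ∑ j, |a j x| ≤ R
    · have h3 : |τ x - WSW.clamp B (f x)| < ε/(4*C) := hτK x hx
      have h4 := WSW.clamp_lip B (WSW.clamp B (f x)) (τ x)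
      rw [WSW.clamp_of_abs (WSW.clamp_abs hB.le (f x)), abs_sub_comm _ (τ x)] at h4
      calc _ ≤ ε/(4*C) * C := mul_le_mul (h4.trans h3.le) (hvC x) (hv x) (by positivity)
        _ = ε/4 := by field_simp
    · refine le_trans (mul_le_mul ?_ ((hvb x).trans ?_) (hv x) (by positivity)) hR
      · have := WSW.clamp_abs hB.le (f x)
        have := WSW.clamp_abs hB.le (τ x)
        have := abs_sub (WSW.clamp B (f x)) (WSW.clamp B (τ x))
        linarith
      · refine mul_le_mul_of_nonneg_left (Real.exp_le_exp.2 ?_) hC.le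
        have := mul_le_mul_of_nonneg_left (not_le.1 hx).le hδ.le
        linarith
  have h3 := hfg x
  have h5 : |f x - eval (fun j => a j x) p| ≤ |f x - WSW.clamp B (f x)| +
      |WSW.clamp B (f x) - WSW.clamp B (τ x)| + |WSW.clamp B (τ x) - eval (fun j => a j x) p| := by
    have e1 := abs_sub_le (f x) (WSW.clamp B (f x)) (eval (fun j => a j x) p)
    have e2 := abs_sub_le (WSW.clamp B (f x)) (WSW.clamp B (τ x)) (eval (fun j => a j x) p)
    linarith
  have h6 := mul_le_mul_of_nonneg_right h5 (hv x)
  rw [add_mul, add_mul] at h6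
  linarith
end

section
/- Let X be a locally compact Hausdorff space, a₁,…,a_N : X → ℝ continuous with Σ|a_j| → ∞ at infinity (not necessarily separating points). Define the equivalence relation x ∼ y iff a_j(x) = a_j(y) for all j. If f : X → ℝ is continuous, vanishing at infinity with respect to a weight v satisfying v(x) ≤ C·exp(−c'|a_j(x)|), and f is constant on each equivalence class, then f can be approximated in the weighted sup-norm |g|_v = sup |g|·v by polynomials in a₁,…,a_N. -/
open MvPolynomial

lemma wsw_tail (y : ℝ) (hy : 0 ≤ y) (n : ℕ) :
    Real.exp y - ∑ m ∈ Finset.range n, y ^ m / (m.factorial : ℝ) ≤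
      (1 / 2) ^ n * Real.exp (2 * y) := by
  have h1 := Real.summable_pow_div_factorial y
  have h2 := Real.summable_pow_div_factorial (2 * y)
  have e1 : Real.exp y = ∑' m : ℕ, y ^ m / (m.factorial : ℝ) := by
    rw [Real.exp_eq_exp_ℝ, NormedSpace.exp_eq_tsum_div]
  have e2 : Real.exp (2 * y) = ∑' m : ℕ, (2 * y) ^ m / (m.factorial : ℝ) := by
    rw [Real.exp_eq_exp_ℝ, NormedSpace.exp_eq_tsum_div]
  have s1 := h1.sum_add_tsum_nat_add n
  have s2 := h2.sum_add_tsum_nat_add n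
  have p2 : 0 ≤ ∑ m ∈ Finset.range n, (2 * y) ^ m / (m.factorial : ℝ) :=
    Finset.sum_nonneg fun i _ => by positivity
  have t : ∑' m : ℕ, y ^ (m + n) / ((m + n).factorial : ℝ) ≤
      ∑' m : ℕ, (1 / 2) ^ n * ((2 * y) ^ (m + n) / ((m + n).factorial : ℝ)) := by
    refine Summable.tsum_le_tsum (fun m => ?_) ((summable_nat_add_iff n).2 h1)
      (((summable_nat_add_iff n).2 h2).mul_left _)
    rw [← mul_div_assoc]
    gcongr
    have : (1 / 2 : ℝ) ^ n * (2 * y) ^ (m + n) = 2 ^ m * y ^ (m + n) := by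
      rw [mul_pow, pow_add 2 m n]
      have : (1 / 2 : ℝ) ^ n * 2 ^ n = 1 := by rw [← mul_pow]; norm_num
      linear_combination 2 ^ m * y ^ (m + n) * this
    rw [this]
    have : (1 : ℝ) ≤ 2 ^ m := one_le_pow₀ (by norm_num)
    have : 0 ≤ y ^ (m + n) := by positivity
    nlinarith
  rw [tsum_mul_left] at t
  have : (0 : ℝ) < (1 / 2) ^ n := by positivity
  have : (1 / 2 : ℝ) ^ n * ∑' m : ℕ, ((2 * y) ^ (m + n) / ((m + n).factorial : ℝ)) ≤
      (1 / 2) ^ n * Real.exp (2 * y) := by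
    gcongr
    linarith
  linarith

lemma wsw_sin (y : ℝ) (n : ℕ) :
    |Real.sin y - ∑ m ∈ Finset.range n, ((Complex.I ^ m).im / (m.factorial : ℝ)) * y ^ m| ≤
      (1 / 2) ^ n * Real.exp (2 * |y|) := by
  have h := Complex.norm_exp_sub_sum_le_exp_norm_sub_sum (y * Complex.I) n
  have h2 := wsw_tail |y| (abs_nonneg y) n
  have h3 := Complex.abs_im_le_norm
    (Complex.exp (y * Complex.I) - ∑ m ∈ Finset.range n, (y * Complex.I) ^ m / (m.factorial : ℂ))
  have e : (Complex.exp (y * Complex.I) -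
      ∑ m ∈ Finset.range n, (y * Complex.I) ^ m / (m.factorial : ℂ)).im =
      Real.sin y - ∑ m ∈ Finset.range n, ((Complex.I ^ m).im / (m.factorial : ℝ)) * y ^ m := by
    rw [Complex.sub_im, Complex.exp_ofReal_mul_I_im, Complex.im_sum]
    congr 1
    refine Finset.sum_congr rfl fun m _ => ?_
    have : ((y : ℂ) * Complex.I) ^ m / (m.factorial : ℂ) =
        ((y ^ m / (m.factorial : ℝ) : ℝ) : ℂ) * Complex.I ^ m := by
      push_cast
      ring
    rw [this, Complex.im_ofReal_mul]
    ring
  rw [e] at h3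
  have e2 : ‖(y : ℂ) * Complex.I‖ = |y| := by simp
  rw [e2] at h
  linarith

lemma wsw_growth {N : ℕ} (P : MvPolynomial (Fin N) ℝ) :
    ∀ b > (0 : ℝ), ∃ D > (0 : ℝ), ∀ t : Fin N → ℝ, |eval t P| ≤ D * Real.exp (b * ‖t‖) := by
  induction P using MvPolynomial.induction_on with
  | C a =>
    intro b hb
    refine ⟨|a| + 1, by positivity, fun t => ?_⟩
    rw [eval_C]
    have : 1 ≤ Real.exp (b * ‖t‖) := Real.one_le_exp (by positivity)
    nlinarith [abs_nonneg a]
  | add p q hp hq =>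
    intro b hb
    obtain ⟨D, hD, h⟩ := hp b hb
    obtain ⟨D', hD', h'⟩ := hq b hb
    refine ⟨D + D', by positivity, fun t => ?_⟩
    rw [map_add]
    have := abs_add_le (eval t p) (eval t q)
    have := h t
    have := h' t
    linarith
  | mul_X p j hp =>
    intro b hb
    obtain ⟨D, hD, h⟩ := hp (b / 2) (by positivity)
    refine ⟨D * (2 / b), by positivity, fun t => ?_⟩
    rw [map_mul, eval_X, abs_mul]
    have h1 : |t j| ≤ 2 / b * Real.exp (b / 2 * ‖t‖) := by
      have h2 : |t j| ≤ ‖t‖ := norm_le_pi_norm t j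
      have h3 := Real.add_one_le_exp (b / 2 * ‖t‖)
      have : ‖t‖ = 2 / b * (b / 2 * ‖t‖) := by field_simp
      calc |t j| ≤ ‖t‖ := h2
        _ = 2 / b * (b / 2 * ‖t‖) := this
        _ ≤ _ := by gcongr; linarith
    calc |eval t p| * |t j| ≤ (D * Real.exp (b / 2 * ‖t‖)) * (2 / b * Real.exp (b / 2 * ‖t‖)) := by
          gcongr
          exact h t
      _ = D * (2 / b) * (Real.exp (b / 2 * ‖t‖) * Real.exp (b / 2 * ‖t‖)) := by ring
      _ = _ := by rw [← Real.exp_add]; congr 2; ring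

def wswAlg (N : ℕ) (c : ℝ) (hc : 0 < c) : Subalgebra ℝ C(Fin N → ℝ, ℝ) where
  carrier := {h | (∃ M : ℝ, ∀ t, |h t| ≤ M) ∧
    ∀ P : MvPolynomial (Fin N) ℝ, ∀ ε > (0 : ℝ), ∃ Q : MvPolynomial (Fin N) ℝ,
      ∀ t, |h t * eval t P - eval t Q| * Real.exp (-c * ‖t‖) ≤ ε}
  mul_mem' := by
    rintro h k ⟨⟨M, hM⟩, hh⟩ ⟨⟨M', hM'⟩, hk⟩
    have hM0 : 0 ≤ M := (abs_nonneg _).trans (hM 0)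
    refine ⟨⟨M * M', fun t => ?_⟩, fun P ε hε => ?_⟩
    · rw [ContinuousMap.mul_apply, abs_mul]
      exact mul_le_mul (hM t) (hM' t) (abs_nonneg _) hM0
    · obtain ⟨Q, hQ⟩ := hk P (ε / (2 * (M + 1))) (by positivity)
      obtain ⟨Q', hQ'⟩ := hh Q (ε / 2) (by positivity)
      refine ⟨Q', fun t => ?_⟩
      have e : (h * k) t * eval t P - eval t Q' =
        h t * (k t * eval t P - eval t Q) + (h t * eval t Q - eval t Q') := by
        rw [ContinuousMap.mul_apply]; ring
      rw [e]
      calc _ ≤ (|h t| * |k t * eval t P - eval t Q| + |h t * eval t Q - eval t Q'|) *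
            Real.exp (-c * ‖t‖) := by
              gcongr
              rw [← abs_mul]
              exact abs_add_le _ _
        _ = |h t| * (|k t * eval t P - eval t Q| * Real.exp (-c * ‖t‖)) +
            |h t * eval t Q - eval t Q'| * Real.exp (-c * ‖t‖) := by ring
        _ ≤ (M + 1) * (ε / (2 * (M + 1))) + ε / 2 := by
              gcongr
              · linarith [hM t]
              · exact hQ t
              · exact hQ' t
        _ = ε := by field_simp; ring
  add_mem' := by
    rintro h k ⟨⟨M, hM⟩, hh⟩ ⟨⟨M', hM'⟩, hk⟩
    refine ⟨⟨M + M', fun t => ?_⟩, fun P ε hε => ?_⟩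
    · exact (abs_add_le _ _).trans (add_le_add (hM t) (hM' t))
    · obtain ⟨Q, hQ⟩ := hh P (ε / 2) (by positivity)
      obtain ⟨Q', hQ'⟩ := hk P (ε / 2) (by positivity)
      refine ⟨Q + Q', fun t => ?_⟩
      have e : (h + k) t * eval t P - eval t (Q + Q') =
        (h t * eval t P - eval t Q) + (k t * eval t P - eval t Q') := by
        rw [ContinuousMap.add_apply, map_add]; ring
      rw [e]
      calc _ ≤ (|h t * eval t P - eval t Q| + |k t * eval t P - eval t Q'|) *
            Real.exp (-c * ‖t‖) := by
              gcongr
              exact abs_add_le _ _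
        _ ≤ ε := by
              rw [add_mul]
              linarith [hQ t, hQ' t]
  algebraMap_mem' := by
    intro r
    refine ⟨⟨|r|, fun t => le_of_eq rfl⟩, fun P ε hε => ⟨C r * P, fun t => ?_⟩⟩
    have : (algebraMap ℝ C(Fin N → ℝ, ℝ) r) t = r := rfl
    rw [this, map_mul, eval_C, sub_self, abs_zero, zero_mul]
    exact hε.le

lemma wsw_sin_mem (N : ℕ) (c : ℝ) (hc : 0 < c) (j : Fin N) (s : ℝ) (hs : 0 < s) (hsc : s ≤ c / 4) :
    (⟨fun t => Real.sin (s * t j), by fun_prop⟩ : C(Fin N → ℝ, ℝ)) ∈ wswAlg N c hc := by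
  refine ⟨⟨1, fun t => Real.abs_sin_le_one _⟩, fun P ε hε => ?_⟩
  obtain ⟨D, hD, hP⟩ := wsw_growth P (c / 2) (by positivity)
  obtain ⟨n, hn⟩ := exists_pow_lt_of_lt_one (div_pos hε hD) (by norm_num : (1 / 2 : ℝ) < 1)
  refine ⟨(∑ m ∈ Finset.range n, C ((Complex.I ^ m).im / (m.factorial : ℝ)) * (C s * X j) ^ m) * P,
    fun t => ?_⟩
  have h := wsw_sin (s * t j) n
  simp only [ContinuousMap.coe_mk, map_mul, map_sum, map_pow, eval_C, eval_X]
  rw [← sub_mul, abs_mul]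
  have h2 : |s * t j| ≤ c / 4 * ‖t‖ := by
    rw [abs_mul, abs_of_pos hs]
    have : |t j| ≤ ‖t‖ := norm_le_pi_norm t j
    gcongr
  calc _ ≤ ((1 / 2) ^ n * Real.exp (2 * (c / 4 * ‖t‖))) * (D * Real.exp (c / 2 * ‖t‖)) *
        Real.exp (-c * ‖t‖) := by
        gcongr
        · refine h.trans ?_
          gcongr
        · exact hP t
    _ = (1 / 2) ^ n * D * (Real.exp (2 * (c / 4 * ‖t‖)) * Real.exp (c / 2 * ‖t‖) *
        Real.exp (-c * ‖t‖)) := by ring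
    _ = (1 / 2) ^ n * D := by
        rw [← Real.exp_add, ← Real.exp_add]
        have : 2 * (c / 4 * ‖t‖) + c / 2 * ‖t‖ + -c * ‖t‖ = 0 := by ring
        rw [this, Real.exp_zero, mul_one]
    _ ≤ ε := by
        rw [lt_div_iff₀ hD] at hn
        exact hn.le

lemma wsw_main (N : ℕ) (c : ℝ) (hc : 0 < c) (G : C(Fin N → ℝ, ℝ)) (M : ℝ) (hM : ∀ t, |G t| ≤ M)
    (ε : ℝ) (hε : 0 < ε) :
    ∃ Q : MvPolynomial (Fin N) ℝ, ∀ t, |G t - eval t Q| * Real.exp (-c * ‖t‖) < ε := by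
  have hM0 : 0 ≤ M := (abs_nonneg _).trans (hM 0)
  set δ := ε / 4 with hδ
  have hδ0 : 0 < δ := by positivity
  obtain ⟨L, hL0, hL⟩ : ∃ L > 0, ∀ r, L < r → (2 * M + δ) * Real.exp (-c * r) ≤ δ := by
    refine ⟨(2 * M + δ) / (c * δ), by positivity, fun r hr => ?_⟩
    rw [div_lt_iff₀ (by positivity)] at hr
    have h1 := Real.add_one_le_exp (c * r)
    have : -c * r = -(c * r) := by ring
    rw [this, Real.exp_neg, ← div_eq_mul_inv, div_le_iff₀ (Real.exp_pos _)]
    nlinarith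
  let K : Set (Fin N → ℝ) := Metric.closedBall 0 L
  have hK : IsCompact K := isCompact_closedBall 0 L
  haveI : CompactSpace K := isCompact_iff_compactSpace.1 hK
  let ρ := ContinuousMap.compRightAlgHom ℝ ℝ (⟨Subtype.val, continuous_subtype_val⟩ : C(K, Fin N → ℝ))
  let A : Subalgebra ℝ C(K, ℝ) := (wswAlg N c hc).map ρ
  have hA : A.SeparatesPoints := by
    rintro x y hxy
    have : ∃ j, x.1 j ≠ y.1 j := by
      by_contra! hcon
      exact hxy (Subtype.ext (funext hcon))
    obtain ⟨j, hj⟩ := this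
    set s := min (c / 4) (1 / L) with hs
    have hs0 : 0 < s := by positivity
    refine ⟨_, ⟨_, ⟨_, wsw_sin_mem N c hc j s hs0 (min_le_left _ _), rfl⟩, rfl⟩, ?_⟩
    change Real.sin (s * x.1 j) ≠ Real.sin (s * y.1 j)
    intro heq
    have key : ∀ z : K, s * z.1 j ∈ Set.Icc (-(Real.pi / 2)) (Real.pi / 2) := by
      intro z
      have h1 : ‖z.1‖ ≤ L := mem_closedBall_zero_iff.1 z.2
      have h2 : |z.1 j| ≤ L := (norm_le_pi_norm z.1 j).trans h1
      have h3 : |s * z.1 j| ≤ 1 := by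
        rw [abs_mul, abs_of_pos hs0]
        calc s * |z.1 j| ≤ 1 / L * L := by
              gcongr
              exact min_le_right _ _
          _ = 1 := by field_simp
      have := Real.pi_gt_three
      rw [abs_le] at h3
      constructor <;> linarith
    exact hj (mul_left_cancel₀ hs0.ne' (Real.injOn_sin (key x) (key y) heq))
  obtain ⟨⟨g, ⟨h, hh, rfl⟩⟩, hg⟩ :=
    ContinuousMap.exists_mem_subalgebra_near_continuous_of_separatesPoints A hA
      (fun x => G x.1) (by fun_prop) δ hδ0
  have hg' : ∀ t, ‖t‖ ≤ L → |h t - G t| < δ := by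
    intro t ht
    exact hg ⟨t, by simpa [K] using ht⟩
  obtain ⟨M', hM'⟩ := hh.1
  obtain ⟨q, hq⟩ := exists_polynomial_near_of_continuousOn (-M') M' (fun x => max (-M) (min M x))
    (by fun_prop) δ hδ0
  have hu : Polynomial.aeval h q ∈ wswAlg N c hc := by
    have := Polynomial.aeval_mem_adjoin_singleton ℝ h (p := q)
    exact Algebra.adjoin_le (by simpa using hh) this
  have hut : ∀ t, (Polynomial.aeval h q) t = q.eval (h t) := by
    intro t
    have := Polynomial.aeval_algHom_apply (ContinuousMap.evalAlgHom ℝ ℝ t) h q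
    simpa using this.symm
  obtain ⟨Q, hQ⟩ := hu.2 1 δ hδ0
  refine ⟨Q, fun t => ?_⟩
  have h1 := hQ t
  rw [map_one, mul_one, hut] at h1
  have h2 := hq (h t) (abs_le.1 (hM' t))
  have hw : 0 < Real.exp (-c * ‖t‖) := Real.exp_pos _
  have hw1 : Real.exp (-c * ‖t‖) ≤ 1 := Real.exp_le_one_iff.2 (by
    have : 0 ≤ c * ‖t‖ := by positivity
    linarith)
  have hGM := abs_le.1 (hM t)
  have h3 : |G t - q.eval (h t)| * Real.exp (-c * ‖t‖) ≤ 2 * δ := by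
    have h2' := abs_lt.1 h2
    rcases le_or_gt ‖t‖ L with ht | ht
    · have h4 := abs_lt.1 (hg' t ht)
      have : |G t - q.eval (h t)| ≤ 2 * δ := by
        rw [abs_le]
        constructor <;> rcases max_cases (-M) (min M (h t)) with ⟨a, b⟩ | ⟨a, b⟩ <;>
          rcases min_cases M (h t) with ⟨a', b'⟩ | ⟨a', b'⟩ <;> simp only [a, a'] at * <;> linarith
      nlinarith [abs_nonneg (G t - q.eval (h t))]
    · have h4 := hL _ ht
      have : |G t - q.eval (h t)| ≤ 2 * M + δ := by
        have l1 : -M ≤ max (-M) (min M (h t)) := le_max_left _ _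
        have l2 : max (-M) (min M (h t)) ≤ M := max_le (by linarith) (min_le_left _ _)
        rw [abs_le]
        constructor <;> linarith
      nlinarith
  calc |G t - eval t Q| * Real.exp (-c * ‖t‖)
      ≤ (|G t - q.eval (h t)| + |q.eval (h t) - eval t Q|) * Real.exp (-c * ‖t‖) := by
        gcongr
        exact abs_sub_le _ _ _
    _ < ε := by rw [add_mul]; linarith

/-- Weighted Stone–Weierstrass theorem without point separation: functions subordinate to
the system (constant on the equivalence classes of the system) can be approximated in the
weighted sup-norm by polynomials in the system. -/
theorem weighted_stone_weierstrass_subordinate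
    (X : Type*) [TopologicalSpace X] [T2Space X] [LocallyCompactSpace X]
    (N : ℕ) (a : Fin N → X → ℝ) (ha : ∀ j, Continuous (a j))
    (v : X → ℝ) (hv : ∀ x, 0 ≤ v x)
    (hconst : ∃ j, ∃ c : ℝ, c ≠ 0 ∧ ∀ x, a j x = c)
    (hinf : ∀ R : ℝ, IsCompact {x : X | ∑ j, |a j x| ≤ R})
    (C c' : ℝ) (hC : 0 < C) (hc' : 0 < c')
    (hvbd : ∀ x, ∀ j, v x ≤ C * Real.exp (-c' * |a j x|))
    (f : X → ℝ) (hf : Continuous f)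
    (hf0 : ∀ ε > (0 : ℝ), IsCompact {x : X | ε ≤ |f x| * v x})
    (hsub : ∀ x y : X, (∀ j, a j x = a j y) → f x = f y) :
    ∀ ε > (0 : ℝ), ∃ p : MvPolynomial (Fin N) ℝ,
      ∀ x : X, |f x - eval (fun j => a j x) p| * v x < ε := by
  intro ε hε
  obtain ⟨j0, -⟩ := hconst
  haveI : Nonempty (Fin N) := ⟨j0⟩
  let α : X → Fin N → ℝ := fun x j => a j x
  have hα : Continuous α := continuous_pi ha
  have hvα : ∀ x, v x ≤ C * Real.exp (-c' * ‖α x‖) := by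
    intro x
    obtain ⟨j, hj⟩ := Finite.exists_max (fun j => ‖α x j‖)
    have h1 : ‖α x‖ ≤ ‖α x j‖ := (pi_norm_le_iff_of_nonempty (α x)).2 hj
    have h2 : ‖α x‖ = |a j x| := le_antisymm h1 (norm_le_pi_norm (α x) j)
    rw [h2]
    exact hvbd x j
  have hprop : IsProperMap α := by
    rw [isProperMap_iff_isCompact_preimage]
    refine ⟨hα, fun K hK => ?_⟩
    obtain ⟨R, hR⟩ := hK.isBounded.exists_norm_le
    refine (hinf (∑ _j : Fin N, R)).of_isClosed_subset (hK.isClosed.preimage hα) ?_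
    intro x hx
    exact Finset.sum_le_sum fun j _ => (norm_le_pi_norm (α x) j).trans (hR _ hx)
  obtain ⟨F, hF⟩ : ∃ F : C(Fin N → ℝ, ℝ), ∀ x, F (α x) = f x := by
    have hcl : IsClosed (Set.range α) := hprop.isClosedMap.isClosed_range
    let β : C(X, Set.range α) := ⟨Set.rangeFactorization α, by fun_prop⟩
    have hβ : Topology.IsQuotientMap β := by
      refine IsClosedMap.isQuotientMap ?_ β.continuous Set.rangeFactorization_surjective
      intro s hs
      have h1 := hprop.isClosedMap s hs
      have : β '' s = Subtype.val ⁻¹' (α '' s) := by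
        ext ⟨y, hy⟩
        simp [β, Set.rangeFactorization, Subtype.ext_iff]
      rw [this]
      exact h1.preimage continuous_subtype_val
    have hfac : Function.FactorsThrough (⟨f, hf⟩ : C(X, ℝ)) β := by
      intro x y hxy
      have : α x = α y := congrArg Subtype.val hxy
      exact hsub x y fun j => congrFun this j
    obtain ⟨F, hF⟩ := ContinuousMap.exists_restrict_eq hcl (hβ.lift ⟨f, hf⟩ hfac)
    refine ⟨F, fun x => ?_⟩
    have h1 := DFunLike.congr_fun hF (β x)
    have h2 := DFunLike.congr_fun (hβ.lift_comp ⟨f, hf⟩ hfac) x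
    exact h1.trans h2
  obtain ⟨R, hR⟩ := ((hf0 (ε / 2) (by positivity)).image hα).isBounded.exists_norm_le
  let χ : (Fin N → ℝ) → ℝ := fun t => max 0 (min 1 (R + 1 - ‖t‖))
  have hχ0 : ∀ t, 0 ≤ χ t := fun t => le_max_left _ _
  have hχ1 : ∀ t, χ t ≤ 1 := fun t => max_le zero_le_one (min_le_left _ _)
  let G : C(Fin N → ℝ, ℝ) := ⟨fun t => F t * χ t, by fun_prop⟩
  obtain ⟨M, hM⟩ : ∃ M, ∀ t, |G t| ≤ M := by
    obtain ⟨M, hM⟩ := (isCompact_closedBall (0 : Fin N → ℝ) (R + 1)).exists_bound_of_continuousOn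
      F.continuous.continuousOn
    refine ⟨max M 0, fun t => ?_⟩
    change |F t * χ t| ≤ _
    rcases le_or_gt ‖t‖ (R + 1) with ht | ht
    · have := hM t (by simpa using ht)
      rw [Real.norm_eq_abs] at this
      rw [abs_mul, abs_of_nonneg (hχ0 t)]
      refine le_trans ?_ (le_max_left _ _)
      nlinarith [abs_nonneg (F t), hχ0 t, hχ1 t]
    · have : χ t = 0 := max_eq_left ((min_le_right _ _).trans (by linarith))
      rw [this, mul_zero, abs_zero]
      exact le_max_right _ _
  obtain ⟨Q, hQ⟩ := wsw_main N c' hc' G M hM (ε / (2 * C)) (by positivity)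
  refine ⟨Q, fun x => ?_⟩
  change |f x - eval (α x) Q| * v x < ε
  have h1 : |f x - G (α x)| * v x ≤ ε / 2 := by
    have e : f x - G (α x) = f x * (1 - χ (α x)) := by
      change f x - F (α x) * χ (α x) = _
      rw [hF]; ring
    rw [e, abs_mul, abs_of_nonneg (sub_nonneg.2 (hχ1 _))]
    by_cases hx : ε / 2 ≤ |f x| * v x
    · have h2 := hR _ (Set.mem_image_of_mem α hx)
      have : χ (α x) = 1 := by
        have : min 1 (R + 1 - ‖α x‖) = 1 := min_eq_left (by linarith)
        simp only [χ, this]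
        norm_num
      rw [this]
      simp
      positivity
    · push Not at hx
      have : 0 ≤ |f x| * v x := mul_nonneg (abs_nonneg _) (hv x)
      nlinarith [hχ0 (α x), hχ1 (α x)]
  have h2 : |G (α x) - eval (α x) Q| * v x < ε / 2 := by
    calc _ ≤ |G (α x) - eval (α x) Q| * (C * Real.exp (-c' * ‖α x‖)) := by
          gcongr
          exact hvα x
      _ = C * (|G (α x) - eval (α x) Q| * Real.exp (-c' * ‖α x‖)) := by ring
      _ < C * (ε / (2 * C)) := by
          gcongr
          exact hQ (α x)
      _ = ε / 2 := by field_simp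
  calc |f x - eval (α x) Q| * v x
      ≤ (|f x - G (α x)| + |G (α x) - eval (α x) Q|) * v x :=
        mul_le_mul_of_nonneg_right (abs_sub_le _ _ _) (hv x)
    _ < ε := by rw [add_mul]; linarith
end

section
/- Let X be a locally compact Hausdorff space, a₁,…,a_N : X → ℝ continuous functions containing a nonzero constant with Σ|a_j| → ∞ at infinity, v a weight with v(x) ≤ C·exp(−c'|a_j(x)|) for all j, and let ν₀ be a nonnegative locally finite Borel measure on X such that ∫ v(x)^{−1} dν₀(x) < ∞. Then every continuous compactly supported function f that is constant on each set {y : a_j(y) = a_j(x) ∀j} can be approximated arbitrarily well in L¹(ν₀) by functions of the form p(a₁,…,a_N) with p a polynomial. -/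
open MvPolynomial MeasureTheory

lemma aux_complexMGF {Ω : Type*} [MeasurableSpace Ω] (μ₁ μ₂ : Measure Ω) (Y : Ω → ℝ)
    (h1 : 0 ∈ interior (ProbabilityTheory.integrableExpSet Y μ₁))
    (h2 : 0 ∈ interior (ProbabilityTheory.integrableExpSet Y μ₂))
    (h : ∀ n : ℕ, ∫ x, Y x ^ n ∂μ₁ = ∫ x, Y x ^ n ∂μ₂) (t : ℝ) :
    ProbabilityTheory.complexMGF Y μ₁ (t * Complex.I)
      = ProbabilityTheory.complexMGF Y μ₂ (t * Complex.I) := by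
  have hd : ∀ n : ℕ, iteratedDeriv n (ProbabilityTheory.complexMGF Y μ₁) 0
      = iteratedDeriv n (ProbabilityTheory.complexMGF Y μ₂) 0 := by
    intro n
    rw [ProbabilityTheory.iteratedDeriv_complexMGF (by simpa using h1),
      ProbabilityTheory.iteratedDeriv_complexMGF (by simpa using h2)]
    simp only [zero_mul, Complex.exp_zero, mul_one, ← Complex.ofReal_pow]
    rw [integral_complex_ofReal, integral_complex_ofReal, h n]
  have ha1 := ProbabilityTheory.analyticAt_complexMGF (X := Y) (μ := μ₁) (z := 0)
    (by simpa using h1)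
  have ha2 := ProbabilityTheory.analyticAt_complexMGF (X := Y) (μ := μ₂) (z := 0)
    (by simpa using h2)
  have hev : ProbabilityTheory.complexMGF Y μ₁ =ᶠ[nhds 0] ProbabilityTheory.complexMGF Y μ₂ := by
    have e1 := ha1.hasFPowerSeriesAt
    have e2 := ha2.hasFPowerSeriesAt
    simp only [hd] at e1
    filter_upwards [e1.eventually_hasSum_sub, e2.eventually_hasSum_sub] with y y1 y2
    exact y1.unique y2
  set U : Set ℂ := Complex.reLm ⁻¹' (interior (ProbabilityTheory.integrableExpSet Y μ₁) ∩
    interior (ProbabilityTheory.integrableExpSet Y μ₂)) with hU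
  have hpc : IsPreconnected U :=
    (((ProbabilityTheory.convex_integrableExpSet (X := Y) (μ := μ₁)).interior.inter
      (ProbabilityTheory.convex_integrableExpSet (X := Y)
        (μ := μ₂)).interior).linear_preimage Complex.reLm).isPreconnected
  have A1 : AnalyticOnNhd ℂ (ProbabilityTheory.complexMGF Y μ₁) U :=
    ProbabilityTheory.analyticOnNhd_complexMGF.mono (fun z hz => hz.1)
  have A2 : AnalyticOnNhd ℂ (ProbabilityTheory.complexMGF Y μ₂) U :=
    ProbabilityTheory.analyticOnNhd_complexMGF.mono (fun z hz => hz.2)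
  refine A1.eqOn_of_preconnected_of_eventuallyEq A2 hpc (z₀ := 0) ?_ hev ?_
  · simp [hU, h1, h2]
  · simp [hU, h1, h2]

lemma aux_poly_bound {N : ℕ} (p : MvPolynomial (Fin N) ℝ) :
    ∀ c > (0 : ℝ), ∃ K, 0 ≤ K ∧ ∀ x : Fin N → ℝ, |eval x p| ≤ K * Real.exp (c * ‖x‖) := by
  induction p using MvPolynomial.induction_on with
  | C r =>
    intro c hc
    refine ⟨|r|, abs_nonneg _, fun x => ?_⟩
    rw [eval_C]
    exact le_mul_of_one_le_right (abs_nonneg _) (Real.one_le_exp (by positivity))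
  | add p q hp hq =>
    intro c hc
    obtain ⟨K, hK, h1⟩ := hp c hc
    obtain ⟨K', hK', h2⟩ := hq c hc
    refine ⟨K + K', by positivity, fun x => ?_⟩
    rw [map_add, add_mul]
    exact (abs_add_le _ _).trans (add_le_add (h1 x) (h2 x))
  | mul_X p n hp =>
    intro c hc
    obtain ⟨K, hK, h1⟩ := hp (c / 2) (by positivity)
    refine ⟨K * (2 / c), by positivity, fun x => ?_⟩
    rw [map_mul, eval_X, abs_mul]
    have h3 : |x n| ≤ (2 / c) * Real.exp (c / 2 * ‖x‖) := by
      have h4 : |x n| ≤ ‖x‖ := norm_le_pi_norm x n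
      have h5 := Real.add_one_le_exp (c / 2 * ‖x‖)
      have h6 : ‖x‖ = (2 / c) * (c / 2 * ‖x‖) := by field_simp
      rw [h6] at h4
      refine h4.trans ?_
      gcongr
      linarith
    calc |eval x p| * |x n| ≤ (K * Real.exp (c / 2 * ‖x‖)) * ((2 / c) * Real.exp (c / 2 * ‖x‖)) :=
          mul_le_mul (h1 x) h3 (abs_nonneg _) (by positivity)
      _ = K * (2 / c) * (Real.exp (c / 2 * ‖x‖) * Real.exp (c / 2 * ‖x‖)) := by ring
      _ = _ := by rw [← Real.exp_add]; ring_nf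

lemma aux_exp_memLp {N : ℕ} (μ : Measure (Fin N → ℝ)) (c : ℝ)
    (hint : Integrable (fun x => Real.exp (c * ‖x‖)) μ) :
    MemLp (fun x : Fin N → ℝ => Real.exp (c / 2 * ‖x‖)) 2 μ := by
  rw [memLp_two_iff_integrable_sq (by fun_prop)]
  refine hint.congr (Filter.Eventually.of_forall fun x => ?_)
  simp only [sq, ← Real.exp_add]
  ring_nf

lemma aux_poly_memLp {N : ℕ} (μ : Measure (Fin N → ℝ)) (c : ℝ) (hc : 0 < c)
    (hint : Integrable (fun x => Real.exp (c * ‖x‖)) μ) (p : MvPolynomial (Fin N) ℝ) :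
    MemLp (fun x => eval x p) 2 μ := by
  obtain ⟨K, hK, h⟩ := aux_poly_bound p (c / 2) (by positivity)
  refine ((aux_exp_memLp μ c hint).const_mul K).mono'
    (MvPolynomial.continuous_eval p).aestronglyMeasurable
    (Filter.Eventually.of_forall fun x => h x)

lemma aux_mem_interior {N : ℕ} (μ : Measure (Fin N → ℝ)) (c : ℝ) (hc : 0 < c)
    (hint : Integrable (fun x => Real.exp (c * ‖x‖)) μ) (h : (Fin N → ℝ) → ℝ)
    (hh : MemLp h 2 μ) (L : StrongDual ℝ (Fin N → ℝ)) :
    0 ∈ interior (ProbabilityTheory.integrableExpSet (fun x => L x)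
      (μ.withDensity fun x => ENNReal.ofReal (h x))) := by
  rw [mem_interior_iff_mem_nhds]
  refine Filter.mem_of_superset (Metric.ball_mem_nhds 0
    (ε := c / 2 / (‖L‖ + 1)) (by positivity)) fun t ht => ?_
  rw [mem_ball_zero_iff, lt_div_iff₀ (by positivity)] at ht
  change Integrable _ _
  rw [integrable_withDensity_iff_integrable_smul₀' hh.1.aemeasurable.ennreal_ofReal (by simp)]
  have := MemLp.integrable_mul (q := 2) hh (aux_exp_memLp μ c hint)
  refine this.mono ?_ (Filter.Eventually.of_forall fun x => ?_)
  · have k1 : AEStronglyMeasurable (fun x => (ENNReal.ofReal (h x)).toReal) μ :=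
      hh.1.aemeasurable.ennreal_ofReal.ennreal_toReal.aestronglyMeasurable
    have k2 : AEStronglyMeasurable (fun x => Real.exp (t * L x)) μ := by fun_prop
    exact k1.smul k2
  · rw [norm_smul, Pi.mul_apply, norm_mul, ENNReal.toReal_ofReal', Real.norm_eq_abs,
      Real.norm_eq_abs, Real.norm_eq_abs, Real.norm_eq_abs, Real.abs_exp, Real.abs_exp]
    refine mul_le_mul ?_ (Real.exp_le_exp.2 ?_) (Real.exp_pos _).le (abs_nonneg _)
    · rw [abs_of_nonneg (le_max_right _ _)]
      exact max_le (le_abs_self _) (abs_nonneg _)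
    · calc t * L x ≤ ‖t * L x‖ := le_abs_self _
        _ ≤ ‖t‖ * (‖L‖ * ‖x‖) := by rw [norm_mul]; gcongr; exact L.le_opNorm x
        _ ≤ ‖t‖ * ((‖L‖ + 1) * ‖x‖) := by gcongr; linarith
        _ = ‖t‖ * (‖L‖ + 1) * ‖x‖ := by ring
        _ ≤ _ := by gcongr

lemma aux_ortho {N : ℕ} (μ : Measure (Fin N → ℝ)) [IsFiniteMeasure μ] (c : ℝ) (hc : 0 < c)
    (hint : Integrable (fun x => Real.exp (c * ‖x‖)) μ) (h : (Fin N → ℝ) → ℝ)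
    (hh : MemLp h 2 μ) (ho : ∀ p : MvPolynomial (Fin N) ℝ, ∫ x, h x * eval x p ∂μ = 0) :
    h =ᵐ[μ] 0 := by
  have hi : Integrable h μ := hh.integrable (by norm_num)
  have hhn : MemLp (fun x => - h x) 2 μ := hh.neg
  have f1 : IsFiniteMeasure (μ.withDensity fun x => ENNReal.ofReal (h x)) :=
    isFiniteMeasure_withDensity_ofReal hi.2
  have f2 : IsFiniteMeasure (μ.withDensity fun x => ENNReal.ofReal (- h x)) :=
    isFiniteMeasure_withDensity_ofReal hi.neg.2
  have hmom : ∀ p : MvPolynomial (Fin N) ℝ,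
      ∫ x, eval x p ∂(μ.withDensity fun x => ENNReal.ofReal (h x))
      = ∫ x, eval x p ∂(μ.withDensity fun x => ENNReal.ofReal (- h x)) := by
    intro p
    rw [integral_withDensity_eq_integral_toReal_smul₀ hh.1.aemeasurable.ennreal_ofReal (by simp),
      integral_withDensity_eq_integral_toReal_smul₀ hhn.1.aemeasurable.ennreal_ofReal (by simp),
      ← sub_eq_zero]
    have hp := aux_poly_memLp μ c hc hint p
    have g1 : Integrable (fun x => (ENNReal.ofReal (h x)).toReal • eval x p) μ := by
      simp only [ENNReal.toReal_ofReal', smul_eq_mul]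
      exact MemLp.integrable_mul (p := 2) (q := 2) hh.pos_part hp
    have g2 : Integrable (fun x => (ENNReal.ofReal (- h x)).toReal • eval x p) μ := by
      simp only [ENNReal.toReal_ofReal', smul_eq_mul]
      exact MemLp.integrable_mul (p := 2) (q := 2) hhn.pos_part hp
    rw [← integral_sub g1 g2, ← ho p]
    congr 1
    ext x
    simp only [ENNReal.toReal_ofReal', smul_eq_mul, ← sub_mul]
    congr 1
    rcases le_total 0 (h x) with h0 | h0
    · rw [max_eq_left h0, max_eq_right (by linarith)]; ring
    · rw [max_eq_right h0, max_eq_left (by linarith)]; ring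
  have heq : (μ.withDensity fun x => ENNReal.ofReal (h x))
      = μ.withDensity fun x => ENNReal.ofReal (- h x) := by
    refine Measure.ext_of_charFunDual (funext fun L => ?_)
    have := aux_complexMGF _ _ (fun x => L x) (aux_mem_interior μ c hc hint h hh L)
      (aux_mem_interior μ c hc hint _ hhn L) (fun n => ?_) 1
    · rw [charFunDual_apply, charFunDual_apply]
      simpa [ProbabilityTheory.complexMGF, mul_comm] using this
    · have hL : ∀ x, L x ^ n = eval x ((∑ j, C (L (Pi.single j 1)) * X j) ^ n) := by
        intro x
        rw [map_pow, map_sum]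
        congr 1
        conv_lhs => rw [← Finset.univ_sum_single x, map_sum]
        refine Finset.sum_congr rfl fun j _ => ?_
        have : (Pi.single j (x j) : Fin N → ℝ) = x j • Pi.single j 1 := by
          rw [← Pi.single_smul]; simp
        rw [this, map_smul]
        simp [mul_comm]
      simp only [hL]
      exact hmom _
  rw [withDensity_eq_iff hh.1.aemeasurable.ennreal_ofReal hhn.1.aemeasurable.ennreal_ofReal
    hi.lintegral_lt_top.ne] at heq
  filter_upwards [heq] with x hx
  have := congrArg ENNReal.toReal hx
  simp only [ENNReal.toReal_ofReal'] at this
  rcases le_total 0 (h x) with h0 | h0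
  · rw [max_eq_left h0, max_eq_right (by linarith)] at this; exact this
  · rw [max_eq_right h0, max_eq_left (by linarith)] at this; simp; linarith

lemma aux_dense {N : ℕ} (μ : Measure (Fin N → ℝ)) [IsFiniteMeasure μ] (c : ℝ) (hc : 0 < c)
    (hint : Integrable (fun x => Real.exp (c * ‖x‖)) μ) (g : (Fin N → ℝ) → ℝ)
    (hg : MemLp g 2 μ) (ε : ℝ) (hε : 0 < ε) :
    ∃ p : MvPolynomial (Fin N) ℝ, eLpNorm (fun x => g x - eval x p) 2 μ < ENNReal.ofReal ε := by
  let T : MvPolynomial (Fin N) ℝ →ₗ[ℝ] Lp ℝ 2 μ :=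
    { toFun := fun p => (aux_poly_memLp μ c hc hint p).toLp _
      map_add' := fun p q => by
        rw [← MemLp.toLp_add]
        congr 1
        ext x; simp
      map_smul' := fun r p => by
        rw [RingHom.id_apply, ← MemLp.toLp_const_smul]
        congr 1
        ext x; simp [smul_eval] }
  have hT : (LinearMap.range T).topologicalClosure = ⊤ := by
    rw [Submodule.topologicalClosure_eq_top_iff, Submodule.eq_bot_iff]
    intro h hh
    have : (h : (Fin N → ℝ) → ℝ) =ᵐ[μ] 0 := by
      refine aux_ortho μ c hc hint h (Lp.memLp h) fun p => ?_
      have := (Submodule.mem_orthogonal' _ _).1 hh (T p) ⟨p, rfl⟩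
      rw [L2.inner_def] at this
      rw [← this]
      refine integral_congr_ae ?_
      filter_upwards [(aux_poly_memLp μ c hc hint p).coeFn_toLp] with x hx
      change _ = inner ℝ (h x) (((aux_poly_memLp μ c hc hint p).toLp _ : Lp ℝ 2 μ) x)
      rw [hx]
      simp [mul_comm]
    exact (Lp.eq_zero_iff_ae_eq_zero).2 this
  have hm : hg.toLp g ∈ (LinearMap.range T).topologicalClosure := by rw [hT]; trivial
  have hm' : hg.toLp g ∈ closure (LinearMap.range T : Set (Lp ℝ 2 μ)) := hm
  obtain ⟨_, ⟨p, rfl⟩, hp⟩ := EMetric.mem_closure_iff.1 hm' (ENNReal.ofReal ε)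
    (by simpa using hε)
  refine ⟨p, ?_⟩
  rwa [show T p = (aux_poly_memLp μ c hc hint p).toLp _ from rfl, Lp.edist_toLp_toLp] at hp

/-- L¹ approximation corollary of the weighted Stone–Weierstrass theorem: continuous
compactly supported functions subordinate to the system can be approximated in `L¹(ν₀)`
by polynomials in the system, provided `∫ v⁻¹ dν₀ < ∞`. -/
theorem weighted_stone_weierstrass_L1
    (X : Type*) [TopologicalSpace X] [T2Space X] [LocallyCompactSpace X]
    [MeasurableSpace X] [BorelSpace X]
    (N : ℕ) (a : Fin N → X → ℝ) (ha : ∀ j, Continuous (a j))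
    (v : X → ℝ) (hv : ∀ x, 0 < v x)
    (hconst : ∃ j, ∃ c : ℝ, c ≠ 0 ∧ ∀ x, a j x = c)
    (hinf : ∀ R : ℝ, IsCompact {x : X | ∑ j, |a j x| ≤ R})
    (C c' : ℝ) (hC : 0 < C) (hc' : 0 < c')
    (hvbd : ∀ x, ∀ j, v x ≤ C * Real.exp (-c' * |a j x|))
    (ν₀ : Measure X) [IsLocallyFiniteMeasure ν₀]
    (hν₀ : ∫⁻ x, ENNReal.ofReal (v x)⁻¹ ∂ν₀ < ⊤)
    (f : X → ℝ) (hf : Continuous f) (hfc : HasCompactSupport f)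
    (hsub : ∀ x y : X, (∀ j, a j x = a j y) → f x = f y) :
    ∀ ε > (0 : ℝ), ∃ p : MvPolynomial (Fin N) ℝ,
      ∫⁻ x, ENNReal.ofReal |f x - eval (fun j => a j x) p| ∂ν₀ < ENNReal.ofReal ε := by
  intro ε hε
  obtain ⟨j₀, -⟩ := hconst
  have : Nonempty (Fin N) := ⟨j₀⟩
  let A : X → Fin N → ℝ := fun x j => a j x
  have hA : Continuous A := continuous_pi ha
  -- exponential integrability
  have hexp : ∀ x, C⁻¹ * Real.exp (c' * ‖A x‖) ≤ (v x)⁻¹ := by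
    intro x
    obtain ⟨j, hj⟩ : ∃ j, ‖A x‖ = |a j x| := by
      obtain ⟨j, -, hj⟩ := Finset.exists_mem_eq_sup' (Finset.univ_nonempty (α := Fin N))
        (fun j => ‖A x j‖₊)
      refine ⟨j, ?_⟩
      rw [Finset.sup'_eq_sup] at hj
      rw [Pi.norm_def, hj]
      rfl
    rw [hj, le_inv_comm₀ (by positivity) (hv x), mul_inv, inv_inv, ← Real.exp_neg, ← neg_mul]
    exact hvbd x j
  have hint0 : Integrable (fun x => C⁻¹ * Real.exp (c' * ‖A x‖)) ν₀ := by
    refine ⟨by fun_prop, ?_⟩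
    rw [hasFiniteIntegral_iff_ofReal (Filter.Eventually.of_forall fun x => by positivity)]
    exact (lintegral_mono fun x => ENNReal.ofReal_le_ofReal (hexp x)).trans_lt hν₀
  have hint1 : Integrable (fun x => Real.exp (c' * ‖A x‖)) ν₀ := by
    have := hint0.const_mul C
    simpa [← mul_assoc, hC.ne'] using this
  have hfin : IsFiniteMeasure ν₀ := by
    have h1 : Integrable (fun _ : X => (1 : ℝ)) ν₀ := by
      refine hint1.mono' (by fun_prop) (Filter.Eventually.of_forall fun x => ?_)
      simp only [norm_one]
      exact Real.one_le_exp (by positivity)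
    exact (integrable_const_iff_isFiniteMeasure one_ne_zero).1 h1
  let μ : Measure (Fin N → ℝ) := ν₀.map A
  have : IsFiniteMeasure μ := by infer_instance
  have hint : Integrable (fun x => Real.exp (c' * ‖x‖)) μ := by
    rw [integrable_map_measure (by fun_prop) hA.aemeasurable]
    exact hint1
  -- factorisation
  have hproper : IsProperMap A := by
    rw [isProperMap_iff_isCompact_preimage]
    refine ⟨hA, fun K hK => ?_⟩
    obtain ⟨R, hR⟩ := hK.isBounded.exists_norm_le
    refine (hinf (N * R)).of_isClosed_subset (hK.isClosed.preimage hA) fun x hx => ?_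
    have h1 : ∀ j ∈ Finset.univ, |a j x| ≤ R := fun j _ =>
      (norm_le_pi_norm (A x) j).trans (hR _ hx)
    simpa using Finset.sum_le_card_nsmul _ _ _ h1
  have hcl : IsClosedMap A := hproper.isClosedMap
  let B : C(X, Set.range A) := ⟨Set.rangeFactorization A, hA.rangeFactorization⟩
  have hBcl : IsClosedMap B := by
    intro s hs
    rw [isClosed_induced_iff]
    refine ⟨A '' s, hcl s hs, ?_⟩
    ext ⟨y, hy⟩
    simp [B, Set.rangeFactorization, Subtype.ext_iff]
  have hBq : Topology.IsQuotientMap B :=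
    hBcl.isQuotientMap B.continuous Set.rangeFactorization_surjective
  have hfac : Function.FactorsThrough (⟨f, hf⟩ : C(X, ℝ)) B := by
    intro x y hxy
    exact hsub x y fun j => congrFun (congrArg Subtype.val hxy) j
  let g₀ : C(Set.range A, ℝ) := hBq.lift ⟨f, hf⟩ hfac
  have hg₀ : ∀ x, g₀ (B x) = f x := fun x =>
    DFunLike.congr_fun (hBq.lift_comp ⟨f, hf⟩ hfac) x
  obtain ⟨M, hM⟩ := hfc.exists_bound_of_continuous hf
  let g₁ : BoundedContinuousFunction (Set.range A) ℝ :=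
    BoundedContinuousFunction.ofNormedAddCommGroup g₀ g₀.continuous M (by
      rintro ⟨_, x, rfl⟩
      exact (congrArg norm (hg₀ x)).le.trans (hM x))
  obtain ⟨g, -, hg⟩ := g₁.exists_extension_norm_eq_of_isClosedEmbedding
    (hcl.isClosed_range.isClosedEmbedding_subtypeVal)
  have hgf : ∀ x, g (A x) = f x := fun x => (congrFun hg (B x)).trans (hg₀ x)
  have hgm : MemLp g 2 μ := MemLp.of_bound g.continuous.aestronglyMeasurable ‖g‖
    (Filter.Eventually.of_forall g.norm_coe_le_norm)
  -- approximation
  set m : ℝ := (μ Set.univ).toReal ^ (1 / 2 : ℝ) with hm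
  have hm0 : 0 ≤ m := by positivity
  obtain ⟨p, hp⟩ := aux_dense μ c' hc' hint g hgm (ε / (m + 1)) (by positivity)
  refine ⟨p, ?_⟩
  have hcont : Continuous fun x : Fin N → ℝ => g x - eval x p :=
    g.continuous.sub (MvPolynomial.continuous_eval p)
  have e1 : ∫⁻ x, ENNReal.ofReal |f x - eval (fun j => a j x) p| ∂ν₀
      = eLpNorm (fun x => g x - eval x p) 1 μ := by
    rw [eLpNorm_one_eq_lintegral_enorm, lintegral_map hcont.measurable.enorm hA.measurable]
    refine lintegral_congr fun x => ?_
    rw [hgf, Real.enorm_eq_ofReal_abs]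
  rw [e1]
  have e2 := eLpNorm_le_eLpNorm_mul_rpow_measure_univ (μ := μ) (p := 1) (q := 2)
    (by norm_num) hcont.aestronglyMeasurable
  have e3 : μ Set.univ ^ (1 / (1 : ENNReal).toReal - 1 / (2 : ENNReal).toReal)
      = ENNReal.ofReal m := by
    rw [hm, ← ENNReal.ofReal_rpow_of_nonneg (by positivity) (by norm_num),
      ENNReal.ofReal_toReal (measure_ne_top _ _)]
    norm_num
  rw [e3] at e2
  calc _ ≤ _ := e2
    _ ≤ ENNReal.ofReal (ε / (m + 1)) * ENNReal.ofReal m := by gcongr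
    _ = ENNReal.ofReal (ε / (m + 1) * m) := by rw [ENNReal.ofReal_mul (by positivity)]
    _ < ENNReal.ofReal ε := by
      rw [ENNReal.ofReal_lt_ofReal_iff hε, div_mul_eq_mul_div, div_lt_iff₀ (by positivity)]
      nlinarith
end

section
/- In the real one-variable case, Theorem on weighted Stone–Weierstrass with X = ℝ, a₁ = 1, a₂(x) = x³, and weight v(x) = exp(−c|x|³) (c > 0) holds: the algebra of polynomials in x³, i.e. real polynomials all of whose monomials have degree divisible by 3, is dense in the space of continuous f : ℝ → ℝ with f(x)·exp(−c|x|³) → 0 at infinity, in the norm sup_x |f(x)|·exp(−c|x|³). -/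
open Polynomial

lemma wsw_exp_tail (x : ℝ) (hx : 0 ≤ x) (n : ℕ) :
    Real.exp x - ∑ m ∈ Finset.range n, x ^ m / m.factorial ≤ (1/2) ^ n * Real.exp (2 * x) := by
  have e : ∀ y : ℝ, Real.exp y = ∑' m : ℕ, y ^ m / m.factorial := fun y => by
    rw [Real.exp_eq_exp_ℝ, NormedSpace.exp_eq_tsum_div]
  have s := Real.summable_pow_div_factorial
  have h1 := (s x).sum_add_tsum_nat_add n
  have h2 := (s (2*x)).sum_add_tsum_nat_add n
  rw [← e] at h1 h2
  have h3 : 0 ≤ ∑ m ∈ Finset.range n, (2*x) ^ m / m.factorial :=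
    Finset.sum_nonneg fun i _ => by positivity
  have h4 : ∑' i : ℕ, x ^ (i + n) / ((i + n).factorial : ℝ)
      ≤ ∑' i : ℕ, (1/2) ^ n * ((2*x) ^ (i + n) / ((i + n).factorial : ℝ)) := by
    refine Summable.tsum_le_tsum (fun i => ?_) ((summable_nat_add_iff n).2 (s x))
      (((summable_nat_add_iff n).2 (s (2*x))).mul_left _)
    rw [← mul_div_assoc]
    gcongr
    rw [mul_pow, pow_add 2, ← mul_assoc]
    have : (1/2:ℝ) ^ n * (2 ^ i * 2 ^ n) = 2 ^ i := by
      rw [mul_comm (2 ^ i : ℝ), ← mul_assoc, ← mul_pow]; norm_num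
    rw [this]
    exact le_mul_of_one_le_left (by positivity) (one_le_pow₀ (by norm_num))
  rw [tsum_mul_left] at h4
  calc _ = ∑' i : ℕ, x ^ (i + n) / ((i + n).factorial : ℝ) := by linarith
    _ ≤ _ := h4
    _ ≤ _ := by gcongr; linarith

/-- Functions that are weighted limits of complex polynomials. -/
def wswV (c : ℝ) : Submodule ℂ (ℝ → ℂ) where
  carrier := {F | ∀ ε > (0:ℝ), ∃ p : ℂ[X], ∀ y : ℝ,
    ‖F y - p.eval (y:ℂ)‖ * Real.exp (-c * |y|) ≤ ε}
  zero_mem' := fun ε hε => ⟨0, fun y => by simpa using hε.le⟩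
  add_mem' := by
    intro F G hF hG ε hε
    obtain ⟨p, hp⟩ := hF (ε/2) (by positivity)
    obtain ⟨q, hq⟩ := hG (ε/2) (by positivity)
    refine ⟨p + q, fun y => ?_⟩
    have h : ‖(F + G) y - (p+q).eval (y:ℂ)‖ ≤ ‖F y - p.eval (y:ℂ)‖ + ‖G y - q.eval (y:ℂ)‖ := by
      rw [Pi.add_apply, eval_add, add_sub_add_comm]; exact norm_add_le _ _
    have := mul_le_mul_of_nonneg_right h (Real.exp_pos (-c * |y|)).le
    linarith [hp y, hq y, add_mul ‖F y - p.eval (y:ℂ)‖ ‖G y - q.eval (y:ℂ)‖ (Real.exp (-c * |y|))]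
  smul_mem' := by
    intro a F hF ε hε
    obtain ⟨p, hp⟩ := hF (ε/(‖a‖+1)) (by positivity)
    refine ⟨C a * p, fun y => ?_⟩
    have : ‖(a • F) y - (C a * p).eval (y:ℂ)‖ = ‖a‖ * ‖F y - p.eval (y:ℂ)‖ := by
      rw [Pi.smul_apply, eval_mul, eval_C, smul_eq_mul, ← mul_sub, norm_mul]
    rw [this, mul_assoc]
    calc _ ≤ ‖a‖ * (ε/(‖a‖+1)) := by gcongr; exact hp y
      _ ≤ (‖a‖+1) * (ε/(‖a‖+1)) := by gcongr; linarith
      _ = ε := by field_simp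

lemma wswV_closed {c : ℝ} {F : ℝ → ℂ} (h : ∀ ε > (0:ℝ), ∃ G ∈ wswV c, ∀ y : ℝ,
    ‖F y - G y‖ * Real.exp (-c * |y|) ≤ ε) : F ∈ wswV c := by
  intro ε hε
  obtain ⟨G, hG, h1⟩ := h (ε/2) (by positivity)
  obtain ⟨q, hq⟩ := hG (ε/2) (by positivity)
  refine ⟨q, fun y => ?_⟩
  have h : ‖F y - q.eval (y:ℂ)‖ ≤ ‖F y - G y‖ + ‖G y - q.eval (y:ℂ)‖ := norm_sub_le_norm_sub_add_norm_sub _ _ _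
  have := mul_le_mul_of_nonneg_right h (Real.exp_pos (-c * |y|)).le
  linarith [h1 y, hq y, add_mul ‖F y - G y‖ ‖G y - q.eval (y:ℂ)‖ (Real.exp (-c * |y|))]

/-- monomial times character -/
noncomputable def wswE (k : ℕ) (t : ℝ) : ℝ → ℂ := fun y => (y:ℂ) ^ k * Complex.exp (t * y * Complex.I)

lemma wswE_zero (c : ℝ) (k : ℕ) : wswE k 0 ∈ wswV c := by
  intro ε hε
  exact ⟨X ^ k, fun y => by simpa [wswE] using hε.le⟩

lemma wswE_step {c : ℝ} (hc : 0 < c) {t s : ℝ} (hs : |s| ≤ c / 4)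
    (h : ∀ k, wswE k t ∈ wswV c) (k : ℕ) : wswE k (t + s) ∈ wswV c := by
  apply wswV_closed
  intro ε hε
  set M : ℝ := k.factorial / (c/2) ^ k with hM
  have hM0 : 0 < M := by positivity
  obtain ⟨n, hn⟩ := exists_pow_lt_of_lt_one (show 0 < ε / M by positivity)
    (show (1/2:ℝ) < 1 by norm_num)
  refine ⟨∑ m ∈ Finset.range n, ((s * Complex.I) ^ m / m.factorial : ℂ) • wswE (k + m) t,
    Submodule.sum_mem _ fun m _ => Submodule.smul_mem _ _ (h _), fun y => ?_⟩
  have e1 : wswE k (t + s) y - (∑ m ∈ Finset.range n,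
      ((s * Complex.I) ^ m / m.factorial : ℂ) • wswE (k + m) t) y
      = (y:ℂ) ^ k * Complex.exp (((t * y : ℝ) : ℂ) * Complex.I) *
        (Complex.exp (s * y * Complex.I) -
        ∑ m ∈ Finset.range n, (s * y * Complex.I) ^ m / m.factorial) := by
    rw [mul_sub, Finset.mul_sum, Finset.sum_apply]
    congr 1
    · simp only [wswE]
      rw [mul_assoc ((y:ℂ) ^ k), ← Complex.exp_add]
      congr 2
      push_cast; ring
    · refine Finset.sum_congr rfl fun m _ => ?_
      simp only [wswE, Pi.smul_apply, smul_eq_mul]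
      push_cast
      ring
  rw [e1, norm_mul, norm_mul, Complex.norm_exp_ofReal_mul_I, mul_one, norm_pow, Complex.norm_real,
    Real.norm_eq_abs]
  have hz : ‖(s * y * Complex.I : ℂ)‖ = |s| * |y| := by simp
  have h1 := (Complex.norm_exp_sub_sum_le_exp_norm_sub_sum (s * y * Complex.I) n).trans
    (wsw_exp_tail _ (norm_nonneg _) n)
  rw [hz] at h1
  have h2 : |y| ^ k ≤ M * Real.exp (c/2 * |y|) := by
    have := Real.pow_div_factorial_le_exp (x := c/2*|y|) (by positivity) k
    rw [div_le_iff₀ (by positivity), mul_pow] at this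
    rw [hM, div_mul_eq_mul_div, le_div_iff₀ (by positivity)]
    linarith
  have h3 : Real.exp (2 * (|s| * |y|)) ≤ Real.exp (c/2 * |y|) := by
    apply Real.exp_le_exp.2
    nlinarith [abs_nonneg y]
  calc _ ≤ (M * Real.exp (c/2 * |y|)) * ((1/2)^n * Real.exp (c/2 * |y|)) * Real.exp (-c * |y|) := by
        gcongr
        exact h1.trans (by gcongr)
    _ = M * (1/2)^n * (Real.exp (c/2 * |y|) * Real.exp (c/2 * |y|) * Real.exp (-c * |y|)) := by ring
    _ = M * (1/2)^n := by
        rw [← Real.exp_add, ← Real.exp_add]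
        rw [show c/2 * |y| + c/2 * |y| + -c * |y| = 0 by ring]; simp
    _ ≤ M * (ε / M) := by gcongr
    _ = ε := by field_simp

lemma wswE_mem {c : ℝ} (hc : 0 < c) (t : ℝ) (k : ℕ) : wswE k t ∈ wswV c := by
  obtain ⟨N, hN⟩ := exists_nat_gt (|t| / (c/4))
  have hN0 : (0:ℝ) < N := lt_of_le_of_lt (by positivity) hN
  have hs : |t / N| ≤ c/4 := by
    rw [abs_div, Nat.abs_cast, div_le_iff₀ hN0]
    rw [div_lt_iff₀ (by positivity)] at hN
    linarith
  have : ∀ j : ℕ, ∀ k, wswE k (j * (t/N)) ∈ wswV c := by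
    intro j
    induction j with
    | zero => intro k; simpa using wswE_zero c k
    | succ j ih =>
      intro k
      have := wswE_step hc hs ih k
      rwa [show ((j+1 : ℕ) : ℝ) * (t/N) = j * (t/N) + t/N by push_cast; ring]
  have h := this N k
  rwa [mul_div_cancel₀ _ hN0.ne'] at h

lemma wsw_trig {c : ℝ} (hc : 0 < c) (T : ℝ) (P : C(AddCircle T, ℂ))
    (hP : P ∈ Submodule.span ℂ (Set.range (@fourier T))) :
    (fun y : ℝ => P (y : AddCircle T)) ∈ wswV c := by
  induction hP using Submodule.span_induction with
  | mem x hx =>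
    obtain ⟨n, rfl⟩ := hx
    have := wswE_mem hc (2 * Real.pi * n / T) 0
    convert this using 1
    funext y
    rw [fourier_coe_apply]
    simp only [wswE, pow_zero, one_mul]
    congr 1
    push_cast; ring
  | zero => exact (wswV c).zero_mem
  | add x y _ _ hx hy => exact (wswV c).add_mem hx hy
  | smul a x _ hx => exact (wswV c).smul_mem a hx

lemma wsw_main_s9 {c : ℝ} (hc : 0 < c) (g : ℝ → ℝ) (hg : Continuous g)
    (hg0 : Filter.Tendsto (fun x => |g x| * Real.exp (-c * |x|)) (Filter.cocompact ℝ) (nhds 0)) :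
    (fun y => (g y : ℂ)) ∈ wswV c := by
  apply wswV_closed
  intro ε hε
  have hev := hg0.eventually (gt_mem_nhds (show 0 < ε/2 by positivity))
  obtain ⟨R, hR⟩ := Metric.closedBall_compl_subset_of_mem_cocompact hev (0:ℝ)
  have hR' : ∀ y, R < |y| → |g y| * Real.exp (-c * |y|) < ε/2 := fun y hy => hR (by simpa using hy)
  set L := |R| + 1 with hL
  have hL0 : 0 < L := by positivity
  let k : ℝ → ℝ := fun y => g y * max 0 (min 1 (L - |y|))
  have hk : Continuous k := by fun_prop
  have hkL : ∀ y, L ≤ |y| → k y = 0 := fun y hy => by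
    have : min 1 (L - |y|) ≤ 0 := (min_le_right _ _).trans (by linarith)
    simp [k, max_eq_left this]
  have hgk : ∀ y, |g y - k y| * Real.exp (-c * |y|) ≤ ε/2 := by
    intro y
    by_cases hy : R < |y|
    · refine le_trans ?_ (hR' y hy).le
      refine mul_le_mul_of_nonneg_right ?_ (Real.exp_pos _).le
      have h0 : 0 ≤ max 0 (min 1 (L - |y|)) := le_max_left _ _
      have h1 : max 0 (min 1 (L - |y|)) ≤ 1 := max_le zero_le_one (min_le_left _ _)
      have : g y - k y = g y * (1 - max 0 (min 1 (L - |y|))) := by simp only [k]; ring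
      rw [this, abs_mul]
      apply mul_le_of_le_one_right (abs_nonneg _)
      rw [abs_le]; constructor <;> linarith
    · have : 1 ≤ L - |y| := by have := le_abs_self R; rw [hL]; linarith
      have : k y = g y := by simp [k, min_eq_left this]
      rw [this]; simp; positivity
  obtain ⟨M, hM⟩ : ∃ M, ∀ y, |k y| ≤ M := by
    obtain ⟨M, hM⟩ := (isCompact_Icc (a := -L) (b := L)).exists_bound_of_continuousOn hk.continuousOn
    refine ⟨max M 0, fun y => ?_⟩
    by_cases hy : |y| ≤ L
    · exact (hM y (abs_le.1 hy)).trans (le_max_left _ _)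
    · rw [hkL y (by linarith)]; simp
  have hM0 : 0 ≤ M := (abs_nonneg _).trans (hM 0)
  obtain ⟨T, hTL, hT⟩ : ∃ T, L ≤ T ∧ (M + ε/2) * Real.exp (-c * T) ≤ ε/2 := by
    have : Filter.Tendsto (fun T => (M + ε/2) * Real.exp (-c * T)) Filter.atTop (nhds 0) := by
      rw [show (0:ℝ) = (M + ε/2) * 0 by simp]
      apply Filter.Tendsto.const_mul
      apply Real.tendsto_exp_atBot.comp
      exact Filter.tendsto_id.const_mul_atTop_of_neg (by linarith)
    obtain ⟨T, h1, h2⟩ := ((Filter.eventually_ge_atTop L).and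
      (this.eventually (ge_mem_nhds (show 0 < ε/2 by positivity)))).exists
    exact ⟨T, h1, h2⟩
  have hT0 : 0 < T := by linarith
  have : Fact (0 < 2 * T) := ⟨by positivity⟩
  let K : C(AddCircle (2*T), ℂ) := ⟨AddCircle.liftIco (2*T) (-T) (fun y => (k y : ℂ)), by
    apply AddCircle.liftIco_continuous
    · rw [hkL (-T) (by rw [abs_neg, abs_of_pos hT0]; exact hTL), hkL (-T + 2*T)]
      rw [show -T + 2*T = T by ring, abs_of_pos hT0]; exact hTL
    · exact (Complex.continuous_ofReal.comp hk).continuousOn⟩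
  have hKv : ∀ y ∈ Set.Ico (-T) (-T+2*T), K (y : AddCircle (2*T)) = k y := fun y hy =>
    AddCircle.liftIco_coe_apply (f := fun y => (k y : ℂ)) hy
  have hKM : ∀ z, ‖K z‖ ≤ M := by
    intro z
    obtain ⟨y, hy, rfl⟩ : ∃ y ∈ Set.Ico (-T) (-T+2*T), (y : AddCircle (2*T)) = z :=
      ⟨_, (AddCircle.equivIco (2*T) (-T) z).2, AddCircle.coe_equivIco⟩
    rw [hKv y hy, Complex.norm_real]; exact hM y
  have hcl : K ∈ (Submodule.span ℂ (Set.range (@fourier (2*T)))).topologicalClosure := by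
    rw [span_fourier_closure_eq_top]; trivial
  obtain ⟨P, hP, hKP⟩ := Metric.mem_closure_iff.1 hcl (ε/2) (by positivity)
  have hd : ∀ z, ‖K z - P z‖ ≤ ε/2 := fun z => by
    rw [← dist_eq_norm]
    exact (ContinuousMap.dist_apply_le_dist z).trans hKP.le
  refine ⟨_, wsw_trig hc (2*T) P hP, fun y => ?_⟩
  have hkP : ‖(k y : ℂ) - P (y : AddCircle (2*T))‖ * Real.exp (-c * |y|) ≤ ε/2 := by
    by_cases hy : y ∈ Set.Ico (-T) (-T+2*T)
    · have h1 := hd y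
      rw [hKv y hy] at h1
      have h2 : Real.exp (-c * |y|) ≤ 1 := Real.exp_le_one_iff.2 (by nlinarith [abs_nonneg y])
      calc _ ≤ ε/2 * 1 := by gcongr
        _ = _ := by ring
    · have hyT : T ≤ |y| := by
        by_contra! h
        rw [abs_lt] at h
        exact hy ⟨h.1.le, by linarith [h.2]⟩
      rw [hkL y (hTL.trans hyT)]
      have h1 : ‖P (y : AddCircle (2*T))‖ ≤ M + ε/2 := by
        have := norm_sub_norm_le (P (y : AddCircle (2*T))) (K y)
        rw [norm_sub_rev] at this
        linarith [hd y, hKM y]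
      have h2 : Real.exp (-c * |y|) ≤ Real.exp (-c * T) := Real.exp_le_exp.2 (by nlinarith)
      refine le_trans ?_ hT
      simp only [Complex.ofReal_zero, zero_sub, norm_neg]
      gcongr
  have h : ‖(g y : ℂ) - P (y : AddCircle (2*T))‖ ≤
      |g y - k y| + ‖(k y : ℂ) - P (y : AddCircle (2*T))‖ := by
    have := norm_sub_le_norm_sub_add_norm_sub (g y : ℂ) (k y : ℂ) (P (y : AddCircle (2*T)))
    rwa [← Complex.ofReal_sub, Complex.norm_real, Real.norm_eq_abs] at this
  have h5 := mul_le_mul_of_nonneg_right h (Real.exp_pos (-c * |y|)).le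
  rw [add_mul] at h5
  linarith [hgk y]

lemma wsw_re (p : ℂ[X]) : ∃ q : ℝ[X], ∀ y : ℝ, q.eval y = (p.eval (y:ℂ)).re := by
  induction p using Polynomial.induction_on' with
  | add p q hp hq =>
    obtain ⟨a, ha⟩ := hp
    obtain ⟨b, hb⟩ := hq
    exact ⟨a + b, fun y => by simp [ha, hb]⟩
  | monomial n a =>
    exact ⟨monomial n a.re, fun y => by
      rw [eval_monomial, eval_monomial, ← Complex.ofReal_pow, Complex.re_mul_ofReal]⟩

/-- Instance of the weighted Stone–Weierstrass theorem on `ℝ` with generators `1` and `x³`: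
polynomials with all monomial degrees divisible by 3 are dense with weight `exp(-c|x|³)`. -/
theorem weighted_stone_weierstrass_cubes
    (c : ℝ) (hc : 0 < c)
    (f : ℝ → ℝ) (hf : Continuous f)
    (hf0 : Filter.Tendsto (fun x => |f x| * Real.exp (-c * |x| ^ 3))
      (Filter.cocompact ℝ) (nhds 0)) :
    ∀ ε > (0 : ℝ), ∃ p : Polynomial ℝ, (∀ n ∈ p.support, 3 ∣ n) ∧
      ∀ x : ℝ, |f x - p.eval x| * Real.exp (-c * |x| ^ 3) < ε := by
  intro ε hε
  have hmono : StrictMono (fun x : ℝ => x ^ 3) := Odd.strictMono_pow (by decide)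
  have hsurj : Function.Surjective (fun x : ℝ => x ^ 3) := by
    apply Continuous.surjective (by fun_prop)
    · exact Filter.tendsto_pow_atTop (by norm_num)
    · refine Filter.tendsto_atBot.2 fun b => ?_
      filter_upwards [Filter.eventually_le_atBot (-(|b| + 1))] with x hx
      have h1 := neg_abs_le b
      have h2 := abs_nonneg b
      have h3 : 1 ≤ x ^ 2 := by nlinarith
      nlinarith
  let e : ℝ ≃ₜ ℝ := (hmono.orderIsoOfSurjective _ hsurj).toHomeomorph
  have he : ∀ x, e x = x ^ 3 := fun x => rfl
  have hes : ∀ x, e.symm x ^ 3 = x := fun x => by rw [← he, e.apply_symm_apply]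
  have hmem := wsw_main_s9 hc (fun y => f (e.symm y)) (hf.comp e.symm.continuous) (by
    have := hf0.comp e.symm.isClosedEmbedding.tendsto_cocompact
    refine this.congr fun y => ?_
    simp only [Function.comp]
    rw [← abs_pow, hes])
  obtain ⟨p, hp⟩ := hmem (ε/2) (by positivity)
  obtain ⟨q, hq⟩ := wsw_re p
  refine ⟨expand ℝ 3 q, fun n hn => ?_, fun x => ?_⟩
  · by_contra h
    rw [mem_support_iff, coeff_expand (by norm_num), if_neg h] at hn
    exact hn rfl
  · have h1 := hp (x ^ 3)
    have h2 : e.symm (x ^ 3) = x := by rw [← he, e.symm_apply_apply]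
    simp only [h2] at h1
    rw [expand_eval, hq, ← abs_pow]
    have h3 := Complex.abs_re_le_norm ((f x : ℂ) - p.eval ((x ^ 3 : ℝ) : ℂ))
    rw [Complex.sub_re, Complex.ofReal_re] at h3
    have h4 := mul_le_mul_of_nonneg_right h3 (Real.exp_pos (-c * |x ^ 3|)).le
    linarith
end

section
/- Let F : ℂ^d → ℂ be a measurable function satisfying |F(z)| ≤ b·e^{|z|² − κ|z|} for some b, κ > 0 (class D_{1,1}). If ∫_{ℂ^d} F(z)·p(z)·conj(q(z))·e^{−|z|²} dV(z) = 0 for all analytic polynomials p, q in d complex variables, then F = 0 almost everywhere. -/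
open MeasureTheory MvPolynomial

/-- The Euclidean norm `|z|` on `ℂ^d`. -/
noncomputable def euclNorm {d : ℕ} (z : Fin d → ℂ) : ℝ :=
  Real.sqrt (∑ j, ‖z j‖ ^ 2)

theorem aux_int_exp {d : ℕ} (c : ℝ) (hc : 0 < c) :
    Integrable (fun z : Fin d → ℂ => Real.exp (-c * ‖z‖)) := by
  obtain ⟨n, hn⟩ := exists_nat_gt (Module.finrank ℝ (Fin d → ℂ) : ℝ)
  have h1 := (integrable_one_add_norm (μ := (volume : Measure (Fin d → ℂ))) hn).const_mul
    (Real.exp c * (n.factorial / c ^ n))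
  refine h1.mono' (by fun_prop) (Filter.Eventually.of_forall fun z => ?_)
  have hz := norm_nonneg z
  have h2 := Real.pow_div_factorial_le_exp (x := c * (1 + ‖z‖)) (by positivity) n
  have h4 : Real.exp (-c * ‖z‖) * Real.exp (c * (1 + ‖z‖)) = Real.exp c := by
    rw [← Real.exp_add]; congr 1; ring
  have h5 : (0:ℝ) < (1 + ‖z‖) ^ n := by positivity
  have hf : (0:ℝ) < n.factorial := by positivity
  rw [Real.norm_eq_abs, abs_of_pos (Real.exp_pos _), Real.rpow_neg (by positivity),
    Real.rpow_natCast]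
  have h6 : Real.exp (-c * ‖z‖) * ((c * (1 + ‖z‖)) ^ n / n.factorial) ≤ Real.exp c := by
    rw [← h4]; gcongr
  rw [mul_pow] at h6
  have : Real.exp (-c * ‖z‖) = Real.exp (-c * ‖z‖) * (c ^ n * (1 + ‖z‖) ^ n / n.factorial) *
      ((n.factorial / c ^ n) * ((1 + ‖z‖) ^ n)⁻¹) := by
    field_simp
  rw [this, mul_assoc (Real.exp c)]
  gcongr

theorem aux_int_pow {d : ℕ} (c : ℝ) (hc : 0 < c) (n : ℕ) :
    Integrable (fun z : Fin d → ℂ => ‖z‖ ^ n * Real.exp (-c * ‖z‖)) := by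
  refine ((aux_int_exp (d := d) (c / 2) (by positivity)).const_mul
    (n.factorial / (c / 2) ^ n)).mono' (by fun_prop) (Filter.Eventually.of_forall fun z => ?_)
  have hz := norm_nonneg z
  have h2 := Real.pow_div_factorial_le_exp (x := c / 2 * ‖z‖) (by positivity) n
  have h4 : Real.exp (-c * ‖z‖) = Real.exp (-(c / 2) * ‖z‖) * Real.exp (-(c / 2 * ‖z‖)) := by
    rw [← Real.exp_add]; congr 1; ring
  have hf : (0:ℝ) < n.factorial := by positivity
  rw [Real.norm_eq_abs, abs_of_nonneg (by positivity), h4]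
  have h5 : ‖z‖ ^ n = (n.factorial / (c / 2) ^ n) * ((c / 2 * ‖z‖) ^ n / n.factorial) := by
    rw [mul_pow]; field_simp
  have h6 : (c / 2 * ‖z‖) ^ n / n.factorial * Real.exp (-(c / 2 * ‖z‖)) ≤ 1 := by
    rw [Real.exp_neg, ← div_eq_mul_inv, div_le_one (Real.exp_pos _)]; exact h2
  calc _ = (n.factorial / (c / 2) ^ n) * Real.exp (-(c / 2) * ‖z‖) *
        ((c / 2 * ‖z‖) ^ n / n.factorial * Real.exp (-(c / 2 * ‖z‖))) := by rw [h5]; ring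
    _ ≤ (n.factorial / (c / 2) ^ n) * Real.exp (-(c / 2) * ‖z‖) * 1 := by gcongr
    _ = _ := by ring

theorem aux_step {α : Type*} [MeasurableSpace α] (μ : Measure α) (G : α → ℂ) (L : α → ℝ)
    (hG : Measurable G) (hL : Measurable L)
    (hi : Integrable (fun x => ‖G x‖ * Real.exp (2 * |L x|)) μ)
    (h0 : ∀ m : ℕ, ∫ x, G x * (L x : ℂ) ^ m ∂μ = 0) (k : ℕ) :
    ∀ m : ℕ, ∫ x, G x * (L x : ℂ) ^ m * Complex.exp (k * (L x * Complex.I)) ∂μ = 0 := by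
  induction k with
  | zero => simpa using h0
  | succ k ih =>
    intro m
    have hm : ∀ x, |L x| ^ m ≤ m.factorial * Real.exp |L x| := fun x => by
      have := Real.pow_div_factorial_le_exp (x := |L x|) (abs_nonneg (L x)) m
      rw [div_le_iff₀ (by positivity)] at this
      linarith
    have hsum : ∀ x, HasSum (fun n : ℕ => ‖G x‖ * |L x| ^ m * (|L x| ^ n / n.factorial))
        (‖G x‖ * |L x| ^ m * Real.exp |L x|) := fun x => by
      have := NormedSpace.expSeries_div_hasSum_exp (|L x|)
      rw [← Real.exp_eq_exp_ℝ] at this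
      exact this.mul_left _
    have key := hasSum_integral_of_dominated_convergence (μ := μ)
      (F := fun (n : ℕ) x => G x * (L x : ℂ) ^ m * Complex.exp (k * (L x * Complex.I)) *
        ((L x * Complex.I) ^ n / n.factorial))
      (f := fun x => G x * (L x : ℂ) ^ m * Complex.exp ((k + 1 : ℕ) * (L x * Complex.I)))
      (bound := fun n x => ‖G x‖ * |L x| ^ m * (|L x| ^ n / n.factorial))
      (fun n => by
        apply Measurable.aestronglyMeasurable
        fun_prop)
      (fun n => Filter.Eventually.of_forall fun x => by
        have : ‖Complex.exp (k * (L x * Complex.I))‖ = 1 := by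
          have := Complex.norm_exp_ofReal_mul_I (k * L x)
          push_cast at this
          rwa [mul_assoc] at this
        simp [this])
      (Filter.Eventually.of_forall fun x => (hsum x).summable)
      (by
        simp_rw [fun x => (hsum x).tsum_eq]
        refine (hi.const_mul (m.factorial : ℝ)).mono' ?_ (Filter.Eventually.of_forall fun x => ?_)
        · apply Measurable.aestronglyMeasurable
          fun_prop
        · rw [Real.norm_eq_abs, abs_of_nonneg (by positivity), two_mul, Real.exp_add]
          calc _ ≤ ‖G x‖ * (m.factorial * Real.exp |L x|) * Real.exp |L x| := by
                gcongr; exact hm x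
            _ = _ := by ring)
      (Filter.Eventually.of_forall fun x => by
        have := NormedSpace.expSeries_div_hasSum_exp ((L x : ℂ) * Complex.I)
        rw [← Complex.exp_eq_exp_ℂ] at this
        have h2 : Complex.exp ((k + 1 : ℕ) * (L x * Complex.I)) =
          Complex.exp (k * (L x * Complex.I)) * Complex.exp (L x * Complex.I) := by
          rw [← Complex.exp_add]; congr 1; push_cast; ring
        have h3 : G x * (L x : ℂ) ^ m * Complex.exp ((k + 1 : ℕ) * (L x * Complex.I)) =
          G x * (L x : ℂ) ^ m * Complex.exp (k * (L x * Complex.I)) *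
            Complex.exp (L x * Complex.I) := by rw [h2]; ring
        rw [h3]
        exact this.mul_left
          (G x * (L x : ℂ) ^ m * Complex.exp (k * (L x * Complex.I))))
    have hz : ∀ n : ℕ, ∫ x, G x * (L x : ℂ) ^ m * Complex.exp (k * (L x * Complex.I)) *
        ((L x * Complex.I) ^ n / n.factorial) ∂μ = 0 := fun n => by
      have := ih (m + n)
      calc _ = ∫ x, (Complex.I ^ n / n.factorial) * (G x * (L x : ℂ) ^ (m + n) *
            Complex.exp (k * (L x * Complex.I))) ∂μ := by
            congr 1; ext x; rw [mul_pow, pow_add]; ring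
        _ = 0 := by rw [integral_const_mul, this, mul_zero]
    simp only [hz] at key
    exact key.unique hasSum_zero

theorem aux_real {d : ℕ} (g : (Fin d → ℂ) → ℝ) (hg : Measurable g) (hi : Integrable g)
    (h : ∀ L : StrongDual ℝ (Fin d → ℂ), ∫ z, (g z : ℂ) * Complex.exp (L z * Complex.I) = 0) :
    ∀ᵐ z, g z = 0 := by
  have := isFiniteMeasure_withDensity_ofReal hi.2
  have := isFiniteMeasure_withDensity_ofReal hi.neg.2
  have hm : (volume : Measure (Fin d → ℂ)).withDensity (fun z => ENNReal.ofReal (g z)) =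
      (volume : Measure (Fin d → ℂ)).withDensity (fun z => ENNReal.ofReal ((-g) z)) := by
    apply Measure.ext_of_charFunDual
    ext L
    rw [charFunDual_apply, charFunDual_apply,
      integral_withDensity_eq_integral_toReal_smul (by fun_prop) (by simp),
      integral_withDensity_eq_integral_toReal_smul (by simp only [Pi.neg_apply]; fun_prop) (by simp),
      ← sub_eq_zero, ← integral_sub, ← h L]
    · congr 1; ext z
      rw [← sub_smul, ENNReal.toReal_ofReal', ENNReal.toReal_ofReal', Pi.neg_apply,
        max_zero_sub_max_neg_zero_eq_self, Complex.real_smul]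
    all_goals
      refine hi.norm.mono' ?_ (Filter.Eventually.of_forall fun z => ?_)
      · apply Measurable.aestronglyMeasurable
        try simp only [Pi.neg_apply]
        fun_prop
      · rw [norm_smul, Complex.norm_exp_ofReal_mul_I, mul_one, ENNReal.toReal_ofReal',
          Real.norm_eq_abs, Real.norm_eq_abs, abs_of_nonneg (le_max_right _ _)]
        first
        | exact max_le (le_abs_self _) (abs_nonneg _)
        | exact max_le (neg_le_abs _) (abs_nonneg _)
  rw [withDensity_eq_iff_of_sigmaFinite (by fun_prop) (by simp only [Pi.neg_apply]; fun_prop)] at hm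
  filter_upwards [hm] with z hz
  have := congrArg ENNReal.toReal hz
  rw [ENNReal.toReal_ofReal', ENNReal.toReal_ofReal'] at this
  rw [← max_zero_sub_max_neg_zero_eq_self (g z), this]
  simp

theorem aux_complex {d : ℕ} (G : (Fin d → ℂ) → ℂ) (hG : Measurable G) (hi : Integrable G)
    (h : ∀ L : StrongDual ℝ (Fin d → ℂ), ∫ z, G z * Complex.exp (L z * Complex.I) = 0) :
    ∀ᵐ z, G z = 0 := by
  have hb : ∀ (H : (Fin d → ℂ) → ℂ), Integrable H → ∀ L : StrongDual ℝ (Fin d → ℂ),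
      Integrable (fun z => H z * Complex.exp (L z * Complex.I)) := fun H hH L => by
    refine hH.mul_bdd (c := 1) (by fun_prop) (Filter.Eventually.of_forall fun z => ?_)
    rw [Complex.norm_exp_ofReal_mul_I]
  have hc : ∀ L : StrongDual ℝ (Fin d → ℂ),
      ∫ z, (starRingEnd ℂ) (G z) * Complex.exp (L z * Complex.I) = 0 := fun L => by
    have := congrArg (starRingEnd ℂ) (h (-L))
    rw [← integral_conj, map_zero] at this
    rw [← this]
    congr 1; ext z
    simp [← Complex.exp_conj]
  have hci : Integrable (fun z => (starRingEnd ℂ) (G z)) :=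
    hi.norm.mono' (Measurable.aestronglyMeasurable (by fun_prop)) (by simp)
  have h1 := aux_real (fun z => (G z).re) (by fun_prop) hi.re fun L => by
    calc _ = ∫ z, (1 / 2 : ℂ) * (G z * Complex.exp (L z * Complex.I) +
          (starRingEnd ℂ) (G z) * Complex.exp (L z * Complex.I)) := by
          congr 1; ext z; rw [← add_mul, Complex.add_conj]; push_cast; ring
      _ = 0 := by
        rw [integral_const_mul, integral_add (hb G hi L) (hb _ hci L), h, hc]; simp
  have h2 := aux_real (fun z => (G z).im) (by fun_prop) hi.im fun L => by
    calc _ = ∫ z, (1 / (2 * Complex.I) : ℂ) * (G z * Complex.exp (L z * Complex.I) -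
          (starRingEnd ℂ) (G z) * Complex.exp (L z * Complex.I)) := by
          congr 1; ext z; rw [← sub_mul, Complex.sub_conj]; field_simp [Complex.I_ne_zero]; push_cast; ring
      _ = 0 := by
        rw [integral_const_mul, integral_sub (hb G hi L) (hb _ hci L), h, hc]; simp
  filter_upwards [h1, h2] with z hz1 hz2
  exact Complex.ext hz1 hz2

/-- Every real functional is `P + conj P` with `P` a linear polynomial. -/
theorem aux_dual {d : ℕ} (L : StrongDual ℝ (Fin d → ℂ)) :
    ∃ (p : MvPolynomial (Fin d) ℂ) (C : ℝ), 0 ≤ C ∧ (∀ z, ‖eval z p‖ ≤ C * ‖z‖) ∧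
      ∀ z, (L z : ℂ) = eval z p + (starRingEnd ℂ) (eval z p) := by
  let c : Fin d → ℂ := fun j =>
    ((L (Pi.single j 1) : ℂ) - L (Pi.single j Complex.I) * Complex.I) / 2
  have hev : ∀ z, eval z (∑ j, MvPolynomial.C (c j) * X j) = ∑ j, c j * z j := fun z => by simp
  refine ⟨∑ j, MvPolynomial.C (c j) * X j, ∑ j, ‖c j‖, by positivity, fun z => ?_, fun z => ?_⟩
  · rw [hev, Finset.sum_mul]
    refine (norm_sum_le _ _).trans (Finset.sum_le_sum fun j _ => ?_)
    rw [norm_mul]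
    gcongr
    exact norm_le_pi_norm z j
  · rw [hev, map_sum, ← Finset.sum_add_distrib]
    have hz : z = ∑ j, ((z j).re • (Pi.single j (1:ℂ) : Fin d → ℂ) + (z j).im • (Pi.single j Complex.I : Fin d → ℂ)) := by
      ext i
      simp [Finset.sum_apply, Pi.single_apply, Finset.sum_add_distrib]
    conv_lhs => rw [hz]
    rw [map_sum, Complex.ofReal_sum]
    refine Finset.sum_congr rfl fun j _ => ?_
    rw [Complex.add_conj]
    congr 1
    simp [c]
    ring

theorem aux_euclNorm {d : ℕ} (z : Fin d → ℂ) : ‖z‖ ≤ euclNorm z := by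
  unfold euclNorm
  rw [pi_norm_le_iff_of_nonneg (Real.sqrt_nonneg _)]
  intro j
  apply Real.le_sqrt_of_sq_le
  exact Finset.single_le_sum (f := fun j => ‖z j‖ ^ 2) (fun _ _ => by positivity)
    (Finset.mem_univ j)

/-- Zero theorem for symbols in the class `D_{1,1}`: if `|F(z)| ≤ b e^{|z|²-κ|z|}` and
`∫ F p q̄ e^{-|z|²} dV = 0` for all analytic polynomials `p, q`, then `F = 0` a.e. -/
theorem D11_symbol_annihilating_polynomials_is_zero
    (d : ℕ) (F : (Fin d → ℂ) → ℂ) (hF : Measurable F)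
    (b κ : ℝ) (hb : 0 < b) (hκ : 0 < κ)
    (hbd : ∀ z : Fin d → ℂ, ‖F z‖ ≤ b * Real.exp (euclNorm z ^ 2 - κ * euclNorm z))
    (h : ∀ p q : MvPolynomial (Fin d) ℂ,
      ∫ z : Fin d → ℂ,
        F z * eval z p * (starRingEnd ℂ) (eval z q) *
          (Real.exp (-euclNorm z ^ 2) : ℂ) ∂volume = 0) :
    ∀ᵐ z : Fin d → ℂ ∂volume, F z = 0 := by
  have hem : Measurable (euclNorm (d := d)) := by unfold euclNorm; fun_prop
  let G : (Fin d → ℂ) → ℂ := fun z => F z * (Real.exp (-euclNorm z ^ 2) : ℂ)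
  have hG : Measurable G := by fun_prop
  have hGb : ∀ z, ‖G z‖ ≤ b * Real.exp (-κ * ‖z‖) := fun z => by
    simp only [G]
    rw [norm_mul, Complex.norm_real, Real.norm_eq_abs, abs_of_pos (Real.exp_pos _)]
    calc _ ≤ b * Real.exp (euclNorm z ^ 2 - κ * euclNorm z) * Real.exp (-euclNorm z ^ 2) := by
          gcongr; exact hbd z
      _ = b * Real.exp (-κ * euclNorm z) := by
          rw [mul_assoc, ← Real.exp_add]; congr 2; ring
      _ ≤ _ := by
          have := aux_euclNorm z
          gcongr b * Real.exp ?_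
          nlinarith
  have hGi : Integrable G := ((aux_int_exp κ hκ).const_mul b).mono' hG.aestronglyMeasurable
    (Filter.Eventually.of_forall hGb)
  suffices hz : ∀ᵐ z, G z = 0 by
    filter_upwards [hz] with z hz
    have : (Real.exp (-euclNorm z ^ 2) : ℂ) ≠ 0 := by
      exact_mod_cast (Real.exp_pos _).ne'
    exact (mul_eq_zero.mp hz).resolve_right this
  -- moments
  have hmom : ∀ (L : StrongDual ℝ (Fin d → ℂ)) (n : ℕ), ∫ z, G z * (L z : ℂ) ^ n = 0 := by
    intro L n
    obtain ⟨p, C, hC, hpC, hL⟩ := aux_dual L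
    have hpm : Measurable (fun z => eval z p) := (MvPolynomial.continuous_eval p).measurable
    calc _ = ∫ z, ∑ k ∈ Finset.range (n + 1), (n.choose k : ℂ) *
          (F z * eval z (p ^ k) * (starRingEnd ℂ) (eval z (p ^ (n - k))) *
          (Real.exp (-euclNorm z ^ 2) : ℂ)) := by
          congr 1; ext z
          rw [hL, add_pow, Finset.mul_sum]
          refine Finset.sum_congr rfl fun k _ => ?_
          simp only [G, map_pow]; ring
      _ = 0 := by
        rw [integral_finsetSum]
        · refine Finset.sum_eq_zero fun k _ => ?_
          rw [integral_const_mul, h, mul_zero]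
        · intro k hk
          have hk' : k + (n - k) = n := by
            have := Finset.mem_range.mp hk; omega
          refine Integrable.const_mul ?_ _
          refine ((aux_int_pow κ hκ n).const_mul (b * C ^ n)).mono' ?_
            (Filter.Eventually.of_forall fun z => ?_)
          · apply Measurable.aestronglyMeasurable
            simp only [map_pow]
            fun_prop
          · calc _ = ‖G z‖ * ‖eval z p‖ ^ n := by
                  conv_rhs => rw [← hk', pow_add]
                  simp only [G, map_pow, norm_mul, norm_pow, RCLike.norm_conj]; ring
              _ ≤ (b * Real.exp (-κ * ‖z‖)) * (C * ‖z‖) ^ n := by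
                  gcongr
                  · exact hGb z
                  · exact hpC z
              _ = _ := by rw [mul_pow]; ring
  refine aux_complex G hG hGi fun L => ?_
  obtain ⟨N, hN⟩ := exists_nat_gt (4 * ‖L‖ / κ)
  have hN0 : (0:ℝ) < N := lt_of_le_of_lt (by positivity) hN
  let L' : StrongDual ℝ (Fin d → ℂ) := (N : ℝ)⁻¹ • L
  have hL' : ∀ z, |L' z| ≤ κ / 4 * ‖z‖ := fun z => by
    have h1 : |L z| ≤ ‖L‖ * ‖z‖ := L.le_opNorm z
    have h2 : ‖L‖ ≤ κ / 4 * N := by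
      rw [div_lt_iff₀ hκ] at hN; linarith
    have h3 : L' z = (N : ℝ)⁻¹ * L z := rfl
    rw [h3, abs_mul, abs_of_pos (by positivity), inv_mul_le_iff₀ hN0]
    have := mul_le_mul_of_nonneg_right h2 (norm_nonneg z)
    linarith
  have hfin := aux_step volume G L' hG (by fun_prop) (by
    refine ((aux_int_exp (κ / 2) (by positivity)).const_mul b).mono' ?_
      (Filter.Eventually.of_forall fun z => ?_)
    · apply Measurable.aestronglyMeasurable
      fun_prop
    · rw [Real.norm_eq_abs, abs_of_nonneg (by positivity)]
      calc _ ≤ b * Real.exp (-κ * ‖z‖) * Real.exp (2 * (κ / 4 * ‖z‖)) := by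
            gcongr
            · exact hGb z
            · exact hL' z
        _ = _ := by rw [mul_assoc, ← Real.exp_add]; congr 2; ring) (hmom L') N 0
  rw [← hfin]
  congr 1; ext z
  have h3 : L' z = (N : ℝ)⁻¹ * L z := rfl
  have hN1 : (N : ℂ) ≠ 0 := by exact_mod_cast hN0.ne'
  rw [h3, pow_zero, mul_one]
  congr 2
  push_cast
  field_simp
end

section
/- Let r be a positive integer and ν a complex Borel measure on ℂ such that e^{γ|z|^r}|ν| is a finite measure for some γ > 0. If the Toeplitz operator T_ν on the Fock space B(ℂ), (T_ν u)(z) = ∫ e^{z w̄} u(w) e^{−|w|²} dν(w)/π, has rank strictly less than r, then ν is a linear combination of fewer than r point masses (Dirac measures). -/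
open MeasureTheory Polynomial

/-- The Toeplitz operator on the Fock space `B(ℂ)` with a complex measure `ν = ρ dμ` as
symbol, acting on an analytic polynomial `p`:
`(T_ν p)(z) = π⁻¹ ∫ e^{z w̄} p(w) e^{-|w|²} dν(w)`. -/
noncomputable def toeplitzMeasure (μ : Measure ℂ) (ρ : ℂ → ℂ) (p : Polynomial ℂ)
    (z : ℂ) : ℂ :=
  (Real.pi : ℂ)⁻¹ *
    ∫ w, Complex.exp (z * (starRingEnd ℂ) w) * p.eval w * (Real.exp (-‖w‖ ^ 2) : ℂ) * ρ w ∂μ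


theorem esymm_eq_of_psum {r : ℕ} (x y : Fin r → ℂ)
    (h : ∀ k : Fin r, ∑ i, x i ^ (k.1 + 1) = ∑ i, y i ^ (k.1 + 1)) (k : ℕ) (hk : k ≤ r) :
    MvPolynomial.aeval x (MvPolynomial.esymm (Fin r) ℂ k)
      = MvPolynomial.aeval y (MvPolynomial.esymm (Fin r) ℂ k) := by
  induction k using Nat.strong_induction_on with
  | _ k ih =>
    rcases Nat.eq_zero_or_pos k with rfl | hpos
    · simp
    have e := MvPolynomial.mul_esymm_eq_sum (Fin r) ℂ k
    have ex := congrArg (MvPolynomial.aeval x) e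
    have ey := congrArg (MvPolynomial.aeval y) e
    have hk0 : (k : ℂ) ≠ 0 := by exact_mod_cast hpos.ne'
    apply mul_left_cancel₀ hk0
    simp only [map_mul, map_natCast, map_pow, map_neg, map_one, map_sum] at ex ey
    rw [ex, ey]
    congr 1
    apply Finset.sum_congr rfl
    rintro ⟨a, b⟩ hab
    rw [Finset.mem_filter] at hab
    have hab1 : a + b = k := Finset.HasAntidiagonal.mem_antidiagonal.1 hab.1
    have hab2 : a < k := hab.2
    rw [ih a hab2 (by omega)]
    congr 1
    have hb : b - 1 < r := by omega
    have := h ⟨b - 1, hb⟩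
    have hb' : b - 1 + 1 = b := by omega
    simp only [hb'] at this
    simp [MvPolynomial.psum, this]

theorem perm_of_psum {r : ℕ} (x y : Fin r → ℂ)
    (h : ∀ k : Fin r, ∑ i, x i ^ (k.1 + 1) = ∑ i, y i ^ (k.1 + 1)) :
    Finset.univ.val.map x = Finset.univ.val.map y := by
  have hp : ((Finset.univ.val.map x).map fun t => X - C t).prod
      = ((Finset.univ.val.map y).map fun t => X - C t).prod := by
    rw [Multiset.prod_X_sub_X_eq_sum_esymm, Multiset.prod_X_sub_X_eq_sum_esymm]
    simp only [Multiset.card_map]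
    apply Finset.sum_congr rfl
    intro j hj
    have hj' : j ≤ r := by
      simp at hj; omega
    have := esymm_eq_of_psum x y h j hj'
    rw [MvPolynomial.aeval_esymm_eq_multiset_esymm, MvPolynomial.aeval_esymm_eq_multiset_esymm] at this
    rw [this]
  have := congrArg Polynomial.roots hp
  rwa [Polynomial.roots_multiset_prod_X_sub_C, Polynomial.roots_multiset_prod_X_sub_C] at this

/-- the symmetric weight -/
noncomputable def symW {r : ℕ} (ρ : ℂ → ℂ) (x : Fin r → ℂ) : ℂ :=
  (Matrix.vandermonde x).det * (starRingEnd ℂ) (Matrix.vandermonde x).det * ∏ i, ρ (x i)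

theorem symW_symm {r : ℕ} (ρ : ℂ → ℂ) (x y : Fin r → ℂ)
    (h : Finset.univ.val.map x = Finset.univ.val.map y) : symW ρ x = symW ρ y := by
  have key : ∀ f : ℂ → ℂ, ∑ i, f (x i) = ∑ i, f (y i) := by
    intro f
    have := congrArg (fun s => (s.map f).sum) h
    simp only [Multiset.map_map] at this
    exact this
  have hp : ∏ i, ρ (x i) = ∏ i, ρ (y i) := by
    have := congrArg (fun s => (s.map ρ).prod) h
    simp only [Multiset.map_map] at this
    exact this
  have hV : ∀ z : Fin r → ℂ, (Matrix.vandermonde z).det * (starRingEnd ℂ) (Matrix.vandermonde z).det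
      = (Matrix.of fun a b : Fin r => ∑ i, (starRingEnd ℂ) (z i) ^ a.1 * z i ^ b.1).det := by
    intro z
    have h1 : (starRingEnd ℂ) (Matrix.vandermonde z).det = (Matrix.vandermonde z).conjTranspose.det := by
      rw [Matrix.det_conjTranspose]; rfl
    rw [h1, mul_comm, ← Matrix.det_mul]
    congr 1
    ext a b
    simp [Matrix.mul_apply, Matrix.vandermonde_apply]
  unfold symW
  rw [hp, hV, hV]
  congr 3
  ext a b
  exact key fun z => (starRingEnd ℂ) z ^ a.1 * z ^ b.1

theorem fourier_nonpos {X E : Type*} [TopologicalSpace X] [PolishSpace X] [MeasurableSpace X]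
    [BorelSpace X] [NormedAddCommGroup E] [NormedSpace ℝ E] [CompleteSpace E]
    [SecondCountableTopology E] [MeasurableSpace E] [BorelSpace E]
    (κ : Measure X) (P : X → E) (hP : Measurable P) (h : X → ℝ) (hm : Measurable h)
    (hi : Integrable h κ) (hfac : ∀ x y, P x = P y → h x = h y)
    (hF : ∀ L : StrongDual ℝ E, ∫ x, (h x : ℂ) * Complex.exp (L (P x) * Complex.I) ∂κ = 0) :
    ∀ᵐ x ∂κ, h x ≤ 0 := by
  classical
  set κ₁ := κ.withDensity fun x => ((h x).toNNReal : ENNReal) with hκ₁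
  set κ₂ := κ.withDensity fun x => ((-h x).toNNReal : ENNReal) with hκ₂
  have f1 : IsFiniteMeasure κ₁ := by
    apply isFiniteMeasure_withDensity_ofReal hi.2
  have f2 : IsFiniteMeasure κ₂ := by
    apply isFiniteMeasure_withDensity_ofReal hi.neg.2
  have hm1 : Measurable fun x => (h x).toNNReal := hm.real_toNNReal
  have hm2 : Measurable fun x => (-h x).toNNReal := hm.neg.real_toNNReal
  have hce : ∀ L : StrongDual ℝ E, Measurable fun x => Complex.exp (L (P x) * Complex.I) := by
    intro L
    have : Measurable fun x => L (P x) := L.continuous.measurable.comp hP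
    fun_prop
  have hint : ∀ L : StrongDual ℝ E, ∀ g : X → ℝ, Integrable g κ →
      Integrable (fun x => (g x : ℂ) * Complex.exp (L (P x) * Complex.I)) κ := by
    intro L g hg
    refine hg.ofReal.mul_bdd (c := 1) (hce L).aestronglyMeasurable ?_
    filter_upwards with x
    rw [Complex.norm_exp_ofReal_mul_I]
  have heq : κ₁.map P = κ₂.map P := by
    apply Measure.ext_of_charFunDual
    ext L
    have hcE : AEStronglyMeasurable (fun v : E => Complex.exp (L v * Complex.I)) (κ₁.map P) := by
      apply Continuous.aestronglyMeasurable; fun_prop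
    have hcE2 : AEStronglyMeasurable (fun v : E => Complex.exp (L v * Complex.I)) (κ₂.map P) := by
      apply Continuous.aestronglyMeasurable; fun_prop
    rw [charFunDual_apply, charFunDual_apply, integral_map hP.aemeasurable hcE,
      integral_map hP.aemeasurable hcE2, hκ₁, hκ₂,
      integral_withDensity_eq_integral_smul hm1, integral_withDensity_eq_integral_smul hm2,
      ← sub_eq_zero]
    have c1 : ∀ (g : X → ℝ) , (fun x => (g x).toNNReal • Complex.exp (L (P x) * Complex.I)) =
        fun x => ((max (g x) 0 : ℝ) : ℂ) * Complex.exp (L (P x) * Complex.I) := by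
      intro g; ext x
      rw [NNReal.smul_def, Real.coe_toNNReal']
      simp
    rw [c1, c1 (fun x => - h x), ← integral_sub (hint L _ hi.pos_part) (hint L _ hi.neg_part), ← hF L]
    congr 1
    ext x
    rw [← sub_mul, ← Complex.ofReal_sub]
    congr 2
    rcases le_total (h x) 0 with h0 | h0
    · rw [max_eq_right h0, max_eq_left (by linarith)]; ring
    · rw [max_eq_left h0, max_eq_right (by linarith)]; ring
  set S := {x | 0 < h x} with hS
  have hSm : MeasurableSet S := measurableSet_lt measurable_const hm
  have hd : Disjoint (P '' S) (P '' Sᶜ) := by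
    rw [Set.disjoint_left]
    rintro _ ⟨x, hx, rfl⟩ ⟨y, hy, hxy⟩
    exact hy (by rw [hS, Set.mem_ofPred_eq, hfac y x hxy]; exact hx)
  obtain ⟨B, hB1, hB2, hB3⟩ := AnalyticSet.measurablySeparable
    (hSm.analyticSet_image hP) (hSm.compl.analyticSet_image hP) hd
  have hpre : P ⁻¹' B = S := by
    ext x
    constructor
    · intro hx
      by_contra hxS
      exact Set.disjoint_left.1 hB2 ⟨x, hxS, rfl⟩ hx
    · intro hx
      exact hB1 ⟨x, hx, rfl⟩
  have h2 : κ₂ S = 0 := by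
    rw [hκ₂, withDensity_apply _ hSm]
    rw [setLIntegral_eq_zero_iff hSm (by fun_prop)]
    filter_upwards with x hx
    have : 0 < h x := hx
    simp [Real.toNNReal_eq_zero, this.le]
  have h1 : κ₁ S = 0 := by
    rw [← hpre, ← Measure.map_apply hP hB3, heq, Measure.map_apply hP hB3, hpre, h2]
  rw [hκ₁, withDensity_apply _ hSm, setLIntegral_eq_zero_iff hSm (by fun_prop)] at h1
  filter_upwards [h1] with x hx
  by_contra hc
  push Not at hc
  have := hx hc
  simp at this
  linarith

theorem fourier_ae_zero {X E : Type*} [TopologicalSpace X] [PolishSpace X] [MeasurableSpace X]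
    [BorelSpace X] [NormedAddCommGroup E] [NormedSpace ℝ E] [CompleteSpace E]
    [SecondCountableTopology E] [MeasurableSpace E] [BorelSpace E]
    (κ : Measure X) (P : X → E) (hP : Measurable P) (h : X → ℂ) (hm : Measurable h)
    (hi : Integrable h κ) (hfac : ∀ x y, P x = P y → h x = h y)
    (hF : ∀ L : StrongDual ℝ E, ∫ x, h x * Complex.exp (L (P x) * Complex.I) ∂κ = 0) :
    ∀ᵐ x ∂κ, h x = 0 := by
  have hce : ∀ L : StrongDual ℝ E, Measurable fun x => Complex.exp (L (P x) * Complex.I) := by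
    intro L
    have : Measurable fun x => L (P x) := L.continuous.measurable.comp hP
    fun_prop
  have key : ∀ c : ℂ, ∀ᵐ x ∂κ, (c * h x).re ≤ 0 := by
    intro c
    apply fourier_nonpos κ P hP (fun x => (c * h x).re) (by fun_prop) (hi.const_mul c).re
    · intro x y hxy; rw [hfac x y hxy]
    · intro L
      have hint : ∀ L : StrongDual ℝ E, ∀ g : X → ℂ, Integrable g κ →
          Integrable (fun x => g x * Complex.exp (L (P x) * Complex.I)) κ := by
        intro L g hg
        refine hg.mul_bdd (c := 1) (hce L).aestronglyMeasurable ?_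
        filter_upwards with x
        rw [Complex.norm_exp_ofReal_mul_I]
      have e1 : ∫ x, c * h x * Complex.exp (L (P x) * Complex.I) ∂κ = 0 := by
        simp_rw [mul_assoc]
        rw [integral_const_mul, hF L, mul_zero]
      have e2 : ∫ x, (starRingEnd ℂ) (c * h x) * Complex.exp (L (P x) * Complex.I) ∂κ = 0 := by
        have : ∀ x, (starRingEnd ℂ) (c * h x) * Complex.exp (L (P x) * Complex.I)
            = (starRingEnd ℂ) (c * (h x * Complex.exp ((-L) (P x) * Complex.I))) := by
          intro x
          simp only [map_mul, ← Complex.exp_conj, Complex.conj_ofReal, Complex.conj_I]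
          simp [mul_assoc]
        simp_rw [this]
        rw [integral_conj, integral_const_mul, hF (-L)]
        simp
      have e3 : ∀ x, (((c * h x).re : ℝ) : ℂ) * Complex.exp (L (P x) * Complex.I)
          = (1/2 : ℂ) * (c * h x * Complex.exp (L (P x) * Complex.I)
            + (starRingEnd ℂ) (c * h x) * Complex.exp (L (P x) * Complex.I)) := by
        intro x
        rw [← add_mul, Complex.add_conj]
        push_cast; ring
      simp_rw [e3]
      rw [integral_const_mul, integral_add (hint L _ (hi.const_mul c)), e1, e2]
      · simp
      · have := hint (-L) _ (hi.const_mul c)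
        have i2 : Integrable (fun x => (starRingEnd ℂ) (c * h x)) κ :=
          (hi.const_mul c).mono (by
            have : Measurable fun x => (starRingEnd ℂ) (c * h x) :=
              Complex.continuous_conj.measurable.comp (by fun_prop)
            exact this.aestronglyMeasurable) (by simp)
        exact hint L _ i2
  filter_upwards [key 1, key (-1), key Complex.I, key (-Complex.I)] with x h1 h2 h3 h4
  simp at h1 h2 h3 h4
  apply Complex.ext
  · simp; linarith
  · simp; linarith

theorem support_small {r : ℕ} (lam : Measure ℂ) [IsFiniteMeasure lam]
    (h : ∀ᵐ x ∂(Measure.pi fun _ : Fin r => lam), (Matrix.vandermonde x).det = 0) :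
    ∃ S : Finset ℂ, S.card < r ∧ lam (S : Set ℂ)ᶜ = 0 := by
  classical
  by_cases hc : ∃ T : Finset ℂ, T.card = r ∧ (T : Set ℂ) ⊆ lam.support
  · exfalso
    obtain ⟨T, hT, hTs⟩ := hc
    let e : Fin r ≃ T := (T.equivFinOfCardEq hT).symm
    let z : Fin r → ℂ := fun i => e i
    have hz : Function.Injective z := Subtype.val_injective.comp e.injective
    obtain ⟨U, hU, hUd⟩ := (Set.toFinite (Set.range z)).t2_separation
    have hpos : 0 < (Measure.pi fun _ : Fin r => lam) (Set.univ.pi fun i => U (z i)) := by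
      rw [Measure.pi_pi]
      rw [pos_iff_ne_zero, Finset.prod_ne_zero_iff]
      intro i _
      exact ((Measure.mem_support_iff_forall _).1 (hTs (e i).2) _
        ((hU (z i)).2.mem_nhds (hU (z i)).1)).ne'
    have hz0 : (Measure.pi fun _ : Fin r => lam) (Set.univ.pi fun i => U (z i)) = 0 := by
      refine measure_mono_null ?_ h
      intro x hx hx0
      replace hx0 : (Matrix.vandermonde x).det = 0 := hx0
      rw [Matrix.det_vandermonde_eq_zero_iff] at hx0
      obtain ⟨i, j, hij, hne⟩ := hx0
      have hd := hUd (Set.mem_range_self i) (Set.mem_range_self j) (fun hh => hne (hz hh))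
      have h1 := hx i (Set.mem_univ i)
      have h2 := hx j (Set.mem_univ j)
      rw [hij] at h1
      exact Set.disjoint_left.1 hd h1 h2
    exact hpos.ne' hz0
  · push Not at hc
    have hfin : lam.support.Finite := by
      by_contra hinf
      obtain ⟨T, hT1, hT2⟩ := (show lam.support.Infinite from hinf).exists_subset_card_eq r
      exact hc T hT2 hT1
    refine ⟨hfin.toFinset, ?_, ?_⟩
    · by_contra hge
      push Not at hge
      obtain ⟨T, hT1, hT2⟩ := Finset.exists_subset_card_eq hge
      exact hc T hT2 (by intro x hx; simpa using hT1 hx)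
    · rw [Set.Finite.coe_toFinset]
      exact Measure.measure_compl_support

/-- growth condition -/
def Gr {F : Type*} [Norm F] (r : ℕ) (ε : ℝ) (f : ℂ → F) : Prop :=
  ∃ C : ℝ, ∀ w, ‖f w‖ ≤ C * Real.exp (ε * ‖w‖ ^ r)

theorem Gr.bound_nonneg {F : Type*} [NormedAddCommGroup F] {r : ℕ} {ε C : ℝ} {f : ℂ → F}
    (h : ∀ w, ‖f w‖ ≤ C * Real.exp (ε * ‖w‖ ^ r)) : 0 ≤ C := by
  have := (norm_nonneg _).trans (h 0)
  exact nonneg_of_mul_nonneg_left this (Real.exp_pos _)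

theorem Gr.mono {F : Type*} [NormedAddCommGroup F] {r : ℕ} {ε ε' : ℝ} {f : ℂ → F}
    (h : Gr r ε f) (he : ε ≤ ε') : Gr r ε' f := by
  obtain ⟨C, hC⟩ := h
  have := Gr.bound_nonneg hC
  refine ⟨C, fun w => (hC w).trans ?_⟩
  gcongr

theorem Gr.mul {F : Type*} [NormedRing F] {r : ℕ} {ε ε' : ℝ} {f g : ℂ → F}
    (h : Gr r ε f) (h' : Gr r ε' g) : Gr r (ε + ε') fun w => f w * g w := by
  obtain ⟨C, hC⟩ := h
  obtain ⟨C', hC'⟩ := h'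
  have := Gr.bound_nonneg hC
  have := Gr.bound_nonneg hC'
  refine ⟨C * C', fun w => (norm_mul_le _ _).trans ?_⟩
  calc ‖f w‖ * ‖g w‖ ≤ (C * Real.exp (ε * ‖w‖ ^ r)) * (C' * Real.exp (ε' * ‖w‖ ^ r)) := by
        gcongr
        · exact hC w
        · exact hC' w
    _ = _ := by rw [add_mul, Real.exp_add]; ring

theorem Gr.add {F : Type*} [NormedAddCommGroup F] {r : ℕ} {ε : ℝ} {f g : ℂ → F}
    (h : Gr r ε f) (h' : Gr r ε g) : Gr r ε fun w => f w + g w := by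
  obtain ⟨C, hC⟩ := h
  obtain ⟨C', hC'⟩ := h'
  refine ⟨C + C', fun w => (norm_add_le _ _).trans ?_⟩
  rw [add_mul]
  exact add_le_add (hC w) (hC' w)

theorem Gr.of_norm_le {F G : Type*} [NormedAddCommGroup F] [NormedAddCommGroup G]
    {r : ℕ} {ε : ℝ} {f : ℂ → F} {g : ℂ → G}
    (h : Gr r ε f) (hg : ∀ w, ‖g w‖ ≤ ‖f w‖) : Gr r ε g := by
  obtain ⟨C, hC⟩ := h
  exact ⟨C, fun w => (hg w).trans (hC w)⟩

theorem Gr.integrable {F : Type*} [NormedAddCommGroup F] {r : ℕ} {ε γ : ℝ} {f : ℂ → F}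
    {lam : Measure ℂ} (h : Gr r ε f) (he : ε ≤ γ)
    (hI : Integrable (fun w : ℂ => Real.exp (γ * ‖w‖ ^ r)) lam)
    (hf : AEStronglyMeasurable f lam) : Integrable f lam := by
  obtain ⟨C, hC⟩ := h.mono he
  exact (hI.const_mul C).mono' hf (Filter.Eventually.of_forall hC)

theorem Gr.exp_norm {r : ℕ} {A δ : ℝ} (hδ : 0 ≤ δ) {f : ℂ → ℂ}
    (h : ∀ w, ‖f w‖ ≤ A * (1 + ‖w‖ ^ r)) : Gr r (δ * A) fun w => Real.exp (δ * ‖f w‖) := by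
  refine ⟨Real.exp (δ * A), fun w => ?_⟩
  rw [Real.norm_eq_abs, Real.abs_exp, ← Real.exp_add]
  apply Real.exp_le_exp.2
  nlinarith [mul_le_mul_of_nonneg_left (h w) hδ]

theorem le_one_add_pow {r : ℕ} (x : ℝ) (hx : 0 ≤ x) {k : ℕ} (hk : k ≤ r) : x ^ k ≤ 1 + x ^ r := by
  rcases le_total x 1 with h | h
  · have := pow_le_one₀ (n := k) hx h
    have := pow_nonneg hx r
    linarith
  · have := pow_le_pow_right₀ h hk
    linarith

theorem Gr.pow {r : ℕ} (hr : 0 < r) {ε : ℝ} (hε : 0 < ε) (k : ℕ) : Gr r ε fun w : ℂ => w ^ k := by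
  refine ⟨k.factorial / ε ^ k * Real.exp ε, fun w => ?_⟩
  have h1 := Real.pow_div_factorial_le_exp (x := ε * ‖w‖) (by positivity) k
  have h2 : Real.exp (ε * ‖w‖) ≤ Real.exp ε * Real.exp (ε * ‖w‖ ^ r) := by
    rw [← Real.exp_add]
    apply Real.exp_le_exp.2
    have := le_one_add_pow ‖w‖ (norm_nonneg w) (k := 1) (r := r) hr
    nlinarith
  have h3 := h1.trans h2
  rw [div_le_iff₀ (by positivity), mul_pow] at h3
  rw [norm_pow]
  calc ‖w‖ ^ k = (ε ^ k * ‖w‖ ^ k) / ε ^ k := by field_simp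
    _ ≤ (Real.exp ε * Real.exp (ε * ‖w‖ ^ r) * k.factorial) / ε ^ k := by gcongr
    _ = _ := by ring

theorem Gr.poly {r : ℕ} (hr : 0 < r) {ε : ℝ} (hε : 0 < ε) (p : Polynomial ℂ) :
    Gr r ε fun w : ℂ => p.eval w := by
  induction p using Polynomial.induction_on' with
  | add p q hp hq => simpa using hp.add hq
  | monomial n a =>
    have h1 : Gr r 0 fun _ : ℂ => a := ⟨‖a‖, fun w => by simp⟩
    simpa using h1.mul (Gr.pow hr hε n)

theorem deriv_int {lam : Measure ℂ} {K X : ℂ → ℂ} {B : ℂ → ℝ} {U : Set ℂ} (hU : IsOpen U)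
    (hK : Measurable K) (hX : Measurable X)
    (hb : ∀ s ∈ U, ∀ w, ‖Complex.exp (s * X w)‖ ≤ B w)
    (h1 : Integrable (fun w => ‖K w‖ * B w) lam)
    (h2 : Integrable (fun w => ‖K w * X w‖ * B w) lam) {s : ℂ} (hs : s ∈ U) :
    HasDerivAt (fun s => ∫ w, K w * Complex.exp (s * X w) ∂lam)
      (∫ w, K w * X w * Complex.exp (s * X w) ∂lam) s := by
  refine (hasDerivAt_integral_of_dominated_loc_of_deriv_le (hU.mem_nhds hs)
    (F := fun s w => K w * Complex.exp (s * X w))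
    (F' := fun s w => K w * X w * Complex.exp (s * X w))
    (bound := fun w => ‖K w * X w‖ * B w) ?_ ?_ ?_ ?_ h2 ?_).2
  · exact Filter.Eventually.of_forall fun s => Measurable.aestronglyMeasurable (by fun_prop)
  · refine h1.mono' (Measurable.aestronglyMeasurable (by fun_prop)) ?_
    filter_upwards with w
    rw [norm_mul]
    exact mul_le_mul_of_nonneg_left (hb s hs w) (norm_nonneg _)
  · exact Measurable.aestronglyMeasurable (by fun_prop)
  · filter_upwards with w s hs
    rw [norm_mul]
    exact mul_le_mul_of_nonneg_left (hb s hs w) (norm_nonneg _)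
  · filter_upwards with w s hs
    have := ((hasDerivAt_mul_const (X w) (x := s)).cexp).const_mul (K w)
    exact this.congr_deriv (by ring)

theorem conj_measurable : Measurable (fun w : ℂ => (starRingEnd ℂ) w) :=
  Complex.continuous_conj.measurable

theorem moments_zero {r : ℕ} (hr : 0 < r) {γ : ℝ} (hγ : 0 < γ) {lam : Measure ℂ}
    (hI : Integrable (fun w : ℂ => Real.exp (γ * ‖w‖ ^ r)) lam) {K : ℂ → ℂ} (hK : Measurable K)
    (hG : Gr r (γ / 4) K)
    (h : ∀ z, ∫ w, K w * Complex.exp (z * (starRingEnd ℂ) w) ∂lam = 0) (n : ℕ) :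
    ∫ w, K w * (starRingEnd ℂ) w ^ n ∂lam = 0 := by
  have hc := conj_measurable
  have key : ∀ n : ℕ, ∀ z ∈ Metric.ball (0 : ℂ) (γ / 4),
      ∫ w, (K w * (starRingEnd ℂ) w ^ n) * Complex.exp (z * (starRingEnd ℂ) w) ∂lam = 0 := by
    intro n
    induction n with
    | zero => intro z _; simpa using h z
    | succ n ih =>
      intro z hz
      have hB : Gr r (γ / 4) fun w : ℂ => Real.exp (γ / 4 * ‖w‖) := by
        have := Gr.exp_norm (r := r) (A := 1) (δ := γ / 4) (by positivity) (f := fun w => w)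
          (fun w => by
            simpa using le_one_add_pow ‖w‖ (norm_nonneg w) (k := 1) (r := r) hr)
        simpa using this
      have hKn : ∀ n : ℕ, Integrable (fun w => ‖K w * (starRingEnd ℂ) w ^ n‖ * Real.exp (γ / 4 * ‖w‖)) lam := by
        intro n
        have g := ((hG.mul (Gr.pow hr (ε := γ / 4) (by positivity) n)).of_norm_le
          (g := fun w => ‖K w * (starRingEnd ℂ) w ^ n‖) (by intro w; simp)).mul hB
        apply g.integrable (by linarith) hI
        exact Measurable.aestronglyMeasurable (by fun_prop)
      have hd := deriv_int (lam := lam) (K := fun w => K w * (starRingEnd ℂ) w ^ n)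
        (X := fun w => (starRingEnd ℂ) w) (B := fun w => Real.exp (γ / 4 * ‖w‖))
        (U := Metric.ball (0 : ℂ) (γ / 4)) Metric.isOpen_ball (by fun_prop) hc ?_ (hKn n) ?_ hz
      · have h0 : HasDerivAt (fun s => ∫ w, (K w * (starRingEnd ℂ) w ^ n) *
            Complex.exp (s * (starRingEnd ℂ) w) ∂lam) 0 z := by
          refine (hasDerivAt_const z (0 : ℂ)).congr_of_eventuallyEq ?_
          filter_upwards [Metric.isOpen_ball.mem_nhds hz] with s hs
          exact ih s hs
        have := hd.unique h0
        simpa [pow_succ, mul_assoc] using this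
      · intro s hs w
        rw [Complex.norm_exp]
        apply Real.exp_le_exp.2
        have hs' : ‖s‖ < γ / 4 := by simpa using hs
        calc _ ≤ ‖s * (starRingEnd ℂ) w‖ := Complex.re_le_norm _
          _ = ‖s‖ * ‖w‖ := by simp
          _ ≤ _ := by gcongr
      · have := hKn (n + 1)
        simpa [pow_succ, mul_assoc] using this
  simpa using key n 0 (by simp; positivity)

theorem det_zero_poly {r : ℕ} (hr : 0 < r) {γ : ℝ} (hγ : 0 < γ) {lam : Measure ℂ}
    (hI : Integrable (fun w : ℂ => Real.exp (γ * ‖w‖ ^ r)) lam) {u : ℂ → ℂ} (hu : Measurable u)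
    (hu1 : ∀ w, ‖u w‖ ≤ 1)
    (hker : ∀ p : Fin r → Polynomial ℂ, ∃ α : Fin r → ℂ, α ≠ 0 ∧
      ∀ z, ∫ w, ((∑ a, α a * (p a).eval w) * u w) * Complex.exp (z * (starRingEnd ℂ) w) ∂lam = 0)
    (p q : Fin r → Polynomial ℂ) :
    (Matrix.of fun a b => ∫ w, (p a).eval w * (starRingEnd ℂ) ((q b).eval w) * u w ∂lam).det = 0 := by
  have hc := conj_measurable
  obtain ⟨α, hα, hz⟩ := hker p
  have hgu : Gr r 0 u := ⟨1, fun w => by simpa using hu1 w⟩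
  have hpm : ∀ p : Polynomial ℂ, Measurable fun w : ℂ => p.eval w :=
    fun p => p.continuous.measurable
  have hsum : ∀ w, ∑ a, α a * (p a).eval w = (∑ a, C (α a) * p a).eval w := by
    intro w; simp [Polynomial.eval_finsetSum]
  have hG : ∀ p : Polynomial ℂ, Gr r (γ / 4) fun w => p.eval w * u w := by
    intro p
    simpa using (Gr.poly hr (ε := γ / 4) (by positivity) p).mul hgu
  have hm := moments_zero hr hγ hI (K := fun w => (∑ a, C (α a) * p a).eval w * u w)
    (by have := hpm (∑ a, C (α a) * p a); fun_prop) (hG _) (by simpa only [hsum] using hz)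
  have hint : ∀ (p q : Polynomial ℂ), Integrable
      (fun w => p.eval w * (starRingEnd ℂ) (q.eval w) * u w) lam := by
    intro p q
    have g := (hG p).mul (Gr.poly hr (ε := γ / 4) (by positivity) q)
    have g2 := g.of_norm_le (g := fun w => p.eval w * (starRingEnd ℂ) (q.eval w) * u w) (by
      intro w; simp only [norm_mul, RCLike.norm_conj]; apply le_of_eq; ring)
    apply g2.integrable (by linarith) hI
    have := hpm p
    have := hc.comp (hpm q)
    exact Measurable.aestronglyMeasurable (by simp only [Function.comp_def] at this; fun_prop)
  have hq : ∀ q : Polynomial ℂ, ∫ w, (∑ a, C (α a) * p a).eval w * (starRingEnd ℂ) (q.eval w) * u w ∂lam = 0 := by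
    intro q
    induction q using Polynomial.induction_on' with
    | add q1 q2 h1 h2 =>
      have := integral_add (hint (∑ a, C (α a) * p a) q1) (hint (∑ a, C (α a) * p a) q2)
      rw [h1, h2, add_zero] at this
      rw [← this]
      congr 1; ext w; simp only [eval_add, map_add]; ring
    | monomial n a =>
      have := hm n
      have e : ∀ w, (∑ a, C (α a) * p a).eval w * (starRingEnd ℂ) ((monomial n a).eval w) * u w
          = (starRingEnd ℂ) a * ((∑ a, C (α a) * p a).eval w * u w * (starRingEnd ℂ) w ^ n) := by
        intro w
        simp only [eval_monomial, map_mul, map_pow]; ring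
      simp_rw [e]
      rw [integral_const_mul, this, mul_zero]
  rw [← Matrix.exists_vecMul_eq_zero_iff]
  refine ⟨α, hα, ?_⟩
  ext b
  simp only [Matrix.vecMul, dotProduct, Matrix.of_apply, Pi.zero_apply]
  rw [← hq (q b)]
  simp_rw [← integral_const_mul]
  rw [← integral_finsetSum _ (fun a _ => (hint _ _).const_mul _)]
  congr 1
  ext w
  rw [← hsum, Finset.sum_mul, Finset.sum_mul]
  apply Finset.sum_congr rfl
  intro a _; ring


theorem partial_exp_bound (x : ℂ) (N : ℕ) :
    ‖∑ n ∈ Finset.range N, x ^ n / (n.factorial : ℂ)‖ ≤ Real.exp ‖x‖ := by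
  refine (norm_sum_le _ _).trans ?_
  refine le_trans (le_of_eq ?_) (Real.sum_le_exp_of_nonneg (norm_nonneg x) N)
  apply Finset.sum_congr rfl
  intro n _
  simp

theorem partial_exp_tendsto (x : ℂ) :
    Filter.Tendsto (fun N => ∑ n ∈ Finset.range N, x ^ n / (n.factorial : ℂ)) Filter.atTop
      (nhds (Complex.exp x)) := by
  have := (NormedSpace.expSeries_div_hasSum_exp x).tendsto_sum_nat
  rwa [← Complex.exp_eq_exp_ℂ] at this

theorem det_zero_small {r : ℕ} (hr : 0 < r) {γ : ℝ} (hγ : 0 < γ) {lam : Measure ℂ}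
    (hI : Integrable (fun w : ℂ => Real.exp (γ * ‖w‖ ^ r)) lam) {u : ℂ → ℂ} (hu : Measurable u)
    (hu1 : ∀ w, ‖u w‖ ≤ 1)
    (hdet : ∀ p q : Fin r → Polynomial ℂ,
      (Matrix.of fun a b => ∫ w, (p a).eval w * (starRingEnd ℂ) ((q b).eval w) * u w ∂lam).det = 0)
    (ζ : Polynomial ℂ) {δ : ℝ} (hδ : 0 ≤ δ)
    (hB : ∀ k : ℕ, Integrable (fun w : ℂ => ‖w ^ k‖ * Real.exp (δ * ‖ζ.eval w‖)) lam)
    (s : ℂ) (hs : ‖s‖ ≤ δ) :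
    (Matrix.of fun a b : Fin r => ∫ w, (w ^ a.1 * (starRingEnd ℂ) w ^ b.1 * u w) *
      Complex.exp (s * (((ζ.eval w).re : ℂ) * Complex.I)) ∂lam).det = 0 := by
  have hc := conj_measurable
  have hpm : ∀ p : Polynomial ℂ, Measurable fun w : ℂ => p.eval w :=
    fun p => p.continuous.measurable
  have hpc : ∀ p : Polynomial ℂ, Measurable fun w : ℂ => (starRingEnd ℂ) (p.eval w) :=
    fun p => hc.comp (hpm p)
  let E : ℂ → ℕ → Polynomial ℂ := fun t N =>
    ∑ n ∈ Finset.range N, C (t ^ n / (n.factorial : ℂ)) * ζ ^ n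
  have hE : ∀ t N w, (E t N).eval w = ∑ n ∈ Finset.range N, (t * ζ.eval w) ^ n / (n.factorial : ℂ) := by
    intro t N w
    simp only [E, Polynomial.eval_finsetSum, eval_mul, eval_C, eval_pow]
    apply Finset.sum_congr rfl
    intro n _
    rw [mul_pow]; ring
  let t : ℂ := s * Complex.I / 2
  let t' : ℂ := (starRingEnd ℂ) t
  have ht : ‖t‖ = ‖s‖ / 2 := by simp [t]
  have ht' : ‖t'‖ = ‖s‖ / 2 := by simp [t', ht]
  have hM : ∀ N, (Matrix.of fun a b : Fin r => ∫ w, (X ^ a.1 * E t N).eval w *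
      (starRingEnd ℂ) ((X ^ b.1 * E t' N).eval w) * u w ∂lam).det = 0 :=
    fun N => hdet (fun a => X ^ a.1 * E t N) (fun b => X ^ b.1 * E t' N)
  refine tendsto_nhds_unique (f := fun N : ℕ => (Matrix.of fun a b : Fin r => ∫ w, (X ^ a.1 * E t N).eval w *
      (starRingEnd ℂ) ((X ^ b.1 * E t' N).eval w) * u w ∂lam).det) (l := Filter.atTop) ?_
      (by simp only [hM]; exact tendsto_const_nhds)
  have hcd : Continuous fun M : Matrix (Fin r) (Fin r) ℂ => M.det := by fun_prop
  refine (hcd.tendsto _).comp ?_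
  refine tendsto_pi_nhds.2 fun a => tendsto_pi_nhds.2 fun b => ?_
  simp only [Matrix.of_apply]
  refine tendsto_integral_of_dominated_convergence
    (fun w : ℂ => ‖w ^ (a.1 + b.1)‖ * Real.exp (δ * ‖ζ.eval w‖)) ?_ (hB _) ?_ ?_
  · intro N
    have h1 := hpm (X ^ a.1 * E t N)
    have h2 := hpc (X ^ b.1 * E t' N)
    exact Measurable.aestronglyMeasurable (by fun_prop)
  · intro N
    filter_upwards with w
    have b1 := partial_exp_bound (t * ζ.eval w) N
    have b2 := partial_exp_bound (t' * ζ.eval w) N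
    rw [← hE, norm_mul, ht] at b1
    rw [← hE, norm_mul, ht'] at b2
    simp only [eval_mul, eval_pow, eval_X, norm_mul, RCLike.norm_conj, map_mul]
    rw [pow_add, norm_mul]
    calc _ ≤ ‖w ^ a.1‖ * Real.exp (‖s‖ / 2 * ‖ζ.eval w‖) * (‖w ^ b.1‖ * Real.exp (‖s‖ / 2 * ‖ζ.eval w‖)) * 1 := by
          gcongr
          exact hu1 w
      _ = ‖w ^ a.1‖ * ‖w ^ b.1‖ * Real.exp (‖s‖ * ‖ζ.eval w‖) := by
          have : Real.exp (‖s‖ * ‖ζ.eval w‖) = Real.exp (‖s‖ / 2 * ‖ζ.eval w‖) * Real.exp (‖s‖ / 2 * ‖ζ.eval w‖) := by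
            rw [← Real.exp_add]; congr 1; ring
          rw [this]; ring
      _ ≤ _ := by gcongr
  · filter_upwards with w
    have l1 := partial_exp_tendsto (t * ζ.eval w)
    have l2 := (Complex.continuous_conj.tendsto _).comp (partial_exp_tendsto (t' * ζ.eval w))
    simp only [Function.comp_def, ← hE] at l1 l2
    have := ((l1.mul l2).const_mul (w ^ a.1 * (starRingEnd ℂ) w ^ b.1)).mul_const (u w)
    have e : Complex.exp (s * (((ζ.eval w).re : ℂ) * Complex.I)) =
        Complex.exp (t * ζ.eval w) * (starRingEnd ℂ) (Complex.exp (t' * ζ.eval w)) := by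
      rw [← Complex.exp_conj, ← Complex.exp_add]
      congr 1
      simp only [map_mul, t', Complex.conj_conj]
      rw [← mul_add, Complex.add_conj]
      simp only [t]; push_cast; ring
    rw [e]
    convert this using 1
    · ext N
      simp only [eval_mul, eval_pow, eval_X, map_mul, map_pow]; ring
    · congr 1
      ring

theorem det_zero_all {r : ℕ} (hr : 0 < r) {γ : ℝ} (hγ : 0 < γ) {lam : Measure ℂ}
    (hI : Integrable (fun w : ℂ => Real.exp (γ * ‖w‖ ^ r)) lam) {u : ℂ → ℂ} (hu : Measurable u)
    (hu1 : ∀ w, ‖u w‖ ≤ 1)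
    (hdet : ∀ p q : Fin r → Polynomial ℂ,
      (Matrix.of fun a b => ∫ w, (p a).eval w * (starRingEnd ℂ) ((q b).eval w) * u w ∂lam).det = 0)
    (ζ : Polynomial ℂ) {A : ℝ} (hA : ∀ w : ℂ, ‖ζ.eval w‖ ≤ A * (1 + ‖w‖ ^ r)) :
    (Matrix.of fun a b : Fin r => ∫ w, (w ^ a.1 * (starRingEnd ℂ) w ^ b.1 * u w) *
      Complex.exp (((ζ.eval w).re : ℂ) * Complex.I) ∂lam).det = 0 := by
  have hc := conj_measurable
  have hpm : ∀ p : Polynomial ℂ, Measurable fun w : ℂ => p.eval w :=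
    fun p => p.continuous.measurable
  have hζm := hpm ζ
  have hA0 : 0 ≤ A := by
    have h0 := (norm_nonneg _).trans (hA 0)
    have : (0 : ℝ) < 1 + ‖(0 : ℂ)‖ ^ r := by positivity
    exact nonneg_of_mul_nonneg_left h0 this
  obtain ⟨δ, hδ, hδA⟩ : ∃ δ : ℝ, 0 < δ ∧ δ * A ≤ γ / 4 := by
    refine ⟨γ / 4 / (A + 1), by positivity, ?_⟩
    rw [div_mul_eq_mul_div, div_le_iff₀ (by positivity)]
    nlinarith
  have gB : Gr r (γ / 4) fun w => Real.exp (δ * ‖ζ.eval w‖) := (Gr.exp_norm hδ.le hA).mono hδA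
  have hB : ∀ k : ℕ, Integrable (fun w : ℂ => ‖w ^ k‖ * Real.exp (δ * ‖ζ.eval w‖)) lam := by
    intro k
    have g := ((Gr.pow hr (ε := γ / 4) (by positivity) k).of_norm_le (g := fun w => ‖w ^ k‖)
      (by intro w; simp)).mul gB
    exact g.integrable (by linarith) hI (Measurable.aestronglyMeasurable (by fun_prop))
  have hB2 : ∀ k : ℕ, Integrable (fun w : ℂ => ‖w ^ k‖ * ‖ζ.eval w‖ * Real.exp (δ * ‖ζ.eval w‖)) lam := by
    intro k
    have g := (((Gr.pow hr (ε := γ / 4) (by positivity) k).mul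
      (Gr.poly hr (ε := γ / 4) (by positivity) ζ)).of_norm_le (g := fun w => ‖w ^ k‖ * ‖ζ.eval w‖)
      (by intro w; simp)).mul gB
    exact g.integrable (by linarith) hI (Measurable.aestronglyMeasurable (by fun_prop))
  let U : Set ℂ := {s | |s.im| < δ}
  have hUo : IsOpen U := isOpen_lt (by fun_prop) continuous_const
  have hUc : IsPreconnected U := by
    have : U = Complex.imLm ⁻¹' (Set.Ioo (-δ) δ) := by
      ext s; simp [U, abs_lt]
    rw [this]
    exact ((convex_Ioo (-δ) δ).linear_preimage Complex.imLm).isPreconnected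
  let D : ℂ → ℂ := fun s => (Matrix.of fun a b : Fin r => ∫ w, (w ^ a.1 * (starRingEnd ℂ) w ^ b.1 * u w) *
      Complex.exp (s * (((ζ.eval w).re : ℂ) * Complex.I)) ∂lam).det
  have hD : DifferentiableOn ℂ D U := by
    have hent : ∀ a b : Fin r, DifferentiableOn ℂ (fun s => ∫ w, (w ^ a.1 * (starRingEnd ℂ) w ^ b.1 * u w) *
      Complex.exp (s * (((ζ.eval w).re : ℂ) * Complex.I)) ∂lam) U := by
      intro a b s hs
      refine (deriv_int (B := fun w => Real.exp (δ * ‖ζ.eval w‖)) hUo (by fun_prop) (by fun_prop) ?_ ?_ ?_ hs).differentiableAt.differentiableWithinAt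
      · intro s hs w
        rw [Complex.norm_exp]
        apply Real.exp_le_exp.2
        have e : (s * (((ζ.eval w).re : ℂ) * Complex.I)).re = -(s.im * (ζ.eval w).re) := by simp
        rw [e]
        calc _ ≤ |s.im * (ζ.eval w).re| := neg_le_abs _
          _ = |s.im| * |(ζ.eval w).re| := abs_mul _ _
          _ ≤ _ := by
            gcongr
            · exact le_of_lt hs
            · exact Complex.abs_re_le_norm _
      · refine (hB (a.1 + b.1)).mono' (Measurable.aestronglyMeasurable (by fun_prop)) ?_
        filter_upwards with w
        rw [Real.norm_eq_abs, abs_of_nonneg (by positivity)]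
        gcongr
        rw [pow_add, norm_mul, norm_mul, norm_mul]
        simp only [norm_pow, RCLike.norm_conj]
        exact mul_le_of_le_one_right (by positivity) (hu1 w)
      · refine (hB2 (a.1 + b.1)).mono' (Measurable.aestronglyMeasurable (by fun_prop)) ?_
        filter_upwards with w
        rw [Real.norm_eq_abs, abs_of_nonneg (by positivity)]
        rw [norm_mul (_ * _) (_ * Complex.I)]
        gcongr
        · rw [pow_add, norm_mul, norm_mul, norm_mul]
          simp only [norm_pow, RCLike.norm_conj]
          exact mul_le_of_le_one_right (by positivity) (hu1 w)
        · simpa using Complex.abs_re_le_norm _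
    simp only [D, Matrix.det_apply, Matrix.of_apply]
    refine DifferentiableOn.fun_sum fun σ _ => DifferentiableOn.const_smul ?_ _
    exact DifferentiableOn.fun_finsetProd fun i _ => hent _ _
  have hz := (hD.analyticOnNhd hUo).eqOn_zero_of_preconnected_of_eventuallyEq_zero hUc
    (z₀ := 0) (by simpa [U] using hδ) (by
      filter_upwards [Metric.closedBall_mem_nhds (0 : ℂ) hδ] with s hs
      exact det_zero_small hr hγ hI hu hu1 hdet ζ hδ.le hB s (by simpa using hs))
  have h1 := hz (x := 1) (by simpa [U] using hδ)
  simpa [D] using h1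

theorem andreief {r : ℕ} {lam : Measure ℂ} [IsFiniteMeasure lam] {f : ℂ → ℂ}
    (hint : ∀ a b : ℕ, Integrable (fun w => w ^ a * (starRingEnd ℂ) w ^ b * f w) lam)
    (hdet : (Matrix.of fun a b : Fin r => ∫ w, w ^ a.1 * (starRingEnd ℂ) w ^ b.1 * f w ∂lam).det = 0) :
    Integrable (symW (r := r) f) (Measure.pi fun _ => lam) ∧
      ∫ x, symW (r := r) f x ∂(Measure.pi fun _ => lam) = 0 := by
  have hpt : ∀ x : Fin r → ℂ, symW f x = ∑ π : Equiv.Perm (Fin r), ∑ τ : Equiv.Perm (Fin r),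
      ((Equiv.Perm.sign π : ℤ) : ℂ) * (((Equiv.Perm.sign τ : ℤ) : ℂ) *
        ∏ i, (x i ^ (τ i).1 * (starRingEnd ℂ) (x i) ^ (π i).1 * f (x i))) := by
    intro x
    have hV : (Matrix.vandermonde x).det = ∑ τ : Equiv.Perm (Fin r), ((Equiv.Perm.sign τ : ℤ) : ℂ) *
        ∏ i, x i ^ (τ i).1 := by
      rw [← Matrix.det_transpose, Matrix.det_apply']
      rfl
    unfold symW
    rw [hV]
    simp only [map_sum, map_mul, map_prod, map_pow, map_intCast]
    rw [mul_comm (∑ _, _) (∑ _, _), Finset.sum_mul_sum, Finset.sum_mul]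
    apply Finset.sum_congr rfl; intro π _
    rw [Finset.sum_mul]
    apply Finset.sum_congr rfl; intro τ _
    rw [Finset.prod_mul_distrib, Finset.prod_mul_distrib]
    ring
  have hi : ∀ π τ : Equiv.Perm (Fin r), Integrable (fun x : Fin r → ℂ =>
      ((Equiv.Perm.sign π : ℤ) : ℂ) * (((Equiv.Perm.sign τ : ℤ) : ℂ) *
        ∏ i, (x i ^ (τ i).1 * (starRingEnd ℂ) (x i) ^ (π i).1 * f (x i)))) (Measure.pi fun _ => lam) := by
    intro π τ
    refine Integrable.const_mul (Integrable.const_mul ?_ _) _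
    exact Integrable.fintype_prod (f := fun (i : Fin r) (w : ℂ) =>
      w ^ (τ i).1 * (starRingEnd ℂ) w ^ (π i).1 * f w) fun i => hint _ _
  have hfun : symW (r := r) f = fun x => ∑ π : Equiv.Perm (Fin r), ∑ τ : Equiv.Perm (Fin r),
      ((Equiv.Perm.sign π : ℤ) : ℂ) * (((Equiv.Perm.sign τ : ℤ) : ℂ) *
        ∏ i, (x i ^ (τ i).1 * (starRingEnd ℂ) (x i) ^ (π i).1 * f (x i))) := funext hpt
  rw [hfun]
  refine ⟨integrable_finsetSum _ fun π _ => integrable_finsetSum _ fun τ _ => hi π τ, ?_⟩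
  rw [integral_finsetSum _ fun π _ => integrable_finsetSum _ fun τ _ => hi π τ]
  apply Finset.sum_eq_zero
  intro π _
  rw [integral_finsetSum _ fun τ _ => hi π τ]
  simp_rw [integral_const_mul]
  rw [← Finset.mul_sum]
  have : ∀ τ : Equiv.Perm (Fin r), ∫ x : Fin r → ℂ,
      ∏ i, (x i ^ (τ i).1 * (starRingEnd ℂ) (x i) ^ (π i).1 * f (x i)) ∂(Measure.pi fun _ => lam)
      = ∏ i, ((Matrix.of fun a b : Fin r => ∫ w, w ^ a.1 * (starRingEnd ℂ) w ^ b.1 * f w ∂lam).submatrix id π) (τ i) i := by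
    intro τ
    exact integral_fintype_prod_eq_prod (𝕜 := ℂ) (fun (i : Fin r) (w : ℂ) =>
      w ^ (τ i).1 * (starRingEnd ℂ) w ^ (π i).1 * f w)
  simp_rw [this]
  rw [← Matrix.det_apply', Matrix.det_permute', hdet]
  simp

theorem core {r : ℕ} (hr : 0 < r) {γ : ℝ} (hγ : 0 < γ) {lam : Measure ℂ} [IsFiniteMeasure lam]
    (hI : Integrable (fun w : ℂ => Real.exp (γ * ‖w‖ ^ r)) lam) {u : ℂ → ℂ} (hu : Measurable u)
    (hu1 : ∀ w, ‖u w‖ ≤ 1) (hu0 : ∀ᵐ w ∂lam, u w ≠ 0)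
    (hker : ∀ p : Fin r → Polynomial ℂ, ∃ α : Fin r → ℂ, α ≠ 0 ∧
      ∀ z, ∫ w, ((∑ a, α a * (p a).eval w) * u w) * Complex.exp (z * (starRingEnd ℂ) w) ∂lam = 0) :
    ∃ S : Finset ℂ, S.card < r ∧ lam (S : Set ℂ)ᶜ = 0 := by
  have hc := conj_measurable
  have hdet := det_zero_poly hr hγ hI hu hu1 hker
  have hi0 : ∀ a b : ℕ, Integrable (fun w => w ^ a * (starRingEnd ℂ) w ^ b * u w) lam := by
    intro a b
    have g := (Gr.pow hr (ε := γ) (by positivity) (a + b)).of_norm_le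
      (g := fun w => w ^ a * (starRingEnd ℂ) w ^ b * u w) (by
        intro w
        simp only [norm_mul, norm_pow, RCLike.norm_conj, pow_add]
        exact mul_le_of_le_one_right (by positivity) (hu1 w))
    exact g.integrable le_rfl hI (Measurable.aestronglyMeasurable (by fun_prop))
  have hsm : Measurable (symW (r := r) u) := by
    have hcd : Continuous fun x : Fin r → ℂ => (Matrix.vandermonde x).det := by
      apply Continuous.matrix_det
      apply continuous_matrix
      intro i j
      simp only [Matrix.vandermonde_apply]
      fun_prop
    have h1 := hcd.measurable
    have h2 := hc.comp h1
    simp only [Function.comp_def] at h2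
    unfold symW
    fun_prop
  let P : (Fin r → ℂ) → (Fin r → ℂ) := fun x k => ∑ i, x i ^ (k.1 + 1)
  have hPm : Measurable P := by
    apply Continuous.measurable
    fun_prop
  have hmain : ∀ L : StrongDual ℝ (Fin r → ℂ), Integrable (symW (r := r) u) (Measure.pi fun _ => lam) ∧
      ∫ x, symW (r := r) u x * Complex.exp (L (P x) * Complex.I) ∂(Measure.pi fun _ => lam) = 0 := by
    intro L
    let ξ : Fin r → ℂ := fun k =>
      (L (Pi.single k 1) : ℂ) - Complex.I * (L (Pi.single k Complex.I) : ℂ)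
    have hL : ∀ y : Fin r → ℂ, L y = (∑ k, ξ k * y k).re := by
      intro y
      have hy : y = ∑ k, ((y k).re • (Pi.single k (1 : ℂ) : Fin r → ℂ)
          + (y k).im • (Pi.single k Complex.I : Fin r → ℂ)) := by
        have : ∀ k, ((y k).re • (Pi.single k (1 : ℂ) : Fin r → ℂ)
          + (y k).im • (Pi.single k Complex.I : Fin r → ℂ)) = Pi.single k (y k) := by
          intro k
          rw [← Pi.single_smul', ← Pi.single_smul', ← Pi.single_add]
          congr 1
          simp [Complex.re_add_im]
        simp_rw [this]
        exact (Finset.univ_sum_single y).symm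
      conv_lhs => rw [hy]
      rw [map_sum, Complex.re_sum]
      apply Finset.sum_congr rfl
      intro k _
      simp [ξ]
      ring
    let ζ : Polynomial ℂ := ∑ k : Fin r, C (ξ k) * X ^ (k.1 + 1)
    have hζ : ∀ w, ζ.eval w = ∑ k : Fin r, ξ k * w ^ (k.1 + 1) := by
      intro w; simp [ζ, Polynomial.eval_finsetSum]
    have hA : ∀ w : ℂ, ‖ζ.eval w‖ ≤ (∑ k, ‖ξ k‖) * (1 + ‖w‖ ^ r) := by
      intro w
      rw [hζ, Finset.sum_mul]
      refine (norm_sum_le _ _).trans (Finset.sum_le_sum fun k _ => ?_)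
      rw [norm_mul, norm_pow]
      gcongr
      exact le_one_add_pow ‖w‖ (norm_nonneg w) k.2
    have hLP : ∀ x : Fin r → ℂ, L (P x) = ∑ i, (ζ.eval (x i)).re := by
      intro x
      rw [hL, ← Complex.re_sum]
      congr 1
      simp_rw [hζ, P, Finset.mul_sum]
      exact Finset.sum_comm
    have hd := det_zero_all hr hγ hI hu hu1 hdet ζ hA
    have hfu : ∀ x : Fin r → ℂ, symW (r := r) u x * Complex.exp (L (P x) * Complex.I) =
        symW (r := r) (fun w => u w * Complex.exp (((ζ.eval w).re : ℂ) * Complex.I)) x := by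
      intro x
      unfold symW
      rw [Finset.prod_mul_distrib, ← Complex.exp_sum, hLP, Complex.ofReal_sum, Finset.sum_mul]
      ring
    have hζm : Measurable fun w : ℂ => ζ.eval w := ζ.continuous.measurable
    have hA1 := andreief (r := r) (lam := lam)
      (f := fun w => u w * Complex.exp (((ζ.eval w).re : ℂ) * Complex.I)) (by
        intro a b
        refine (hi0 a b).mono (Measurable.aestronglyMeasurable (by fun_prop)) ?_
        filter_upwards with w
        rw [norm_mul, norm_mul (_ * _) (u w), norm_mul (u w), Complex.norm_exp_ofReal_mul_I, mul_one]) (by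
        simpa only [mul_assoc] using hd)
    refine ⟨?_, by simp_rw [hfu]; exact hA1.2⟩
    refine hA1.1.mono hsm.aestronglyMeasurable ?_
    filter_upwards with x
    rw [← hfu, norm_mul, Complex.norm_exp_ofReal_mul_I, mul_one]
  have hInt : Integrable (symW (r := r) u) (Measure.pi fun _ => lam) := (hmain 0).1
  have hae := fourier_ae_zero (Measure.pi fun _ : Fin r => lam) P hPm (symW u) hsm hInt (by
    intro x y hxy
    exact symW_symm u x y (perm_of_psum x y fun k => congrFun hxy k)) fun L => (hmain L).2
  apply support_small
  have hu0' : ∀ᵐ x ∂(Measure.pi fun _ : Fin r => lam), ∀ i, u (x i) ≠ 0 := by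
    rw [ae_all_iff]
    intro i
    exact (Measure.quasiMeasurePreserving_eval (μ := fun _ : Fin r => lam) i).ae hu0
  filter_upwards [hae, hu0'] with x h1 h2
  unfold symW at h1
  simpa [Finset.prod_eq_zero_iff, h2] using h1

/-- Finite rank theorem: if `e^{γ|z|^r}|ν|` is finite and the Toeplitz operator `T_ν` has
rank `< r`, then `ν` is a linear combination of fewer than `r` point masses. -/
theorem finite_rank_toeplitz_point_masses
    (r : ℕ) (hr : 0 < r)
    (μ : Measure ℂ) (ρ : ℂ → ℂ) (hρ : Measurable ρ)
    (γ : ℝ) (hγ : 0 < γ)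
    (hfin : ∫⁻ z, ENNReal.ofReal (Real.exp (γ * ‖z‖ ^ r)) * ‖ρ z‖₊ ∂μ < ⊤)
    (hrank : ∃ m : ℕ, m < r ∧ ∃ (g : Fin m → ℂ → ℂ) (c : Polynomial ℂ → Fin m → ℂ),
      ∀ (p : Polynomial ℂ) (z : ℂ), toeplitzMeasure μ ρ p z = ∑ i, c p i * g i z) :
    ∃ m : ℕ, m < r ∧ ∃ (pts : Fin m → ℂ) (coef : Fin m → ℂ),
      ∀ s : Set ℂ, MeasurableSet s →
        ∫ z in s, ρ z ∂μ = ∑ i, Set.indicator s (fun _ => coef i) (pts i) := by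
  classical
  obtain ⟨m, hm, g, c, hT⟩ := hrank
  have hc := conj_measurable
  have hnm : Measurable fun z => ‖ρ z‖₊ := hρ.nnnorm
  set lam : Measure ℂ := μ.withDensity fun z => (‖ρ z‖₊ : ENNReal) with hlam
  have hfin1 : ∫⁻ z, (‖ρ z‖₊ : ENNReal) ∂μ < ⊤ := by
    refine lt_of_le_of_lt (lintegral_mono fun z => ?_) hfin
    have : (1 : ENNReal) ≤ ENNReal.ofReal (Real.exp (γ * ‖z‖ ^ r)) := by
      rw [ENNReal.one_le_ofReal]
      exact Real.one_le_exp (by positivity)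
    calc (‖ρ z‖₊ : ENNReal) = 1 * ‖ρ z‖₊ := (one_mul _).symm
      _ ≤ _ := by gcongr
  have : IsFiniteMeasure lam := isFiniteMeasure_withDensity hfin1.ne
  have hI : Integrable (fun w : ℂ => Real.exp (γ * ‖w‖ ^ r)) lam := by
    refine ⟨Measurable.aestronglyMeasurable (by fun_prop), ?_⟩
    rw [hasFiniteIntegral_iff_ofReal (Filter.Eventually.of_forall fun w => (Real.exp_pos _).le), hlam,
      lintegral_withDensity_eq_lintegral_mul _ (by fun_prop) (by fun_prop)]
    refine lt_of_le_of_lt (le_of_eq ?_) hfin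
    refine lintegral_congr fun z => ?_
    simp only [Pi.mul_apply]
    rw [mul_comm]
  let v : ℂ → ℂ := fun w => ρ w / (‖ρ w‖ : ℂ)
  have hv : Measurable v := by
    have : Measurable fun w => (‖ρ w‖ : ℂ) := Complex.measurable_ofReal.comp hρ.norm
    exact hρ.div this
  have hv1 : ∀ w, ‖v w‖ ≤ 1 := by
    intro w
    simp only [v, norm_div, Complex.norm_real, norm_norm]
    exact div_self_le_one _
  have hvρ : ∀ w, (‖ρ w‖ : ℂ) * v w = ρ w := by
    intro w
    by_cases h0 : ρ w = 0
    · simp [v, h0]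
    · have : (‖ρ w‖ : ℂ) ≠ 0 := by simpa using h0
      simp only [v]; field_simp
  have hne : ∀ᵐ w ∂lam, ρ w ≠ 0 := by
    rw [hlam, ae_withDensity_iff (by fun_prop)]
    filter_upwards with w hw h0
    simp [h0] at hw
  let u : ℂ → ℂ := fun w => (Real.exp (-‖w‖ ^ 2) : ℂ) * v w
  have hu : Measurable u := by
    have : Measurable fun w : ℂ => (Real.exp (-‖w‖ ^ 2) : ℂ) :=
      Complex.measurable_ofReal.comp (by fun_prop)
    exact this.mul hv
  have hun : ∀ w, ‖u w‖ ≤ Real.exp (-‖w‖ ^ 2) := by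
    intro w
    simp only [u, norm_mul, Complex.norm_real, Real.norm_eq_abs, Real.abs_exp]
    exact mul_le_of_le_one_right (Real.exp_pos _).le (hv1 w)
  have hu1 : ∀ w, ‖u w‖ ≤ 1 := fun w => (hun w).trans (Real.exp_le_one_iff.2 (by
    have := sq_nonneg ‖w‖
    linarith))
  have hu0 : ∀ᵐ w ∂lam, u w ≠ 0 := by
    filter_upwards [hne] with w hw
    have h1 : (‖ρ w‖ : ℂ) ≠ 0 := by simpa using hw
    simp only [u, v]
    refine mul_ne_zero ?_ (div_ne_zero hw h1)
    exact_mod_cast (Real.exp_pos _).ne'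
  have hTl : ∀ (p : Polynomial ℂ) (z : ℂ),
      ∫ w, p.eval w * u w * Complex.exp (z * (starRingEnd ℂ) w) ∂lam = Real.pi * ∑ i, c p i * g i z := by
    intro p z
    rw [← hT p z, toeplitzMeasure, ← mul_assoc, mul_inv_cancel₀ (by exact_mod_cast Real.pi_ne_zero),
      one_mul, hlam, integral_withDensity_eq_integral_smul hnm]
    congr 1; ext w
    rw [NNReal.smul_def, coe_nnnorm, Complex.real_smul]
    conv_rhs => rw [← hvρ w]
    simp only [u]; ring
  have hint : ∀ (p : Polynomial ℂ) (z : ℂ),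
      Integrable (fun w => p.eval w * u w * Complex.exp (z * (starRingEnd ℂ) w)) lam := by
    intro p z
    have h1 : Gr r 0 fun w => u w * Complex.exp (z * (starRingEnd ℂ) w) := by
      refine ⟨Real.exp (‖z‖ ^ 2), fun w => ?_⟩
      have e1 : ‖Complex.exp (z * (starRingEnd ℂ) w)‖ ≤ Real.exp (‖z‖ * ‖w‖) := by
        rw [Complex.norm_exp]
        apply Real.exp_le_exp.2
        refine (Complex.re_le_norm _).trans (le_of_eq (by simp))
      rw [norm_mul]
      calc _ ≤ Real.exp (-‖w‖ ^ 2) * Real.exp (‖z‖ * ‖w‖) := by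
            gcongr
            exact hun w
        _ ≤ _ := by
            rw [← Real.exp_add, ← Real.exp_add]
            apply Real.exp_le_exp.2
            nlinarith [sq_nonneg (‖z‖ - ‖w‖), sq_nonneg ‖z‖, sq_nonneg ‖w‖]
    have h2 := (Gr.poly hr (ε := γ) hγ p).mul h1
    simp only [← mul_assoc] at h2
    refine h2.integrable (by linarith) hI ?_
    have hp : Measurable fun w : ℂ => p.eval w := p.continuous.measurable
    exact Measurable.aestronglyMeasurable (by fun_prop)
  have hker : ∀ p : Fin r → Polynomial ℂ, ∃ α : Fin r → ℂ, α ≠ 0 ∧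
      ∀ z, ∫ w, ((∑ a, α a * (p a).eval w) * u w) * Complex.exp (z * (starRingEnd ℂ) w) ∂lam = 0 := by
    intro p
    have hnl : ¬ LinearIndependent ℂ (fun a => c (p a)) := by
      intro hli
      have := hli.fintype_card_le_finrank
      simp at this
      omega
    rw [Fintype.not_linearIndependent_iff] at hnl
    obtain ⟨α, hα, i, hi⟩ := hnl
    refine ⟨α, fun h => hi (by rw [h]; rfl), fun z => ?_⟩
    have e : ∀ w, ((∑ a, α a * (p a).eval w) * u w) * Complex.exp (z * (starRingEnd ℂ) w)
        = ∑ a, α a * ((p a).eval w * u w * Complex.exp (z * (starRingEnd ℂ) w)) := by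
      intro w
      rw [Finset.sum_mul, Finset.sum_mul]
      apply Finset.sum_congr rfl
      intro a _; ring
    simp_rw [e]
    rw [integral_finsetSum _ fun a _ => (hint (p a) z).const_mul _]
    simp_rw [integral_const_mul, hTl]
    have e2 : ∀ a, α a * ((Real.pi : ℂ) * ∑ i, c (p a) i * g i z)
        = ∑ i, (Real.pi : ℂ) * g i z * (α a * c (p a) i) := by
      intro a
      rw [Finset.mul_sum, Finset.mul_sum]
      apply Finset.sum_congr rfl
      intro i _; ring
    simp_rw [e2]
    rw [Finset.sum_comm]
    apply Finset.sum_eq_zero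
    intro i _
    rw [← Finset.mul_sum]
    have := congrFun hα i
    simp at this
    rw [this, mul_zero]
  obtain ⟨S, hS, hS0⟩ := core hr hγ hI hu hu1 hu0 hker
  refine ⟨S.card, hS, fun i => (S.equivFin.symm i : ℂ),
    fun i => lam.real {(S.equivFin.symm i : ℂ)} • v (S.equivFin.symm i), fun s hs => ?_⟩
  have h1 : ∫ z in s, ρ z ∂μ = ∫ z in s, v z ∂lam := by
    rw [hlam, setIntegral_withDensity_eq_setIntegral_smul hnm _ hs]
    congr 1; ext w
    rw [NNReal.smul_def, coe_nnnorm, Complex.real_smul, hvρ]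
  have hvi : Integrable v lam :=
    (integrable_const (1 : ℝ)).mono' hv.aestronglyMeasurable (Filter.Eventually.of_forall hv1)
  have h2 : lam.restrict (S : Set ℂ) = lam := by
    rw [Measure.restrict_eq_self_of_ae_mem]
    exact hS0
  have h3 : ∫ z, s.indicator v z ∂lam = ∫ z in (S : Set ℂ), s.indicator v z ∂lam := by rw [h2]
  rw [h1, ← integral_indicator hs, h3, setIntegral_finset S (hvi.indicator hs).integrableOn,
    ← Finset.sum_coe_sort, ← S.equivFin.symm.sum_comp]
  apply Finset.sum_congr rfl
  intro i _
  by_cases hi : (S.equivFin.symm i : ℂ) ∈ s <;> simp [hi]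
end
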